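/- Let Ω ⊆ ℝ^N be open and let A ⊆ Ω be a measurable set of finite perimeter in Ω. Then for every ε > 0 there exists an open set U ⊆ Ω such that U ⊇ A^{(1)}, λ^N(U \ A) < ε, and |P(U,Ω) − P(A,Ω)| < ε. Here A^{(1)} denotes the set of points x ∈ Ω where A has density 1, i.e. λ^N(A∩B_ρ(x))/λ^N(B_ρ(x)) → 1 as ρ → 0⁺. -/

import Mathlib

open MeasureTheory Metric Filter Set
open scoped ENNReal Topology symmDiff

noncomputable section

abbrev Euc (N : ℕ) : Type := EuclideanSpace ℝ (Fin N)

variable {N : ℕ}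

/-- The divergence of a vector field `φ : ℝ^N → ℝ^N`. -/
def diverg (φ : Euc N → Euc N) (x : Euc N) : ℝ :=
  ∑ i : Fin N, fderiv ℝ φ x (EuclideanSpace.single i 1) i

/-- The admissible test vector fields for the variation in `Ω`:
`C^1`, compactly supported in `Ω`, with `‖φ‖ ≤ 1`. -/
def TestVF (Ω : Set (Euc N)) : Set (Euc N → Euc N) :=
  {φ | ContDiff ℝ 1 φ ∧ HasCompactSupport φ ∧ tsupport φ ⊆ Ω ∧ ∀ x, ‖φ x‖ ≤ 1}

/-- The total variation `V(u, Ω)`. -/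
def variation (u : Euc N → ℝ) (Ω : Set (Euc N)) : ℝ≥0∞ :=
  ⨆ φ ∈ TestVF Ω, ENNReal.ofReal (∫ x in Ω, u x * diverg φ x)

/-- The perimeter `P(A, Ω)` of `A` in `Ω`. -/
def perimeter (A Ω : Set (Euc N)) : ℝ≥0∞ :=
  ⨆ φ ∈ TestVF Ω, ENNReal.ofReal (∫ x in A, diverg φ x)

/-- `u ∈ BV(Ω)`. -/
def MemBV (u : Euc N → ℝ) (Ω : Set (Euc N)) : Prop :=
  IntegrableOn u Ω volume ∧ variation u Ω < ⊤

/-- `u ∈ BV_loc(Ω)`. -/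
def MemBVloc (u : Euc N → ℝ) (Ω : Set (Euc N)) : Prop :=
  ∀ Ω' : Set (Euc N), IsOpen Ω' → IsCompact (closure Ω') → closure Ω' ⊆ Ω → MemBV u Ω'

/-- `u ∈ GBV(Ω)`: measurable, and every truncation `(-m) ∨ u ∧ m` is in `BV_loc(Ω)`. -/
def MemGBV (u : Euc N → ℝ) (Ω : Set (Euc N)) : Prop :=
  AEMeasurable u (volume.restrict Ω) ∧
    ∀ m : ℝ, 0 < m → MemBVloc (fun x => max (-m) (min (u x) m)) Ω

/-- `A` has locally finite perimeter in `Ω`. -/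
def HasLocFinPerimeter (A Ω : Set (Euc N)) : Prop :=
  ∀ Ω' : Set (Euc N), IsOpen Ω' → IsCompact (closure Ω') → closure Ω' ⊆ Ω →
    perimeter A Ω' < ⊤

/-- `A` has density `t` at `x`. -/
def HasDensity (A : Set (Euc N)) (x : Euc N) (t : ℝ) : Prop :=
  Tendsto (fun ρ : ℝ => volume (A ∩ ball x ρ) / volume (ball x ρ)) (𝓝[>] 0)
    (𝓝 (ENNReal.ofReal t))

/-- The approximate upper limit `u⁺(x)` of `u` at `x` (relative to `Ω`), with `inf ∅ = ⊤`. -/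
def approxUpper (u : Euc N → ℝ) (Ω : Set (Euc N)) (x : Euc N) : EReal :=
  sInf {t : EReal | ∃ s : ℝ, t = (s : EReal) ∧ HasDensity {y | y ∈ Ω ∧ s < u y} x 0}

/-- The approximate lower limit `u⁻(x)` of `u` at `x` (relative to `Ω`), with `sup ∅ = ⊥`. -/
def approxLower (u : Euc N → ℝ) (Ω : Set (Euc N)) (x : Euc N) : EReal :=
  sSup {t : EReal | ∃ s : ℝ, t = (s : EReal) ∧ HasDensity {y | y ∈ Ω ∧ u y < s} x 0}

/-- The approximate limit `ũ(x)` exists (i.e. `u⁺(x) = u⁻(x)`) and is `+∞`. -/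
def HasApproxLimitTop (u : Euc N → ℝ) (Ω : Set (Euc N)) (x : Euc N) : Prop :=
  approxUpper u Ω x = ⊤ ∧ approxLower u Ω x = ⊤

/-- The approximate limit `ũ(x)` exists and `|ũ(x)| = +∞`. -/
def HasInfApproxLimit (u : Euc N → ℝ) (Ω : Set (Euc N)) (x : Euc N) : Prop :=
  (approxUpper u Ω x = ⊤ ∧ approxLower u Ω x = ⊤) ∨
    (approxUpper u Ω x = ⊥ ∧ approxLower u Ω x = ⊥)

/-- `C` is `L⁰`-polar in `Ω`. -/
def L0Polar (C Ω : Set (Euc N)) : Prop :=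
  ∃ u : Euc N → ℝ, AEMeasurable u (volume.restrict Ω) ∧
    C ⊆ {x | x ∈ Ω ∧ HasInfApproxLimit u Ω x}

/-- `C` is `BV`-polar in `Ω`. -/
def BVPolar (C Ω : Set (Euc N)) : Prop :=
  ∃ u : Euc N → ℝ, MemBV u Ω ∧ C ⊆ {x | x ∈ Ω ∧ HasInfApproxLimit u Ω x}

/-- `C` is `GBV`-polar in `Ω`. -/
def GBVPolar (C Ω : Set (Euc N)) : Prop :=
  ∃ u : Euc N → ℝ, MemGBV u Ω ∧ C ⊆ {x | x ∈ Ω ∧ HasInfApproxLimit u Ω x}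

/-- The set `A^{(1)}` of points of `Ω` where `A` has density `1`. -/
def densityOne (A Ω : Set (Euc N)) : Set (Euc N) :=
  {x | x ∈ Ω ∧ HasDensity A x 1}

lemma diverg_continuousOn {Ω : Set (Euc N)} (hΩ : IsOpen Ω) {φ : Euc N → Euc N}
    (h : ContDiffOn ℝ 1 φ Ω) : ContinuousOn (diverg φ) Ω := by
  have h1 : ContinuousOn (fderiv ℝ φ) Ω := h.continuousOn_fderiv_of_isOpen hΩ le_rfl
  unfold diverg
  refine continuousOn_finsetSum _ fun i _ => ?_
  have h2 : ContinuousOn (fun x => fderiv ℝ φ x (EuclideanSpace.single i 1)) Ω :=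
    h1.clm_apply continuousOn_const
  exact (EuclideanSpace.proj (𝕜 := ℝ) i).continuous.comp_continuousOn h2

lemma diverg_continuous {φ : Euc N → Euc N} (h : ContDiff ℝ 1 φ) : Continuous (diverg φ) := by
  rw [← continuousOn_univ]
  exact diverg_continuousOn isOpen_univ h.contDiffOn

lemma diverg_eq_zero {φ : Euc N → Euc N} {x : Euc N} (hx : x ∉ tsupport φ) :
    diverg φ x = 0 := by
  have : fderiv ℝ φ x = 0 := by
    have := notMem_tsupport_iff_eventuallyEq.1 hx
    rw [this.fderiv_eq]; simp
  simp [diverg, this]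

lemma diverg_hasCompactSupport {φ : Euc N → Euc N} (h : HasCompactSupport φ) :
    HasCompactSupport (diverg φ) :=
  HasCompactSupport.intro h fun _ hx => diverg_eq_zero hx

lemma diverg_integrable {φ : Euc N → Euc N} (h : ContDiff ℝ 1 φ) (hc : HasCompactSupport φ) :
    Integrable (diverg φ) :=
  (diverg_continuous h).integrable_of_hasCompactSupport (diverg_hasCompactSupport hc)

lemma diverg_bound {φ : Euc N → Euc N} (h : ContDiff ℝ 1 φ) (hc : HasCompactSupport φ) :
    ∃ D : ℝ, 0 ≤ D ∧ ∀ x, |diverg φ x| ≤ D := by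
  obtain ⟨C, hC⟩ := (diverg_hasCompactSupport hc).exists_bound_of_continuous (diverg_continuous h)
  exact ⟨max C 0, le_max_right _ _, fun x => (hC x).trans (le_max_left _ _)⟩

lemma sum_single_coord (v : Euc N) : ∑ i : Fin N, v i • EuclideanSpace.single i (1:ℝ) = v := by
  ext j
  simp [Finset.sum_apply, Pi.single_apply]

lemma diverg_smul {w : Euc N → ℝ} {φ : Euc N → Euc N} {x : Euc N}
    (hw : DifferentiableAt ℝ w x) (hφ : DifferentiableAt ℝ φ x) :
    diverg (fun y => w y • φ y) x = w x * diverg φ x + fderiv ℝ w x (φ x) := by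
  unfold diverg
  rw [fderiv_fun_smul hw hφ]
  conv_rhs => rw [← sum_single_coord (φ x)]
  simp [Finset.sum_add_distrib, Finset.mul_sum, mul_comm]

lemma diverg_sum {ι : Type*} (s : Finset ι) {φ : ι → Euc N → Euc N} {x : Euc N}
    (hφ : ∀ i ∈ s, DifferentiableAt ℝ (φ i) x) :
    diverg (fun y => ∑ i ∈ s, φ i y) x = ∑ i ∈ s, diverg (φ i) x := by
  unfold diverg
  rw [fderiv_fun_sum hφ, Finset.sum_comm]
  simp

lemma integral_diverg {φ : Euc N → Euc N} (h : ContDiff ℝ 1 φ) (hc : HasCompactSupport φ) :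
    ∫ x, diverg φ x = 0 := by
  have hd : ∀ x, DifferentiableAt ℝ φ x := fun x => h.differentiable one_ne_zero x
  have key : ∀ i : Fin N, Integrable (fun x => fderiv ℝ φ x (EuclideanSpace.single i 1)) := by
    intro i
    refine Continuous.integrable_of_hasCompactSupport ?_ ?_
    · exact (h.continuous_fderiv one_ne_zero).clm_apply continuous_const
    · exact (hc.fderiv_apply ℝ _)
  have h0 : ∀ i : Fin N, ∫ x, fderiv ℝ φ x (EuclideanSpace.single i 1) = 0 := by
    intro i
    have := integral_smul_fderiv_eq_neg_fderiv_smul_of_integrable (μ := (volume : Measure (Euc N)))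
      (f := fun _ : Euc N => (1:ℝ)) (g := φ) (v := EuclideanSpace.single i 1)
      (by simp) (by simpa using key i)
      (by simpa using h.continuous.integrable_of_hasCompactSupport hc)
      (by simp) (by intro x _; exact hd x)
    simpa using this
  unfold diverg
  have key2 : ∀ i : Fin N, Integrable (fun x => fderiv ℝ φ x (EuclideanSpace.single i 1) i) :=
    fun i => (EuclideanSpace.proj (𝕜 := ℝ) i).integrable_comp (key i)
  rw [integral_finsetSum _ (fun i _ => key2 i)]
  refine Finset.sum_eq_zero fun i _ => ?_
  have := (EuclideanSpace.proj (𝕜 := ℝ) i).integral_comp_comm (key i)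
  rw [h0 i, map_zero] at this
  exact this

/-- product of a `C^n` function on `Ω` with a compactly supported field. -/
lemma contDiff_smul_of_tsupport {F : Type*} [NormedAddCommGroup F] [NormedSpace ℝ F]
    {Ω : Set (Euc N)} (hΩ : IsOpen Ω) {n : WithTop ℕ∞}
    {w : Euc N → ℝ} (hw : ContDiffOn ℝ n w Ω) {φ : Euc N → F} (h : ContDiff ℝ n φ)
    (hs : tsupport φ ⊆ Ω) : ContDiff ℝ n (fun x => w x • φ x) := by
  rw [contDiff_iff_contDiffAt]
  intro x
  by_cases hx : x ∈ tsupport φ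
  · exact (hw.contDiffAt (hΩ.mem_nhds (hs hx))).smul h.contDiffAt
  · have h0 : (fun x => w x • φ x) =ᶠ[𝓝 x] fun _ => (0 : F) := by
      filter_upwards [notMem_tsupport_iff_eventuallyEq.1 hx] with y hy
      simp [hy]
    exact contDiffAt_const.congr_of_eventuallyEq h0

lemma tsupport_smul_sub {F : Type*} [NormedAddCommGroup F] [NormedSpace ℝ F]
    (w : Euc N → ℝ) (φ : Euc N → F) : tsupport (fun x => w x • φ x) ⊆ tsupport φ := by
  refine closure_mono ?_
  intro y hy
  simp only [Function.mem_support] at hy ⊢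
  intro h0; apply hy; simp [h0]

lemma hcs_smul {F : Type*} [NormedAddCommGroup F] [NormedSpace ℝ F]
    (w : Euc N → ℝ) {φ : Euc N → F} (h : HasCompactSupport φ) :
    HasCompactSupport (fun x => w x • φ x) :=
  h.mono (by intro y hy; simp only [Function.mem_support] at hy ⊢; intro h0; apply hy; simp [h0])

lemma integrable_of_contOn {F : Type*} [NormedAddCommGroup F] {Ω K : Set (Euc N)}
    {f : Euc N → F} (hf : ContinuousOn f Ω) (hK : IsCompact K) (hKΩ : K ⊆ Ω)
    (h0 : ∀ x, x ∉ K → f x = 0) : Integrable f := by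
  have h1 : IntegrableOn f K := (hf.mono hKΩ).integrableOn_compact hK
  rwa [integrableOn_iff_integrable_of_support_subset] at h1
  intro x hx
  by_contra h
  exact hx (h0 x h)

lemma ibp {Ω : Set (Euc N)} (hΩ : IsOpen Ω) {w : Euc N → ℝ} (hw : ContDiffOn ℝ 1 w Ω)
    {φ : Euc N → Euc N} (h : ContDiff ℝ 1 φ) (hc : HasCompactSupport φ) (hs : tsupport φ ⊆ Ω) :
    Integrable (fun x => w x * diverg φ x) ∧ Integrable (fun x => fderiv ℝ w x (φ x)) ∧
      ∫ x, w x * diverg φ x = - ∫ x, fderiv ℝ w x (φ x) := by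
  have i1 : Integrable (fun x => w x * diverg φ x) := by
    refine integrable_of_contOn (Ω := Ω) (K := tsupport φ) ?_ hc hs ?_
    · exact hw.continuousOn.mul (diverg_continuous h).continuousOn
    · intro x hx; simp [diverg_eq_zero hx]
  have i2 : Integrable (fun x => fderiv ℝ w x (φ x)) := by
    refine integrable_of_contOn (Ω := Ω) (K := tsupport φ) ?_ hc hs ?_
    · exact (hw.continuousOn_fderiv_of_isOpen hΩ le_rfl).clm_apply h.continuous.continuousOn
    · intro x hx; simp [image_eq_zero_of_notMem_tsupport hx]
  refine ⟨i1, i2, ?_⟩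
  have h3 := integral_diverg (contDiff_smul_of_tsupport hΩ hw h hs) (hcs_smul w hc)
  have h4 : ∀ x, diverg (fun y => w y • φ y) x = w x * diverg φ x + fderiv ℝ w x (φ x) := by
    intro x
    by_cases hx : x ∈ tsupport φ
    · exact diverg_smul ((hw.contDiffAt (hΩ.mem_nhds (hs hx))).differentiableAt one_ne_zero)
        (h.differentiable one_ne_zero x)
    · rw [diverg_eq_zero (fun h => hx (tsupport_smul_sub w φ h)), diverg_eq_zero hx,
        image_eq_zero_of_notMem_tsupport hx]
      simp
  simp_rw [h4] at h3
  rw [integral_add i1 i2] at h3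
  linarith

lemma testVF_integral_le {A Ω : Set (Euc N)} (hper : perimeter A Ω < ⊤) {φ : Euc N → Euc N}
    (hφ : φ ∈ TestVF Ω) : ∫ x in A, diverg φ x ≤ (perimeter A Ω).toReal := by
  have : ENNReal.ofReal (∫ x in A, diverg φ x) ≤ perimeter A Ω :=
    le_iSup₂ (f := fun φ (_ : φ ∈ TestVF Ω) => ENNReal.ofReal (∫ x in A, diverg φ x)) φ hφ
  exact (ENNReal.ofReal_le_iff_le_toReal hper.ne).1 this

lemma exists_testVF {A Ω : Set (Euc N)} (hper : perimeter A Ω < ⊤) {δ : ℝ} (hδ : 0 < δ) :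
    ∃ φ ∈ TestVF Ω, (perimeter A Ω).toReal - δ < ∫ x in A, diverg φ x := by
  by_cases h : (perimeter A Ω).toReal - δ < 0
  · refine ⟨fun _ => 0, ⟨contDiff_const, HasCompactSupport.zero, ?_, by simp⟩, ?_⟩
    · have : tsupport (fun _ : Euc N => (0 : Euc N)) = ∅ := tsupport_eq_empty_iff.2 rfl
      rw [this]; exact empty_subset _
    · have : diverg (fun _ : Euc N => (0 : Euc N)) = fun _ => 0 := by
        funext x; simp [diverg]
      simp [this]; linarith
  · push Not at h
    have h1 : ENNReal.ofReal ((perimeter A Ω).toReal - δ) < perimeter A Ω := by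
      conv_rhs => rw [← ENNReal.ofReal_toReal hper.ne]
      exact (ENNReal.ofReal_lt_ofReal_iff_of_nonneg h).2 (by linarith)
    conv_rhs at h1 => unfold perimeter
    simp only [lt_iSup_iff] at h1
    obtain ⟨φ, hφ, h2⟩ := h1
    exact ⟨φ, hφ, (ENNReal.ofReal_lt_ofReal_iff_of_nonneg h).1 h2⟩

lemma perimeter_le_of {A Ω : Set (Euc N)} {c : ℝ} (h : ∀ φ ∈ TestVF Ω, ∫ x in A, diverg φ x ≤ c) :
    perimeter A Ω ≤ ENNReal.ofReal c :=
  iSup₂_le fun φ hφ => ENNReal.ofReal_le_ofReal (h φ hφ)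

/-- standard bump of outer radius `1/(n+1)`. -/
def bmp (N n : ℕ) : ContDiffBump (0 : Euc N) :=
  ⟨1 / (2 * ((n : ℝ) + 1)), 1 / ((n : ℝ) + 1), by positivity, by
    apply one_div_lt_one_div_of_lt <;> nlinarith [(Nat.cast_nonneg n : (0:ℝ) ≤ n)]⟩

/-- the mollifying kernel. -/
def mker (N n : ℕ) : Euc N → ℝ := (bmp N n).normed volume

/-- mollification. -/
def moll {F : Type*} [NormedAddCommGroup F] [NormedSpace ℝ F] (n : ℕ) (f : Euc N → F) :
    Euc N → F :=
  convolution (mker N n) f (ContinuousLinearMap.lsmul ℝ ℝ) volume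

section moll
variable {F : Type*} [NormedAddCommGroup F] [NormedSpace ℝ F]

lemma bmp_rOut_tendsto : Tendsto (fun n => (bmp N n).rOut) atTop (𝓝 0) :=
  tendsto_one_div_add_atTop_nhds_zero_nat

lemma moll_contDiff [CompleteSpace F] (n : ℕ) {f : Euc N → F} (hf : LocallyIntegrable f) :
    ContDiff ℝ 2 (moll n f) :=
  (bmp N n).hasCompactSupport_normed.contDiff_convolution_left _
    ((bmp N n).contDiff_normed (n := 2)) hf

lemma moll_norm_le [CompleteSpace F] (n : ℕ) {f : Euc N → F} (hf : AEStronglyMeasurable f volume)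
    {C : ℝ} (hC : ∀ x, ‖f x‖ ≤ C) (x : Euc N) : ‖moll n f x‖ ≤ C := by
  have h0 : 0 ≤ C := (norm_nonneg _).trans (hC 0)
  have := dist_convolution_le (μ := (volume : Measure (Euc N))) (x₀ := x) (z₀ := (0:F)) h0
    (bmp N n).support_normed_eq.subset (bmp N n).nonneg_normed (bmp N n).integral_normed hf
    (fun y _ => by simpa using hC y)
  simpa [moll, mker] using this

lemma moll_eq_zero [CompleteSpace F] (n : ℕ) {f : Euc N → F} {x : Euc N}
    (hf : ∀ y ∈ ball x (bmp N n).rOut, f y = 0) : moll n f x = 0 := by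
  have hx : f x = 0 := hf x (mem_ball_self (bmp N n).rOut_pos)
  have := (bmp N n).normed_convolution_eq_right (μ := (volume : Measure (Euc N))) (g := f) (x₀ := x)
    (fun y hy => by rw [hf y hy, hx])
  rw [hx] at this
  exact this

lemma moll_L1 [CompleteSpace F] {f : Euc N → F} (hf : Integrable f)
    {C : ℝ} (hC : ∀ x, ‖f x‖ ≤ C) (hc : HasCompactSupport f) :
    Tendsto (fun n => ∫⁻ x, ‖moll n f x - f x‖ₑ) atTop (𝓝 0) := by
  have h0 : 0 ≤ C := (norm_nonneg _).trans (hC 0)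
  have hK : IsCompact (cthickening 1 (tsupport f)) := IsCompact.cthickening hc
  have hae := ContDiffBump.ae_convolution_tendsto_right_of_locallyIntegrable
    (μ := (volume : Measure (Euc N))) (g := f) (φ := bmp N) (l := atTop) (K := 2)
    bmp_rOut_tendsto (Eventually.of_forall fun n => by
      show 1 / ((n:ℝ) + 1) ≤ 2 * (1 / (2 * ((n : ℝ) + 1)))
      have : (0:ℝ) < n + 1 := by positivity
      field_simp; rfl) hf.locallyIntegrable
  have key := tendsto_lintegral_of_dominated_convergence' (μ := (volume : Measure (Euc N)))
    (F := fun n x => ‖moll n f x - f x‖ₑ) (f := fun _ => 0)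
    ((cthickening 1 (tsupport f)).indicator fun _ => ENNReal.ofReal (2 * C)) ?_ ?_ ?_ ?_
  · simpa using key
  · intro n
    exact ((moll_contDiff n hf.locallyIntegrable).continuous.aestronglyMeasurable.sub
      hf.1).enorm
  · intro n
    refine Eventually.of_forall fun x => ?_
    by_cases hx : x ∈ cthickening 1 (tsupport f)
    · simp only [indicator_of_mem hx]
      rw [← ofReal_norm]
      apply ENNReal.ofReal_le_ofReal
      calc ‖moll n f x - f x‖ ≤ ‖moll n f x‖ + ‖f x‖ := norm_sub_le _ _
        _ ≤ 2 * C := by linarith [moll_norm_le n hf.1 hC x, hC x]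
    · have hz : ∀ y ∈ ball x (bmp N n).rOut, f y = 0 := by
        intro y hy
        apply image_eq_zero_of_notMem_tsupport
        intro hy'
        apply hx
        apply mem_cthickening_of_dist_le x y 1 _ hy'
        rw [mem_ball, dist_comm] at hy
        refine hy.le.trans ?_
        show 1 / ((n:ℝ) + 1) ≤ 1
        rw [div_le_one (by positivity)]; linarith [(Nat.cast_nonneg n : (0:ℝ) ≤ n)]
      have hx0 : f x = 0 := hz x (mem_ball_self (bmp N n).rOut_pos)
      simp [moll_eq_zero n hz, hx0]
  · rw [lintegral_indicator (isClosed_cthickening.measurableSet)]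
    simp only [lintegral_const, Measure.restrict_apply MeasurableSet.univ, univ_inter]
    exact ENNReal.mul_ne_top ENNReal.ofReal_ne_top hK.measure_lt_top.ne
  · filter_upwards [hae] with x hx
    have h2 : Tendsto (fun n => moll n f x - f x) atTop (𝓝 0) := by
      rw [← sub_self (f x)]; exact hx.sub_const (f x)
    simpa using h2.enorm

end moll

lemma moll_adj {F : Type*} [NormedAddCommGroup F] [InnerProductSpace ℝ F] [CompleteSpace F]
    (n : ℕ) {f g : Euc N → F} (hf : Integrable f) (hg : Integrable g) :
    ∫ x, inner ℝ (moll n f x) (g x) = ∫ x, inner ℝ (f x) (moll n g x) := by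
  have hk : Continuous (mker N n) := (bmp N n).continuous_normed
  have hks : ∀ x y : Euc N, mker N n (x - y) = mker N n (y - x) := by
    intro x y
    rw [← neg_sub y x]; exact (bmp N n).normed_neg _
  obtain ⟨C, hC⟩ := ((bmp N n).hasCompactSupport_normed (μ := volume)).exists_bound_of_continuous hk
  have e1 : ∀ x, moll n f x = ∫ t, mker N n (x - t) • f t := fun x => convolution_lsmul_swap
  have e2 : ∀ x, moll n g x = ∫ t, mker N n (x - t) • g t := fun x => convolution_lsmul_swap
  have hIntg : ∀ (u : Euc N → F) (x : Euc N), Integrable u →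
      Integrable (fun t => mker N n (x - t) • u t) := by
    intro u x hu
    refine hu.bdd_smul C ?_ ?_
    · exact (hk.comp (continuous_const.sub continuous_id)).aestronglyMeasurable
    · exact Eventually.of_forall fun t => hC _
  have l1 : ∀ x, inner ℝ (moll n f x) (g x) = ∫ t, mker N n (x - t) * inner ℝ (f t) (g x) := by
    intro x
    rw [e1, real_inner_comm, ← integral_inner (hIntg f x hf)]
    simp only [inner_smul_right]
    congr 1; funext t; rw [real_inner_comm]
  have l2 : ∀ x, inner ℝ (f x) (moll n g x) = ∫ t, mker N n (x - t) * inner ℝ (f x) (g t) := by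
    intro x
    rw [e2, ← integral_inner (hIntg g x hg)]
    simp only [inner_smul_right]
  simp_rw [l1, l2]
  have hI : Integrable (fun p : Euc N × Euc N => mker N n (p.1 - p.2) * inner ℝ (f p.2) (g p.1))
      (volume.prod volume) := by
    refine Integrable.bdd_mul (c := C) ?_ ?_ ?_
    · have h1 : Integrable (fun p : Euc N × Euc N => ‖g p.1‖ * ‖f p.2‖) (volume.prod volume) :=
        hg.norm.mul_prod hf.norm
      refine h1.mono ?_ ?_
      · exact AEStronglyMeasurable.inner hf.1.comp_snd hg.1.comp_fst
      · refine Eventually.of_forall fun p => ?_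
        rw [norm_mul, norm_norm, norm_norm, mul_comm]
        exact norm_inner_le_norm _ _
    · exact (hk.comp (continuous_fst.sub continuous_snd)).aestronglyMeasurable
    · exact Eventually.of_forall fun t => hC _
  rw [integral_integral_swap hI]
  congr 1; funext x; congr 1; funext t
  rw [hks]

/-- divergence as a continuous linear functional of the derivative. -/
def divL (N : ℕ) : (Euc N →L[ℝ] Euc N) →L[ℝ] ℝ :=
  ∑ i : Fin N, (EuclideanSpace.proj (𝕜 := ℝ) i).comp
    (ContinuousLinearMap.apply ℝ (Euc N) (EuclideanSpace.single i (1:ℝ)))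

lemma diverg_eq_divL (φ : Euc N → Euc N) (x : Euc N) : diverg φ x = divL N (fderiv ℝ φ x) := by
  simp [diverg, divL]

lemma moll_diverg (n : ℕ) {φ : Euc N → Euc N} (h : ContDiff ℝ 1 φ) (hc : HasCompactSupport φ)
    (x : Euc N) : diverg (moll n φ) x = moll n (diverg φ) x := by
  have hk : Continuous (mker N n) := (bmp N n).continuous_normed
  have h1 := hc.hasFDerivAt_convolution_right (ContinuousLinearMap.lsmul ℝ ℝ)
    (μ := (volume : Measure (Euc N))) (f := mker N n) hk.locallyIntegrable h x
  have h2 : fderiv ℝ (moll n φ) x = ∫ t, mker N n t • fderiv ℝ φ (x - t) := by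
    rw [moll, h1.fderiv, convolution_def]
    congr 1
  rw [diverg_eq_divL, h2, ← ContinuousLinearMap.integral_comp_comm]
  · simp only [map_smul, ← diverg_eq_divL]
    rfl
  · have hkc : HasCompactSupport (mker N n) := (bmp N n).hasCompactSupport_normed
    have hcs : HasCompactSupport (fun t => mker N n t • fderiv ℝ φ (x - t)) := by
      refine HasCompactSupport.intro hkc (fun t ht => ?_)
      have h0 : mker N n t = 0 := image_eq_zero_of_notMem_tsupport ht
      simp only [h0]
      ext v
      simp
    refine Continuous.integrable_of_hasCompactSupport ?_ hcs
    exact hk.smul ((h.continuous_fderiv one_ne_zero).comp (continuous_const.sub continuous_id))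

lemma exhaustion {Ω : Set (Euc N)} (hΩ : IsOpen Ω) :
    ∃ (K : ℕ → Set (Euc N)) (χ : ℕ → Euc N → ℝ), (∀ n, IsCompact (K n)) ∧
      (∀ n, K n ⊆ interior (K (n+1))) ∧ (⋃ n, K n = Ω) ∧ (∀ n, ContDiff ℝ 2 (χ n)) ∧
      (∀ n x, x ∈ K n → χ n x = 1) ∧ (∀ n x, x ∉ interior (K (n+1)) → χ n x = 0) ∧
      (∀ n x, 0 ≤ χ n x ∧ χ n x ≤ 1) := by
  haveI : LocallyCompactSpace Ω := hΩ.locallyCompactSpace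
  haveI : SigmaCompactSpace Ω := sigmaCompactSpace_of_locallyCompact_secondCountable
  let K' : CompactExhaustion Ω := CompactExhaustion.choice Ω
  let K : ℕ → Set (Euc N) := fun n => Subtype.val '' (K' n)
  have hKc : ∀ n, IsCompact (K n) := fun n => (K'.isCompact n).image continuous_subtype_val
  have hKi : ∀ n, K n ⊆ interior (K (n+1)) := fun n =>
    (image_mono (K'.subset_interior_succ n)).trans
      (hΩ.isOpenMap_subtype_val.image_interior_subset _)
  have hU : ⋃ n, K n = Ω := by
    rw [← image_iUnion, K'.iUnion_eq]; simp
  have hχ : ∀ n, ∃ χ : Euc N → ℝ, ContDiff ℝ 2 χ ∧ (∀ x, x ∈ K n → χ x = 1) ∧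
      (∀ x, x ∉ interior (K (n+1)) → χ x = 0) ∧ (∀ x, 0 ≤ χ x ∧ χ x ≤ 1) := by
    intro n
    obtain ⟨f, h0, h1, hf⟩ := exists_contMDiffMap_zero_one_of_isClosed
      (n := 2) (modelWithCornersSelf ℝ (Euc N)) (s := (interior (K (n+1)))ᶜ) (t := K n)
      isOpen_interior.isClosed_compl (hKc n).isClosed
      (disjoint_compl_left_iff_subset.2 (hKi n))
    exact ⟨f, f.contMDiff.contDiff, fun x hx => h1 hx, fun x hx => h0 hx, fun x => hf x⟩
  choose χ a b c d using hχ
  exact ⟨K, χ, hKc, hKi, hU, a, b, c, d⟩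

lemma K_mono {K : ℕ → Set (Euc N)} (hKi : ∀ n, K n ⊆ interior (K (n+1))) : Monotone K :=
  monotone_nat_of_le_succ fun n => (hKi n).trans interior_subset

lemma contDiff_smul_of_tsupport' {F : Type*} [NormedAddCommGroup F] [NormedSpace ℝ F]
    {Ω : Set (Euc N)} (hΩ : IsOpen Ω) {n : WithTop ℕ∞}
    {χ : Euc N → ℝ} (hχ : ContDiff ℝ n χ) {g : Euc N → F} (h : ContDiffOn ℝ n g Ω)
    (hs : tsupport χ ⊆ Ω) : ContDiff ℝ n (fun x => χ x • g x) := by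
  rw [contDiff_iff_contDiffAt]
  intro x
  by_cases hx : x ∈ Ω
  · exact hχ.contDiffAt.smul (h.contDiffAt (hΩ.mem_nhds hx))
  · have h1 : χ =ᶠ[𝓝 x] 0 := notMem_tsupport_iff_eventuallyEq.1 fun h => hx (hs h)
    have h2 : (fun x => χ x • g x) =ᶠ[𝓝 x] fun _ => 0 := by
      filter_upwards [h1] with y hy
      simp [hy]
    exact contDiffAt_const.congr_of_eventuallyEq h2

/-- gradient vector -/
def gr (h : Euc N → ℝ) (x : Euc N) : Euc N :=
  (InnerProductSpace.toDual ℝ (Euc N)).symm (fderiv ℝ h x)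

lemma gr_inner (h : Euc N → ℝ) (x v : Euc N) : inner ℝ (gr h x) v = fderiv ℝ h x v := by
  simp [gr]

lemma gr_norm (h : Euc N → ℝ) (x : Euc N) : ‖gr h x‖ = ‖fderiv ℝ h x‖ := by
  simp [gr]

lemma gr_contDiffOn {Ω : Set (Euc N)} (hΩ : IsOpen Ω) {h : Euc N → ℝ} (hh : ContDiffOn ℝ 2 h Ω) :
    ContDiffOn ℝ 1 (gr h) Ω :=
  ((InnerProductSpace.toDual ℝ (Euc N)).symm.toContinuousLinearEquiv.contDiff).comp_contDiffOn
    (hh.fderiv_of_isOpen hΩ (by norm_num))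

lemma lintegral_grad_le {Ω : Set (Euc N)} (hΩ : IsOpen Ω) {h : Euc N → ℝ}
    (hh : ContDiffOn ℝ 2 h Ω) {c : ℝ}
    (H : ∀ φ ∈ TestVF Ω, ∫ x, h x * diverg φ x ≤ c) :
    ∫⁻ x in Ω, ‖fderiv ℝ h x‖ₑ ≤ ENNReal.ofReal c := by
  obtain ⟨K, χ, hKc, hKi, hU, hχ, hχ1, hχ0, hχb⟩ := exhaustion hΩ
  have hsup : ∀ m, tsupport (χ m) ⊆ K (m+1) := fun m =>
    closure_minimal (fun x hx => by
      by_contra hc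
      exact hx (hχ0 m x fun h => hc (interior_subset h))) (hKc _).isClosed
  have hKΩ : ∀ m, K m ⊆ Ω := fun m => hU ▸ subset_iUnion K m
  let s : ℕ → Euc N → ℝ := fun m x => Real.sqrt (‖gr h x‖ ^ 2 + 1 / ((m:ℝ) + 1))
  have hpos : ∀ (m : ℕ) x, 0 < ‖gr h x‖ ^ 2 + 1 / ((m:ℝ) + 1) := fun m x => by positivity
  have hspos : ∀ m x, 0 < s m x := fun m x => Real.sqrt_pos.2 (hpos m x)
  have hsg : ∀ m x, ‖gr h x‖ ≤ s m x := fun m x =>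
    Real.le_sqrt_of_sq_le (by have : (0:ℝ) < 1 / ((m:ℝ) + 1) := by positivity
                              linarith)
  let φ : ℕ → Euc N → Euc N := fun m x => χ m x • (-(s m x)⁻¹ • gr h x)
  have hg := gr_contDiffOn hΩ hh
  have hφ : ∀ m, φ m ∈ TestVF Ω := by
    intro m
    refine ⟨?_, ?_, ?_, ?_⟩
    · refine contDiff_smul_of_tsupport' hΩ ((hχ m).of_le (by norm_num)) ?_
        ((hsup m).trans (hKΩ _))
      refine ContDiffOn.smul (ContDiffOn.neg (ContDiffOn.inv (ContDiffOn.sqrt ?_ ?_) ?_)) hg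
      · exact (hg.norm_sq ℝ).add contDiffOn_const
      · exact fun x _ => (hpos m x).ne'
      · exact fun x _ => (hspos m x).ne'
    · exact HasCompactSupport.of_support_subset_isCompact (hKc (m+1)) fun x hx => by
        by_contra hc
        exact hx (by simp [φ, hχ0 m x fun h => hc (interior_subset h)])
    · refine (closure_minimal (fun x hx => ?_) (hKc (m+1)).isClosed).trans (hKΩ (m+1))
      by_contra hc
      exact hx (by simp [φ, hχ0 m x fun h => hc (interior_subset h)])
    · intro x
      have h1 : ‖-(s m x)⁻¹ • gr h x‖ ≤ 1 := by
        rw [norm_smul, norm_neg, norm_inv, Real.norm_of_nonneg (hspos m x).le,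
          inv_mul_le_iff₀ (hspos m x), mul_one]
        exact hsg m x
      simp only [φ]
      rw [norm_smul, Real.norm_of_nonneg (hχb m x).1]
      exact mul_le_one₀ (hχb m x).2 (norm_nonneg _) h1
  let q : ℕ → Euc N → ℝ := fun m x => χ m x * (‖gr h x‖ ^ 2 / s m x)
  have hq : ∀ m x, fderiv ℝ h x (φ m x) = - q m x := by
    intro m x
    rw [← gr_inner]
    simp only [φ, q, inner_smul_right, real_inner_self_eq_norm_sq]
    ring
  have hq0 : ∀ m x, 0 ≤ q m x := fun m x => mul_nonneg (hχb m x).1 (div_nonneg (sq_nonneg _) (hspos m x).le)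
  have key : ∀ m, Integrable (q m) ∧ ∫ x, q m x ≤ c := by
    intro m
    obtain ⟨-, h2, h3⟩ := ibp hΩ (hh.of_le (by norm_num)) (hφ m).1 (hφ m).2.1 (hφ m).2.2.1
    have := H _ (hφ m)
    simp only [hq] at h2 h3
    refine ⟨by simpa using h2.neg, ?_⟩
    rw [h3, integral_neg, neg_neg] at this
    exact this
  have hlim : ∀ x ∈ Ω, Tendsto (fun m => ENNReal.ofReal (q m x)) atTop (𝓝 ‖fderiv ℝ h x‖ₑ) := by
    intro x hx
    rw [← ofReal_norm_eq_enorm, ← gr_norm]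
    refine ENNReal.tendsto_ofReal ?_
    obtain ⟨m0, hm0⟩ := mem_iUnion.1 (hU ▸ hx : x ∈ ⋃ n, K n)
    by_cases h0 : ‖gr h x‖ = 0
    · simp [q, h0]
    have hs1 : Tendsto (fun m => s m x) atTop (𝓝 ‖gr h x‖) := by
      have : Tendsto (fun m : ℕ => ‖gr h x‖ ^ 2 + 1 / ((m:ℝ) + 1)) atTop (𝓝 (‖gr h x‖ ^ 2 + 0)) :=
        tendsto_const_nhds.add tendsto_one_div_add_atTop_nhds_zero_nat
      have h2 := this.sqrt
      rw [add_zero, Real.sqrt_sq (norm_nonneg _)] at h2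
      exact h2
    have h3 := (tendsto_const_nhds (x := ‖gr h x‖ ^ 2)).div hs1 h0
    rw [sq, mul_self_div_self] at h3
    refine h3.congr' ?_
    filter_upwards [eventually_ge_atTop m0] with m hm
    simp [q, hχ1 m x (K_mono hKi hm hm0), sq]
  calc ∫⁻ x in Ω, ‖fderiv ℝ h x‖ₑ
      = ∫⁻ x in Ω, liminf (fun m => ENNReal.ofReal (q m x)) atTop :=
        setLIntegral_congr_fun hΩ.measurableSet fun x hx => (hlim x hx).liminf_eq.symm
    _ ≤ liminf (fun m => ∫⁻ x in Ω, ENNReal.ofReal (q m x)) atTop :=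
        lintegral_liminf_le' fun m => (key m).1.aemeasurable.ennreal_ofReal.restrict
    _ ≤ liminf (fun _ : ℕ => ENNReal.ofReal c) atTop := by
        refine liminf_le_liminf (Eventually.of_forall fun m => ?_)
        refine (setLIntegral_le_lintegral _ _).trans ?_
        rw [← ofReal_integral_eq_lintegral_ofReal (key m).1 (Eventually.of_forall (hq0 m))]
        exact ENNReal.ofReal_le_ofReal (key m).2
    _ = ENNReal.ofReal c := by simp

lemma exists_zeta {Ω : Set (Euc N)} (hΩ : IsOpen Ω) :
    ∃ (K : ℕ → Set (Euc N)) (ζ : ℕ → Euc N → ℝ), (∀ n, IsCompact (K n)) ∧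
      (∀ n, K n ⊆ interior (K (n+1))) ∧ (⋃ n, K n = Ω) ∧ (∀ n, ContDiff ℝ 2 (ζ n)) ∧
      (∀ i x, 0 ≤ ζ i x) ∧ (∀ i x, ζ i x ≤ 1) ∧
      (∀ n x, ∑ i ∈ Finset.range n, ζ i x ≤ 1) ∧
      (∀ i x, x ∉ K (i+1) → ζ i x = 0) ∧
      (∀ m i x, x ∈ K m → m + 1 ≤ i → ζ i x = 0) ∧
      (∀ m n x, x ∈ K m → m + 1 ≤ n → ∑ i ∈ Finset.range n, ζ i x = 1) := by
  obtain ⟨K, χ, hKc, hKi, hU, hχ, hχ1, hχ0, hχb⟩ := exhaustion hΩ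
  have hKm := K_mono hKi
  let ζ : ℕ → Euc N → ℝ := fun i => match i with
    | 0 => χ 0
    | (j+1) => fun x => χ (j+1) x - χ j x
  have hsum : ∀ n x, ∑ i ∈ Finset.range (n+1), ζ i x = χ n x := by
    intro n x
    induction n with
    | zero => simp [ζ]
    | succ k ih => rw [Finset.sum_range_succ, ih]; simp [ζ]
  refine ⟨K, ζ, hKc, hKi, hU, ?_, ?_, ?_, ?_, ?_, ?_, ?_⟩
  · intro n
    cases n with
    | zero => exact hχ 0
    | succ j => exact (hχ (j+1)).sub (hχ j)
  · intro i x
    cases i with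
    | zero => exact (hχb 0 x).1
    | succ j =>
      simp only [ζ, sub_nonneg]
      by_cases hx : x ∈ K (j+1)
      · rw [hχ1 _ _ hx]; exact (hχb j x).2
      · rw [hχ0 j x fun h => hx (interior_subset h)]; exact (hχb (j+1) x).1
  · intro i x
    cases i with
    | zero => exact (hχb 0 x).2
    | succ j =>
      simp only [ζ]
      linarith [(hχb (j+1) x).2, (hχb j x).1]
  · intro n x
    cases n with
    | zero => simp
    | succ k => rw [hsum]; exact (hχb k x).2
  · intro i x hx
    cases i with
    | zero => exact hχ0 0 x fun h => hx (interior_subset h)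
    | succ j =>
      simp only [ζ]
      rw [hχ0 (j+1) x fun h => hx (interior_subset h), hχ0 j x fun h => hx ?_, sub_zero]
      exact hKm (Nat.le_succ _) (interior_subset h)
  · intro m i x hx hi
    obtain ⟨j, rfl⟩ : ∃ j, i = j + 1 := ⟨i - 1, by omega⟩
    simp only [ζ]
    rw [hχ1 (j+1) x (hKm (by omega) hx), hχ1 j x (hKm (by omega) hx), sub_self]
  · intro m n x hx hn
    obtain ⟨j, rfl⟩ : ∃ j, n = j + 1 := ⟨n - 1, by omega⟩
    rw [hsum, hχ1 j x (hKm (by omega) hx)]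

lemma indicator_smul_lemma {A : Set (Euc N)} (hA : MeasurableSet A) {F : Type*}
    [NormedAddCommGroup F] {g : Euc N → F} (hg : Continuous g)
    {K : Set (Euc N)} (hK : IsCompact K) (h0 : ∀ x, x ∉ K → g x = 0) :
    Integrable (A.indicator g) ∧ (∃ C, ∀ x, ‖A.indicator g x‖ ≤ C) ∧
      HasCompactSupport (A.indicator g) := by
  have hc : HasCompactSupport g := HasCompactSupport.intro hK h0
  refine ⟨(hg.integrable_of_hasCompactSupport hc).indicator hA, ?_, ?_⟩
  · obtain ⟨C, hC⟩ := hc.exists_bound_of_continuous hg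
    exact ⟨C, fun x => (norm_indicator_le_norm_self _ _).trans (hC x)⟩
  · refine HasCompactSupport.intro hK fun x hx => ?_
    by_cases h : x ∈ A <;> simp [h, h0 x hx]

lemma gr_continuous {h : Euc N → ℝ} (hh : ContDiff ℝ 2 h) : Continuous (gr h) :=
  (contDiffOn_univ.1 (gr_contDiffOn isOpen_univ hh.contDiffOn)).continuous

lemma gr_eq_zero {h : Euc N → ℝ} {K : Set (Euc N)} (hK : IsClosed K) (h0 : ∀ x, x ∉ K → h x = 0)
    (x : Euc N) (hx : x ∉ K) : gr h x = 0 := by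
  have : h =ᶠ[𝓝 x] fun _ => 0 := by
    filter_upwards [hK.isOpen_compl.mem_nhds hx] with y hy using h0 y hy
  simp [gr, this.fderiv_eq]

/-- One cutoff piece. -/
lemma ag_piece {A : Set (Euc N)} (hA : MeasurableSet A) {ζ : Euc N → ℝ} (hζ : ContDiff ℝ 2 ζ)
    {K : Set (Euc N)} (hK : IsCompact K) (h0 : ∀ x, x ∉ K → ζ x = 0) (n : ℕ)
    {φ : Euc N → Euc N} (hφ : ContDiff ℝ 1 φ) (hc : HasCompactSupport φ) :
    ∫ x, moll n (A.indicator ζ) x * diverg φ x =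
      (∫ x in A, diverg (fun y => ζ y • moll n φ y) x)
        - ∫ x, inner ℝ (moll n (A.indicator (gr ζ)) x) (φ x) := by
  obtain ⟨f1, -, f3⟩ := indicator_smul_lemma hA hζ.continuous hK h0
  obtain ⟨g1, -, g3⟩ := indicator_smul_lemma hA (gr_continuous hζ) hK (gr_eq_zero hK.isClosed h0)
  have hφi : Integrable φ volume := hφ.continuous.integrable_of_hasCompactSupport hc
  have hmφ : ContDiff ℝ 2 (moll n φ) := moll_contDiff n hφi.locallyIntegrable
  have e1 : ∫ x, moll n (A.indicator ζ) x * diverg φ x = ∫ x, A.indicator ζ x * moll n (diverg φ) x := by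
    have := moll_adj n f1 (diverg_integrable hφ hc)
    simpa [mul_comm] using this
  rw [e1, moll_adj n g1 hφi, ← integral_indicator hA]
  have hdc : Continuous (diverg (moll n φ)) := diverg_continuous (hmφ.of_le (by norm_num))
  rw [eq_sub_iff_add_eq, ← integral_add]
  · congr 1
    ext x
    by_cases hx : x ∈ A
    · simp only [indicator_of_mem hx]
      rw [diverg_smul (hζ.differentiable (by norm_num) x) (hmφ.differentiable (by norm_num) x),
        gr_inner, moll_diverg n hφ hc]
    · simp [indicator_of_notMem hx]
  · have hcs : HasCompactSupport (fun x => ζ x * diverg (moll n φ) x) :=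
      HasCompactSupport.intro hK fun x hx => by simp [h0 x hx]
    have := ((hζ.continuous.mul hdc).integrable_of_hasCompactSupport (μ := (volume : Measure (Euc N))) hcs).indicator hA
    refine this.congr (Eventually.of_forall fun x => ?_)
    by_cases hx : x ∈ A
    · simp [indicator_of_mem hx, moll_diverg n hφ hc]
    · simp [indicator_of_notMem hx]
  · have hcs : HasCompactSupport (fun x => inner ℝ (gr ζ x) (moll n φ x)) :=
      HasCompactSupport.intro hK fun x hx => by simp [gr_eq_zero hK.isClosed h0 x hx]
    have := (((gr_continuous hζ).inner hmφ.continuous).integrable_of_hasCompactSupport (μ := (volume : Measure (Euc N))) hcs).indicator hA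
    refine this.congr (Eventually.of_forall fun x => ?_)
    by_cases hx : x ∈ A
    · simp [indicator_of_mem hx]
    · simp [indicator_of_notMem hx]

lemma AG {Ω A : Set (Euc N)} (hΩ : IsOpen Ω) (hA : MeasurableSet A) (hper : perimeter A Ω < ⊤)
    {ω : Euc N → ℝ} (hω : ContinuousOn ω Ω) {δ : ℝ} (hδ : 0 < δ) :
    ∃ h : Euc N → ℝ, ContDiffOn ℝ 2 h Ω ∧
      ∫⁻ x in Ω, ENNReal.ofReal (ω x * |h x - A.indicator 1 x|) ≤ ENNReal.ofReal δ ∧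
      ∫⁻ x in Ω, ‖fderiv ℝ h x‖ₑ ≤ ENNReal.ofReal ((perimeter A Ω).toReal + δ) := by
  obtain ⟨K, ζ, hKc, hKi, hU, hζ, hζ0, hζ1, hζs, hζK, hζm, hζsum⟩ := exists_zeta hΩ
  have hKm := K_mono hKi
  have hKΩ : ∀ m, K m ⊆ Ω := fun m => hU ▸ subset_iUnion K m
  have hr : ∀ m, ∃ r > 0, thickening r (K m) ⊆ interior (K (m+1)) := fun m =>
    (hKc m).exists_thickening_subset_open isOpen_interior (hKi m)
  choose r hr0 hr using hr
  have hW : ∀ i, ∃ W : ℝ, 0 < W ∧ ∀ x ∈ K (i+2), ω x ≤ W := by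
    intro i
    obtain ⟨C, hC⟩ := (hKc (i+2)).exists_bound_of_continuousOn (hω.mono (hKΩ _))
    exact ⟨max C 1, by positivity, fun x hx =>
      ((le_abs_self _).trans (hC x hx)).trans (le_max_left _ _)⟩
  choose W hW0 hW using hW
  obtain ⟨δ', hδ'0, hδ'⟩ := ENNReal.exists_pos_sum_of_countable
    (ENNReal.ofReal_pos.2 hδ).ne' ℕ
  have hn : ∀ i, ∃ n, (∀ m ∈ Finset.range (i+2), (bmp N n).rOut < r m) ∧
      ENNReal.ofReal (W i) * (∫⁻ x, ‖moll n (A.indicator (ζ i)) x - A.indicator (ζ i) x‖ₑ)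
        ≤ δ' i ∧
      ∫⁻ x, ‖moll n (A.indicator (gr (ζ i))) x - A.indicator (gr (ζ i)) x‖ₑ ≤ δ' i := by
    intro i
    obtain ⟨f1, ⟨C1, f2⟩, f3⟩ := indicator_smul_lemma hA (hζ i).continuous (hKc (i+1)) (hζK i)
    obtain ⟨g1, ⟨C2, g2⟩, g3⟩ := indicator_smul_lemma hA (gr_continuous (hζ i)) (hKc (i+1))
      (gr_eq_zero (hKc (i+1)).isClosed (hζK i))
    have hpos : (0:ℝ≥0∞) < δ' i := by exact_mod_cast hδ'0 i
    have t1 := ENNReal.Tendsto.const_mul (a := ENNReal.ofReal (W i)) (moll_L1 f1 f2 f3)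
      (Or.inr ENNReal.ofReal_ne_top)
    rw [mul_zero] at t1
    have t2 := moll_L1 g1 g2 g3
    have t3 : ∀ m ∈ Finset.range (i+2), ∀ᶠ n in atTop, (bmp N n).rOut < r m := fun m _ =>
      bmp_rOut_tendsto.eventually (gt_mem_nhds (hr0 m))
    rw [← Finset.eventually_all] at t3
    obtain ⟨n, a, b, c⟩ := (t3.and ((t1.eventually (gt_mem_nhds hpos)).and
      (t2.eventually (gt_mem_nhds hpos)))).exists
    exact ⟨n, a, b.le, c.le⟩
  choose n hn1 hn2 hn3 using hn
  set h' : ℕ → Euc N → ℝ := fun i => moll (n i) (A.indicator (ζ i)) with hh'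
  have hsm : ∀ i, ContDiff ℝ 2 (h' i) := fun i => moll_contDiff (n i)
    (indicator_smul_lemma hA (hζ i).continuous (hKc (i+1)) (hζK i)).1.locallyIntegrable
  have ha : ∀ m i x, x ∈ K m → m + 2 ≤ i → h' i x = 0 := by
    intro m i x hx hi
    refine moll_eq_zero (n i) fun y hy => ?_
    have : y ∈ K (m+1) := interior_subset (hr m (mem_thickening_iff.2
      ⟨x, hx, (mem_ball.1 hy).trans (hn1 i m (Finset.mem_range.2 (by omega)))⟩))
    by_cases hyA : y ∈ A <;> simp [hyA, hζm (m+1) i y this (by omega)]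
  have hb : ∀ i x, x ∉ K (i+2) → h' i x = 0 := by
    intro i x hx
    refine moll_eq_zero (n i) fun y hy => ?_
    have : y ∉ K (i+1) := fun hyK => hx (interior_subset (hr (i+1) (mem_thickening_iff.2
      ⟨y, hyK, ((dist_comm x y).trans_lt (mem_ball.1 hy)).trans
        (hn1 i (i+1) (Finset.mem_range.2 (by omega)))⟩)))
    by_cases hyA : y ∈ A <;> simp [hyA, hζK i y this]
  set h : Euc N → ℝ := fun x => ∑' i, h' i x with hh
  have hsum : ∀ m x, x ∈ K m → h x = ∑ i ∈ Finset.range (m+2), h' i x := by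
    intro m x hx
    refine tsum_eq_sum fun i hi => ha m i x hx ?_
    simpa using hi
  have hA1 : ∀ m x, x ∈ K m → A.indicator (1 : Euc N → ℝ) x =
      ∑ i ∈ Finset.range (m+2), A.indicator (ζ i) x := by
    intro m x hx
    by_cases hxA : x ∈ A
    · simp [hxA, hζsum m (m+2) x hx (by omega)]
    · simp [hxA]
  have hC2 : ContDiffOn ℝ 2 h Ω := by
    intro x hx
    obtain ⟨m, hm⟩ := mem_iUnion.1 (hU ▸ hx : x ∈ ⋃ n, K n)
    have hev : h =ᶠ[𝓝 x] fun y => ∑ i ∈ Finset.range (m+1+2), h' i y := by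
      filter_upwards [isOpen_interior.mem_nhds (hKi m hm)] with y hy
      exact hsum (m+1) y (interior_subset hy)
    exact (ContDiffAt.congr_of_eventuallyEq (ContDiff.sum fun i _ => hsm i).contDiffAt
      hev).contDiffWithinAt
  have hδsum : ∑' i, (δ' i : ℝ≥0∞) ≤ ENNReal.ofReal δ := hδ'.le
  refine ⟨h, hC2, ?_, ?_⟩
  · have hm : ∀ i, AEMeasurable (fun x => ENNReal.ofReal (W i) *
        ‖h' i x - A.indicator (ζ i) x‖ₑ) (volume : Measure (Euc N)) := fun i => by
      refine AEMeasurable.const_mul ?_ _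
      exact ((hsm i).continuous.measurable.sub
        ((hζ i).continuous.measurable.indicator hA)).enorm.aemeasurable
    calc ∫⁻ x in Ω, ENNReal.ofReal (ω x * |h x - A.indicator 1 x|)
        ≤ ∫⁻ x in Ω, ∑' i, ENNReal.ofReal (W i) * ‖h' i x - A.indicator (ζ i) x‖ₑ := by
          refine setLIntegral_mono' hΩ.measurableSet fun x hx => ?_
          obtain ⟨m, hm⟩ := mem_iUnion.1 (hU ▸ hx : x ∈ ⋃ n, K n)
          refine le_trans ?_ (ENNReal.sum_le_tsum (Finset.range (m+2)))
          rw [hsum m x hm, hA1 m x hm, ← Finset.sum_sub_distrib]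
          have hle : ω x * |∑ i ∈ Finset.range (m+2), (h' i x - A.indicator (ζ i) x)| ≤
              ∑ i ∈ Finset.range (m+2), W i * |h' i x - A.indicator (ζ i) x| := by
            by_cases hω0 : ω x ≤ 0
            · exact (mul_nonpos_of_nonpos_of_nonneg hω0 (abs_nonneg _)).trans
                (Finset.sum_nonneg fun i _ => mul_nonneg (hW0 i).le (abs_nonneg _))
            push Not at hω0
            refine (mul_le_mul_of_nonneg_left (Finset.abs_sum_le_sum_abs _ _) hω0.le).trans ?_
            rw [Finset.mul_sum]
            refine Finset.sum_le_sum fun i _ => ?_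
            by_cases hxK : x ∈ K (i+2)
            · exact mul_le_mul_of_nonneg_right (hW i x hxK) (abs_nonneg _)
            · have : A.indicator (ζ i) x = 0 := by
                by_cases hxA : x ∈ A <;>
                  simp [hxA, hζK i x fun hc => hxK (hKm (Nat.le_succ _) hc)]
              simp [hb i x hxK, this]
          refine (ENNReal.ofReal_le_ofReal hle).trans ?_
          rw [ENNReal.ofReal_sum_of_nonneg fun i _ => mul_nonneg (hW0 i).le (abs_nonneg _)]
          refine Finset.sum_le_sum fun i _ => ?_
          rw [ENNReal.ofReal_mul (hW0 i).le, ← Real.norm_eq_abs, ofReal_norm]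
      _ ≤ ∫⁻ x, ∑' i, ENNReal.ofReal (W i) * ‖h' i x - A.indicator (ζ i) x‖ₑ :=
          setLIntegral_le_lintegral _ _
      _ = ∑' i, ∫⁻ x, ENNReal.ofReal (W i) * ‖h' i x - A.indicator (ζ i) x‖ₑ :=
          lintegral_tsum hm
      _ ≤ ∑' i, (δ' i : ℝ≥0∞) := by
          refine ENNReal.tsum_le_tsum fun i => ?_
          rw [lintegral_const_mul' _ _ ENNReal.ofReal_ne_top]
          exact hn2 i
      _ ≤ ENNReal.ofReal δ := hδsum
  · refine lintegral_grad_le hΩ hC2 fun φ hφ => ?_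
    obtain ⟨φ1, φ2, φ3, φ4⟩ := hφ
    have hφi : Integrable φ volume := φ1.continuous.integrable_of_hasCompactSupport φ2
    obtain ⟨m, hm⟩ : ∃ m, tsupport φ ⊆ K m := by
      obtain ⟨m, hm⟩ := φ2.isCompact.elim_directed_cover (fun m => interior (K (m+1)))
        (fun _ => isOpen_interior) (fun x hx => by
          obtain ⟨m, hm⟩ := mem_iUnion.1 (hU ▸ (φ3 hx) : x ∈ ⋃ n, K n)
          exact mem_iUnion.2 ⟨m, hKi m hm⟩)
        (directed_of_isDirected_le fun a b hab => interior_mono (hKm (by omega)))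
      exact ⟨m+1, hm.trans interior_subset⟩
    have e0 : ∀ x, h x * diverg φ x = ∑ i ∈ Finset.range (m+2), h' i x * diverg φ x := by
      intro x
      by_cases hx : x ∈ tsupport φ
      · rw [hsum m x (hm hx), Finset.sum_mul]
      · simp [diverg_eq_zero hx]
    simp only [e0]
    have hIntg1 : ∀ i, Integrable (fun x => h' i x * diverg φ x) := fun i =>
      (((hsm i).continuous.mul (diverg_continuous φ1)).integrable_of_hasCompactSupport
        ((diverg_hasCompactSupport φ2).mul_left))
    rw [integral_finsetSum _ fun i _ => hIntg1 i]
    have e1 : ∀ i, ∫ x, h' i x * diverg φ x = _ := fun i =>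
      ag_piece hA (hζ i) (hKc (i+1)) (hζK i) (n i) φ1 φ2
    rw [Finset.sum_congr rfl fun i _ => e1 i, Finset.sum_sub_distrib]
    have hmφ : ∀ i, ContDiff ℝ 2 (moll (n i) φ) := fun i =>
      moll_contDiff (n i) hφi.locallyIntegrable
    have hF1 : ∀ i, ContDiff ℝ 1 (fun y => ζ i y • moll (n i) φ y) := fun i =>
      ((hζ i).smul (hmφ i)).of_le (by norm_num)
    have hF2 : ∀ i, HasCompactSupport (fun y => ζ i y • moll (n i) φ y) := fun i =>
      HasCompactSupport.intro (hKc (i+1)) fun x hx => by simp [hζK i x hx]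
    -- first sum
    have s1 : ∑ i ∈ Finset.range (m+2), ∫ x in A, diverg (fun y => ζ i y • moll (n i) φ y) x
        ≤ (perimeter A Ω).toReal := by
      rw [← integral_finsetSum _ fun i _ => (diverg_integrable (hF1 i) (hF2 i)).integrableOn]
      have e2 : ∀ x, ∑ i ∈ Finset.range (m+2), diverg (fun y => ζ i y • moll (n i) φ y) x =
          diverg (fun y => ∑ i ∈ Finset.range (m+2), ζ i y • moll (n i) φ y) x := fun x =>
        (diverg_sum _ fun i _ => (hF1 i).differentiable (by norm_num) x).symm
      simp only [e2]
      have hz : ∀ x, x ∉ K (m+2) → ∑ i ∈ Finset.range (m+2), ζ i x • moll (n i) φ x = 0 :=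
        fun x hx => Finset.sum_eq_zero fun i hi => by
          rw [hζK i x fun hc => hx (hKm (by have := Finset.mem_range.1 hi; omega) hc), zero_smul]
      refine testVF_integral_le hper ⟨ContDiff.sum fun i _ => hF1 i,
        HasCompactSupport.intro (hKc (m+2)) hz, ?_, fun x => ?_⟩
      · refine (closure_minimal (fun x hx => ?_) (hKc (m+2)).isClosed).trans (hKΩ (m+2))
        by_contra hc
        exact hx (hz x hc)
      · refine (norm_sum_le _ _).trans ((Finset.sum_le_sum fun i _ => ?_).trans (hζs (m+2) x))
        rw [norm_smul, Real.norm_of_nonneg (hζ0 i x)]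
        exact mul_le_of_le_one_right (hζ0 i x)
          (moll_norm_le (n i) φ1.continuous.aestronglyMeasurable φ4 x)
    -- second sum
    have hGi : ∀ i, Integrable (A.indicator (gr (ζ i))) := fun i =>
      (indicator_smul_lemma hA (gr_continuous (hζ i)) (hKc (i+1))
        (gr_eq_zero (hKc (i+1)).isClosed (hζK i))).1
    have hI1 : ∀ i, Integrable (fun x => inner ℝ (moll (n i) (A.indicator (gr (ζ i))) x) (φ x)) :=
      fun i => (((moll_contDiff (n i) (hGi i).locallyIntegrable).continuous.inner
        φ1.continuous).integrable_of_hasCompactSupport (HasCompactSupport.intro φ2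
          fun x hx => by simp [image_eq_zero_of_notMem_tsupport hx]))
    have hI2 : ∀ i, Integrable (fun x => inner ℝ (A.indicator (gr (ζ i)) x) (φ x)) := by
      intro i
      have : Integrable (fun x => inner ℝ (gr (ζ i) x) (φ x)) :=
        (((gr_continuous (hζ i)).inner φ1.continuous).integrable_of_hasCompactSupport
          (HasCompactSupport.intro φ2 fun x hx => by simp [image_eq_zero_of_notMem_tsupport hx]))
      refine (this.indicator hA).congr (Eventually.of_forall fun x => ?_)
      by_cases hx : x ∈ A <;> simp [hx]
    have s2 : ∑ i ∈ Finset.range (m+2), ∫ x, inner ℝ (A.indicator (gr (ζ i)) x) (φ x) = 0 := by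
      rw [← integral_finsetSum _ fun i _ => hI2 i]
      refine integral_eq_zero_of_ae (Eventually.of_forall fun x => ?_)
      simp only [Pi.zero_apply]
      by_cases hx : x ∈ tsupport φ
      · by_cases hxA : x ∈ A
        · simp only [indicator_of_mem hxA, gr_inner]
          have hd : fderiv ℝ (fun y => ∑ i ∈ Finset.range (m+2), ζ i y) x = 0 := by
            have : (fun y => ∑ i ∈ Finset.range (m+2), ζ i y) =ᶠ[𝓝 x] fun _ => 1 := by
              filter_upwards [isOpen_interior.mem_nhds (hKi m (hm hx))] with y hy
              exact hζsum (m+1) (m+2) y (interior_subset hy) le_rfl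
            simp [this.fderiv_eq]
          rw [fderiv_fun_sum fun i _ => (hζ i).differentiable (by norm_num) x] at hd
          have := congrArg (fun L => L (φ x)) hd
          simpa using this
        · simp [hxA]
      · simp [image_eq_zero_of_notMem_tsupport hx]
    have s3 : ∀ i, |(∫ x, inner ℝ (moll (n i) (A.indicator (gr (ζ i))) x) (φ x)) -
        ∫ x, inner ℝ (A.indicator (gr (ζ i)) x) (φ x)| ≤ δ' i := by
      intro i
      rw [← integral_sub (hI1 i) (hI2 i)]
      have : ‖∫ x, (inner ℝ (moll (n i) (A.indicator (gr (ζ i))) x) (φ x) -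
          inner ℝ (A.indicator (gr (ζ i)) x) (φ x))‖ₑ ≤ δ' i := by
        refine (enorm_integral_le_lintegral_enorm _).trans ((lintegral_mono fun x => ?_).trans
          (hn3 i))
        rw [← inner_sub_left, ← ofReal_norm, ← ofReal_norm]
        refine ENNReal.ofReal_le_ofReal ((norm_inner_le_norm _ _).trans ?_)
        exact mul_le_of_le_one_right (norm_nonneg _) (φ4 x)
      rw [← Real.norm_eq_abs]
      exact_mod_cast this
    have s4 : ∑ i ∈ Finset.range (m+2), (δ' i : ℝ) ≤ δ := by
      have h1 : ∑ i ∈ Finset.range (m+2), (δ' i : ℝ≥0∞) ≤ ENNReal.ofReal δ :=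
        (ENNReal.sum_le_tsum _).trans hδsum
      have h2 := ENNReal.toReal_mono ENNReal.ofReal_ne_top h1
      rw [ENNReal.toReal_ofReal hδ.le, ENNReal.toReal_sum (by simp)] at h2
      simpa using h2
    have s5 : -∑ i ∈ Finset.range (m+2),
        ∫ x, inner ℝ (moll (n i) (A.indicator (gr (ζ i))) x) (φ x) ≤ δ := by
      rw [← sub_zero (∑ i ∈ Finset.range (m+2), ∫ x, inner ℝ (moll (n i) _ x) (φ x)), ← s2,
        ← Finset.sum_sub_distrib]
      refine (neg_le_abs _).trans ((Finset.abs_sum_le_sum_abs _ _).trans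
        ((Finset.sum_le_sum fun i _ => s3 i).trans s4))
    linarith

lemma flow_lemma {φ : Euc N → Euc N} (hφ : ContDiff ℝ 1 φ) (hc : HasCompactSupport φ)
    (hb : ∀ x, ‖φ x‖ ≤ 1) {A : Set (Euc N)} (hA : MeasurableSet A) {θ α : ℝ} (hθ : 0 < θ)
    (hθ1 : θ ≤ 1/2) (hα : 0 < α) :
    ∃ s : ℝ, 0 < s ∧ ∀ τ : ℝ, |τ| ≤ s →
      MapsTo (fun x => x - τ • φ x) (tsupport φ) (tsupport φ) ∧
      (∀ S, MeasurableSet S → MapsTo (fun x => x - τ • φ x) S S → ∀ G : Euc N → ℝ≥0∞,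
        ∫⁻ x in S, G (x - τ • φ x) ≤ ENNReal.ofReal (1 + θ) * ∫⁻ x in S, G x) ∧
      ∫⁻ x in tsupport φ, ‖A.indicator (1 : Euc N → ℝ) (x - τ • φ x) - A.indicator 1 x‖ₑ
        ≤ ENNReal.ofReal α ∧
      (∀ x, |τ| * ‖fderiv ℝ φ x‖ ≤ θ) := by
  obtain ⟨M, hM⟩ := (hc.fderiv ℝ).exists_bound_of_continuous (hφ.continuous_fderiv one_ne_zero)
  have hM0 : 0 ≤ M := (norm_nonneg _).trans (hM 0)
  set K := tsupport φ with hK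
  have hKc : IsCompact K := hc
  have hfd : ∀ x, HasFDerivAt φ (fderiv ℝ φ x) x := fun x =>
    (hφ.differentiable one_ne_zero x).hasFDerivAt
  -- determinant
  obtain ⟨ρ, hρ, hdet⟩ : ∃ ρ > 0, ∀ L : Euc N →L[ℝ] Euc N,
      ‖L - ContinuousLinearMap.id ℝ (Euc N)‖ < ρ → (1 + θ)⁻¹ ≤ |L.det| := by
    have hcont : Continuous fun L : Euc N →L[ℝ] Euc N => |L.det| :=
      ContinuousLinearMap.continuous_det.abs
    have h1 : (1 + θ)⁻¹ < |(ContinuousLinearMap.id ℝ (Euc N)).det| := by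
      have : (ContinuousLinearMap.id ℝ (Euc N)).det = 1 := by
        simp [ContinuousLinearMap.det]
      rw [this, abs_one]
      exact inv_lt_one_of_one_lt₀ (by linarith)
    obtain ⟨ρ, hρ, h⟩ := Metric.eventually_nhds_iff.1
      (hcont.continuousAt.eventually (lt_mem_nhds h1))
    exact ⟨ρ, hρ, fun L hL => (h (by rwa [dist_eq_norm])).le⟩
  -- approximation of the indicator
  have hfi : Integrable ((A ∩ K).indicator (1 : Euc N → ℝ)) := by
    rw [integrable_indicator_iff (hA.inter hKc.measurableSet)]
    exact integrableOn_const ((measure_mono inter_subset_right).trans_lt hKc.measure_lt_top).ne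
  obtain ⟨g, g1, g2, g3, -⟩ := hfi.exists_hasCompactSupport_lintegral_sub_le
    (ε := ENNReal.ofReal (α / 4)) (by simpa using hα)
  have hguc : UniformContinuous g := g1.uniformContinuous_of_continuous g3
  set V := (volume K).toReal with hV
  have hV0 : 0 ≤ V := ENNReal.toReal_nonneg
  obtain ⟨ρ2, hρ2, hg⟩ := Metric.uniformContinuous_iff.1 hguc (α / (4 * (V + 1))) (by positivity)
  set s := min (θ / (M + 1)) (min (ρ / (2 * (M + 1))) (ρ2 / 2)) with hs
  have hs0 : 0 < s := by positivity
  refine ⟨s, hs0, fun τ hτ => ?_⟩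
  have hτ1 : |τ| * (M + 1) ≤ θ := by
    have : |τ| ≤ θ / (M + 1) := hτ.trans (min_le_left _ _)
    rwa [le_div_iff₀ (by positivity)] at this
  have hτ2 : |τ| * (M + 1) < ρ := by
    have : |τ| ≤ ρ / (2 * (M + 1)) := hτ.trans ((min_le_right _ _).trans (min_le_left _ _))
    rw [le_div_iff₀ (by positivity)] at this
    linarith
  have hτ3 : |τ| < ρ2 := by
    have : |τ| ≤ ρ2 / 2 := hτ.trans ((min_le_right _ _).trans (min_le_right _ _))
    linarith
  have hτM : |τ| * M ≤ |τ| * (M + 1) := by nlinarith [abs_nonneg τ]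
  have h4 : ∀ x, |τ| * ‖fderiv ℝ φ x‖ ≤ |τ| * M := fun x =>
    mul_le_mul_of_nonneg_left (hM x) (abs_nonneg _)
  set ψ : Euc N → Euc N := fun x => x - τ • φ x with hψ
  have hψd : ∀ x, HasFDerivAt ψ (ContinuousLinearMap.id ℝ (Euc N) - τ • fderiv ℝ φ x) x :=
    fun x => (hasFDerivAt_id x).sub ((hfd x).const_smul τ)
  have hinj : Function.Injective ψ := by
    intro x y hxy
    have hlip : ‖φ x - φ y‖ ≤ M * ‖x - y‖ :=
      Convex.norm_image_sub_le_of_norm_hasFDerivWithin_le (s := univ)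
        (fun z _ => (hfd z).hasFDerivWithinAt) (fun z _ => hM z) convex_univ (mem_univ _) (mem_univ _)
    have h1 : x - y = τ • (φ x - φ y) := by
      simp only [hψ] at hxy
      rw [smul_sub]
      have := sub_eq_sub_iff_add_eq_add.1 hxy
      rw [sub_eq_sub_iff_add_eq_add, this]; abel
    have h2 : ‖x - y‖ ≤ 1/2 * ‖x - y‖ := by
      calc ‖x - y‖ = |τ| * ‖φ x - φ y‖ := by rw [h1, norm_smul, Real.norm_eq_abs]
        _ ≤ |τ| * (M * ‖x - y‖) := mul_le_mul_of_nonneg_left hlip (abs_nonneg _)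
        _ = (|τ| * M) * ‖x - y‖ := by ring
        _ ≤ 1/2 * ‖x - y‖ := mul_le_mul_of_nonneg_right (by linarith) (norm_nonneg _)
    have h3 : ‖x - y‖ = 0 := by linarith [norm_nonneg (x - y)]
    exact sub_eq_zero.1 (norm_eq_zero.1 h3)
  have hoff : ∀ x, x ∉ K → ψ x = x := fun x hx => by
    simp [hψ, image_eq_zero_of_notMem_tsupport hx]
  have hmaps : MapsTo ψ K K := by
    intro x hx
    by_contra hc
    have := hinj (hoff _ hc)
    rw [this] at hc
    exact hc hx
  have hcv : ∀ S, MeasurableSet S → MapsTo ψ S S → ∀ G : Euc N → ℝ≥0∞,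
        ∫⁻ x in S, G (ψ x) ≤ ENNReal.ofReal (1 + θ) * ∫⁻ x in S, G x := by
    intro S hS hmS G
    have hcvf := lintegral_image_eq_lintegral_abs_det_fderiv_mul volume hS
      (fun x _ => (hψd x).hasFDerivWithinAt) hinj.injOn G
    have : ∫⁻ x in S, G (ψ x) ≤ ENNReal.ofReal (1 + θ) * ∫⁻ x in ψ '' S, G x := by
      rw [hcvf, ← lintegral_const_mul' _ _ ENNReal.ofReal_ne_top]
      refine lintegral_mono fun x => ?_
      rw [← mul_assoc, ← ENNReal.ofReal_mul (by positivity)]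
      have h1 : (1:ℝ) ≤ (1 + θ) *
          |(ContinuousLinearMap.id ℝ (Euc N) - τ • fderiv ℝ φ x).det| := by
        have := hdet (ContinuousLinearMap.id ℝ (Euc N) - τ • fderiv ℝ φ x) (by
          rw [sub_sub_cancel_left, norm_neg, norm_smul, Real.norm_eq_abs]
          linarith [h4 x])
        rwa [inv_le_iff_one_le_mul₀' (by positivity)] at this
      calc G (ψ x) = 1 * G (ψ x) := (one_mul _).symm
        _ ≤ _ := by
          gcongr
          rw [← ENNReal.ofReal_one]
          exact ENNReal.ofReal_le_ofReal h1
    refine this.trans ?_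
    gcongr
    exact hmS.image_subset
  refine ⟨hmaps, hcv, ?_, fun x => by linarith [h4 x]⟩
  have hcongr : ∀ x ∈ K, A.indicator (1 : Euc N → ℝ) x = (A ∩ K).indicator 1 x := by
    intro x hx
    by_cases hxA : x ∈ A <;> simp [hxA, hx]
  set f := (A ∩ K).indicator (1 : Euc N → ℝ) with hf
  have hψc : Continuous ψ := continuous_id.sub (hφ.continuous.const_smul τ)
  have hfm : Measurable f := measurable_one.indicator (hA.inter hKc.measurableSet)
  calc ∫⁻ x in K, ‖A.indicator (1 : Euc N → ℝ) (ψ x) - A.indicator 1 x‖ₑ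
      ≤ ∫⁻ x in K, (‖f (ψ x) - g (ψ x)‖ₑ + (‖g (ψ x) - g x‖ₑ + ‖f x - g x‖ₑ)) := by
        refine setLIntegral_mono' hKc.measurableSet fun x hx => ?_
        rw [hcongr x hx, hcongr _ (hmaps hx)]
        have : f (ψ x) - f x = (f (ψ x) - g (ψ x)) + ((g (ψ x) - g x) - (f x - g x)) := by ring
        rw [this]
        exact (enorm_add_le _ _).trans (add_le_add le_rfl enorm_sub_le)
    _ = (∫⁻ x in K, ‖f (ψ x) - g (ψ x)‖ₑ) + ((∫⁻ x in K, ‖g (ψ x) - g x‖ₑ) +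
          ∫⁻ x in K, ‖f x - g x‖ₑ) := by
        rw [lintegral_add_left, lintegral_add_left]
        · exact ((g3.comp hψc).sub g3).measurable.enorm
        · exact ((hfm.sub g3.measurable).comp hψc.measurable).enorm
    _ ≤ ENNReal.ofReal (2 * (α / 4)) + (ENNReal.ofReal (α/4) + ENNReal.ofReal (α/4)) := by
        gcongr
        · refine (hcv K hKc.measurableSet hmaps fun y => ‖f y - g y‖ₑ).trans ?_
          rw [ENNReal.ofReal_mul (by norm_num)]
          gcongr
          · linarith
          · exact (setLIntegral_le_lintegral _ _).trans g2
        · calc ∫⁻ x in K, ‖g (ψ x) - g x‖ₑ ≤ ∫⁻ x in K, ENNReal.ofReal (α / (4 * (V + 1))) := by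
                refine lintegral_mono fun x => ?_
                rw [← ofReal_norm]
                refine ENNReal.ofReal_le_ofReal ?_
                rw [← dist_eq_norm]
                refine (hg ?_).le
                rw [dist_eq_norm]
                simp only [hψ, sub_sub_cancel_left, norm_neg, norm_smul, Real.norm_eq_abs]
                have := mul_le_of_le_one_right (abs_nonneg τ) (hb x)
                linarith
            _ = ENNReal.ofReal (α / (4 * (V + 1)) * V) := by
                rw [setLIntegral_const, ENNReal.ofReal_mul (by positivity),
                  ENNReal.ofReal_toReal hKc.measure_lt_top.ne]
            _ ≤ ENNReal.ofReal (α / 4) := by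
                refine ENNReal.ofReal_le_ofReal ?_
                rw [div_mul_eq_mul_div, div_le_div_iff₀ (by positivity) (by positivity)]
                nlinarith
        · exact (setLIntegral_le_lintegral _ _).trans g2
    _ = ENNReal.ofReal α := by
        rw [← ENNReal.ofReal_add (by positivity) (by positivity),
          ← ENNReal.ofReal_add (by positivity) (by positivity)]
        congr 1
        ring

lemma flow_mvt {Ω : Set (Euc N)} (hΩ : IsOpen Ω) {h : Euc N → ℝ} (hh : ContDiffOn ℝ 2 h Ω)
    {φ : Euc N → Euc N} (hφ : φ ∈ TestVF Ω) {s : ℝ} (hs : 0 < s)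
    (hmaps : ∀ τ : ℝ, |τ| ≤ s → MapsTo (fun x => x - τ • φ x) (tsupport φ) (tsupport φ))
    {B : Set (Euc N)} (hB : MeasurableSet B) (hBK : B ⊆ tsupport φ) :
    ∃ τ, 0 < τ ∧ τ < s / 2 ∧ - ∫ x in B, fderiv ℝ h (x - τ • φ x) (φ x) =
      ((∫ x in B, h (x - (s/2) • φ x)) - ∫ x in B, h x) / (s / 2) := by
  obtain ⟨φ1, φ2, φ3, φ4⟩ := hφ
  have hKc : IsCompact (tsupport φ) := φ2
  have hfc : ContinuousOn (fderiv ℝ h) Ω := hh.continuousOn_fderiv_of_isOpen hΩ (by norm_num)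
  obtain ⟨C, hC⟩ := hKc.exists_bound_of_continuousOn (hfc.mono φ3)
  have hBfin : volume B < ⊤ := (measure_mono hBK).trans_lt hKc.measure_lt_top
  have : IsFiniteMeasure (volume.restrict B) := ⟨by simpa using hBfin⟩
  have hcomp : ∀ τ, |τ| ≤ s → ∀ {F : Type} [NormedAddCommGroup F] [NormedSpace ℝ F]
      {g : Euc N → F}, ContinuousOn g Ω →
      ContinuousOn (fun x => g (x - τ • φ x)) (tsupport φ) := by
    intro τ hτ F _ _ g hg
    exact hg.comp (continuous_id.sub (φ1.continuous.const_smul τ)).continuousOn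
      fun x hx => φ3 (hmaps τ hτ hx)
  have hIntg : ∀ τ, |τ| ≤ s → ∀ {F : Type} [NormedAddCommGroup F] [NormedSpace ℝ F]
      {g : Euc N → F}, ContinuousOn g Ω →
      IntegrableOn (fun x => g (x - τ • φ x)) B := by
    intro τ hτ F _ _ g hg
    exact ((hcomp τ hτ hg).integrableOn_compact hKc).mono_set hBK
  have hder : ∀ τ : ℝ, |τ| < s → HasDerivAt (fun τ => ∫ x in B, h (x - τ • φ x))
      (∫ x in B, -(fderiv ℝ h (x - τ • φ x) (φ x))) τ := by
    intro τ hτ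
    have hnhds : {t : ℝ | |t| < s} ∈ 𝓝 τ := (isOpen_lt continuous_abs continuous_const).mem_nhds hτ
    refine (hasDerivAt_integral_of_dominated_loc_of_deriv_le (bound := fun _ => C)
      (μ := volume.restrict B) (F := fun τ x => h (x - τ • φ x))
      (F' := fun τ x => -(fderiv ℝ h (x - τ • φ x) (φ x))) hnhds ?_
      (hIntg τ hτ.le hh.continuousOn) ?_ ?_ (integrable_const _) ?_).2
    · filter_upwards [hnhds] with t ht
      exact (hIntg t (le_of_lt ht) hh.continuousOn).aestronglyMeasurable
    · have : ContinuousOn (fun x => -(fderiv ℝ h (x - τ • φ x) (φ x))) (tsupport φ) :=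
        ((hcomp τ hτ.le hfc).clm_apply φ1.continuous.continuousOn).neg
      exact ((this.integrableOn_compact hKc).mono_set hBK).aestronglyMeasurable
    · filter_upwards [ae_restrict_mem hB] with x hx t ht
      rw [norm_neg]
      refine (ContinuousLinearMap.le_opNorm _ _).trans ?_
      exact (mul_le_of_le_one_right (norm_nonneg _) (φ4 x)).trans
        (hC _ (hmaps t (le_of_lt ht) (hBK hx)))
    · filter_upwards [ae_restrict_mem hB] with x hx t ht
      have h1 : HasFDerivAt h (fderiv ℝ h (x - t • φ x)) (x - t • φ x) :=
        ((hh.contDiffAt (hΩ.mem_nhds (φ3 (hmaps t (le_of_lt ht) (hBK hx))))).differentiableAt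
          (by norm_num)).hasFDerivAt
      have h2 : HasDerivAt (fun t : ℝ => x - t • φ x) (-(φ x)) t := by
        simpa using ((hasDerivAt_id t).smul_const (φ x)).const_sub x
      have h3 := h1.comp_hasDerivAt t h2
      rw [map_neg] at h3
      exact h3
  obtain ⟨τ, hτ, he⟩ := exists_hasDerivAt_eq_slope (fun τ => ∫ x in B, h (x - τ • φ x))
    (fun τ => ∫ x in B, -(fderiv ℝ h (x - τ • φ x) (φ x))) (show (0:ℝ) < s / 2 by positivity)
    (fun t ht => (hder t (by rw [abs_of_nonneg ht.1]; linarith [ht.2])).continuousAt.continuousWithinAt)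
    (fun t ht => hder t (by rw [abs_of_nonneg ht.1.le]; linarith [ht.2]))
  refine ⟨τ, hτ.1, hτ.2, ?_⟩
  rw [← integral_neg, he]
  simp


lemma int_le_of_lint {X : Type*} [MeasurableSpace X] {μ : Measure X} {f : X → ℝ} {c : ℝ}
    (hc : 0 ≤ c) (h : ∫⁻ x, ENNReal.ofReal (f x) ∂μ ≤ ENNReal.ofReal c) : ∫ x, f x ∂μ ≤ c := by
  by_cases hf : Integrable f μ
  · rw [integral_eq_lintegral_pos_part_sub_lintegral_neg_part hf]
    have := ENNReal.toReal_mono ENNReal.ofReal_ne_top h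
    rw [ENNReal.toReal_ofReal hc] at this
    linarith [ENNReal.toReal_nonneg (a := ∫⁻ x, ENNReal.ofReal (-f x) ∂μ)]
  · rw [integral_undef hf]; exact hc

lemma key_slope {Ω A K : Set (Euc N)} (hA : MeasurableSet A) {φ : Euc N → Euc N}
    (φ1 : ContDiff ℝ 1 φ) (hKc : IsCompact K) (φ3 : K ⊆ Ω) {h : Euc N → ℝ}
    (hh : ContinuousOn h Ω) {σ δ2 : ℝ} (hδ20 : 0 < δ2)
    (n1 : MapsTo (fun x : Euc N => x - σ • φ x) K K)
    (n2 : ∫⁻ x in K, ‖h (x - σ • φ x) - A.indicator 1 (x - σ • φ x)‖ₑ ≤ ENNReal.ofReal (2 * δ2))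
    (hL1K : ∫⁻ x in K, ‖h x - A.indicator 1 x‖ₑ ≤ ENNReal.ofReal δ2) :
    (∫ x in A ∩ K, h (x - σ • φ x)) - ∫ x in A ∩ K, h x ≤ 3 * δ2 := by
      have hKm := hKc.measurableSet
      have hB : MeasurableSet (A ∩ K) := hA.inter hKm
      have hc0 : Continuous (fun x : Euc N => x - σ • φ x) :=
        continuous_id.sub (φ1.continuous.const_smul σ)
      have hm0 : MapsTo (fun x : Euc N => x - σ • φ x) K Ω := fun x hx => φ3 (n1 hx)
      have hcomp : ContinuousOn (fun x => h (x - σ • φ x)) K :=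
        ContinuousOn.comp (g := h) hh hc0.continuousOn hm0
      rw [← integral_sub ((hcomp.integrableOn_compact hKc).mono_set inter_subset_right)
        (((hh.mono φ3).integrableOn_compact hKc).mono_set inter_subset_right)]
      refine int_le_of_lint (by positivity) ?_
      calc ∫⁻ x in A ∩ K, ENNReal.ofReal (h (x - σ • φ x) - h x)
          ≤ ∫⁻ x in A ∩ K, (‖h (x - σ • φ x) - A.indicator 1 (x - σ • φ x)‖ₑ +
              ‖h x - A.indicator 1 x‖ₑ) := by
            refine setLIntegral_mono' hB fun x hx => ?_
            rw [← ofReal_norm, ← ofReal_norm, ← ENNReal.ofReal_add (norm_nonneg _) (norm_nonneg _)]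
            refine ENNReal.ofReal_le_ofReal ?_
            have q1 : A.indicator (1 : Euc N → ℝ) (x - σ • φ x) ≤ 1 := by
              by_cases hq : x - σ • φ x ∈ A
              · rw [indicator_of_mem hq]; simp
              · rw [indicator_of_notMem hq]; exact zero_le_one
            have q2 : A.indicator (1 : Euc N → ℝ) x = 1 := by simp [hx.1]
            rw [Real.norm_eq_abs, Real.norm_eq_abs]
            have q3 := le_abs_self (h (x - σ • φ x) - A.indicator 1 (x - σ • φ x))
            have q4 := neg_abs_le (h x - A.indicator 1 x)
            linarith
        _ = (∫⁻ x in A ∩ K, ‖h (x - σ • φ x) - A.indicator 1 (x - σ • φ x)‖ₑ) +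
              ∫⁻ x in A ∩ K, ‖h x - A.indicator 1 x‖ₑ := by
            refine lintegral_add_right' _ ?_
            have hm : Measurable (A.indicator (1 : Euc N → ℝ)) := measurable_one.indicator hA
            exact ((((hh.mono φ3).mono inter_subset_right).aemeasurable hB).sub
              hm.aemeasurable).enorm
        _ ≤ ENNReal.ofReal (2 * δ2) + ENNReal.ofReal δ2 := by
            refine add_le_add ((lintegral_mono_set inter_subset_right).trans ?_)
              ((lintegral_mono_set inter_subset_right).trans hL1K)
            exact n2
        _ = ENNReal.ofReal (3 * δ2) := by
            rw [← ENNReal.ofReal_add (by positivity) (by positivity)]; congr 1; ring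

set_option maxHeartbeats 1000000 in
lemma key_prop {Ω A : Set (Euc N)} (hΩ : IsOpen Ω) (hA : MeasurableSet A) (hAΩ : A ⊆ Ω)
    (hper : perimeter A Ω < ⊤) {φ : Euc N → Euc N} (hφ : φ ∈ TestVF Ω) {δ : ℝ}
    (hφδ : (perimeter A Ω).toReal - δ < ∫ x in A, diverg φ x)
    {ω : Euc N → ℝ} (hω : ContinuousOn ω Ω) (hω1 : ∀ x ∈ Ω, 1 ≤ ω x) {κ : ℝ} (hκ : 0 < κ) :
    ∃ v : Euc N → ℝ, ContDiffOn ℝ 1 v Ω ∧ IntegrableOn (fderiv ℝ v) Ω ∧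
      ∫ x in Ω, (‖fderiv ℝ v x‖ + fderiv ℝ v x (φ x)) ≤ δ + κ ∧
      ∫ x in A, ‖fderiv ℝ v x‖ ≤ δ + κ ∧
      ∫⁻ x in Ω, ENNReal.ofReal (ω x * |v x - A.indicator 1 x|) ≤ ENNReal.ofReal κ := by
  have hφ' := hφ
  obtain ⟨φ1, φ2, φ3, φ4⟩ := hφ
  set K := tsupport φ with hK
  have hKc : IsCompact K := φ2
  have hKm := hKc.measurableSet
  set P := (perimeter A Ω).toReal with hP
  have hP0 : 0 ≤ P := ENNReal.toReal_nonneg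
  obtain ⟨D, hD0, hD⟩ := diverg_bound φ1 φ2
  obtain ⟨W, hW1, hW⟩ : ∃ W : ℝ, 1 ≤ W ∧ ∀ x ∈ K, ω x ≤ W := by
    obtain ⟨C, hC⟩ := hKc.exists_bound_of_continuousOn (hω.mono φ3)
    exact ⟨max C 1, le_max_right _ _, fun x hx =>
      ((le_abs_self _).trans (hC x hx)).trans (le_max_left _ _)⟩
  have hW0 : 0 < W := by linarith
  set κ' := κ / (4 * (D + 1)) with hκ'
  have hκ'0 : 0 < κ' := by positivity
  have hκ'1 : κ' ≤ κ := div_le_self hκ.le (by linarith)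
  have hκ'2 : D * κ' ≤ κ / 4 := by
    rw [hκ', mul_div_assoc', div_le_div_iff₀ (by positivity) (by positivity)]; nlinarith
  set θ := min (1/2) (κ / (4 * (3 * P + 4))) with hθ
  have hθ0 : 0 < θ := by positivity
  have hθ1 : θ ≤ 1/2 := min_le_left _ _
  have hθ2 : θ * (3 * P + 4) ≤ κ / 4 := by
    have : θ ≤ κ / (4 * (3 * P + 4)) := min_le_right _ _
    rw [le_div_iff₀ (by positivity)] at this
    linarith
  obtain ⟨s, hs0, hs⟩ := flow_lemma φ1 φ2 φ4 hA hθ0 hθ1 (show 0 < κ' / (2 * W) by positivity)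
  set δ2 := min θ (min (s * κ / 24) (κ' / (2 * (1 + 2 * W)))) with hδ2
  have hδ20 : 0 < δ2 := by positivity
  have hδ21 : δ2 ≤ θ := min_le_left _ _
  have hδ22 : δ2 ≤ s * κ / 24 := (min_le_right _ _).trans (min_le_left _ _)
  have hδ23 : δ2 * (1 + 2 * W) ≤ κ' / 2 := by
    have : δ2 ≤ κ' / (2 * (1 + 2 * W)) := (min_le_right _ _).trans (min_le_right _ _)
    rw [le_div_iff₀ (by positivity)] at this
    linarith
  obtain ⟨h, hh, hh1, hh2⟩ := AG hΩ hA hper hω hδ20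
  have hB : MeasurableSet (A ∩ K) := hA.inter hKm
  obtain ⟨τ, hτ0, hτs, hτ⟩ := flow_mvt hΩ hh hφ' hs0 (fun τ hτ => (hs τ hτ).1) hB inter_subset_right
  have hτa : |τ| ≤ s := by rw [abs_of_pos hτ0]; linarith
  have hsa : |s / 2| ≤ s := by rw [abs_of_pos (by positivity)]; linarith
  obtain ⟨m1, m2, m3, m4⟩ := hs τ hτa
  obtain ⟨n1, n2, n3, n4⟩ := hs (s/2) hsa
  have hL1K : ∫⁻ x in K, ‖h x - A.indicator 1 x‖ₑ ≤ ENNReal.ofReal δ2 := by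
    refine le_trans ?_ hh1
    refine le_trans (setLIntegral_mono' hKm fun x hx => ?_) (lintegral_mono_set φ3)
    rw [← ofReal_norm, Real.norm_eq_abs]
    exact ENNReal.ofReal_le_ofReal (le_mul_of_one_le_left (abs_nonneg _) (hω1 x (φ3 hx)))
  have h15 : ENNReal.ofReal (1 + θ) * ENNReal.ofReal δ2 ≤ ENNReal.ofReal (2 * δ2) := by
    rw [← ENNReal.ofReal_mul (by positivity)]
    exact ENNReal.ofReal_le_ofReal (by nlinarith)
  set ψ : Euc N → Euc N := fun x => x - τ • φ x with hψ
  have hψoff : ∀ x, x ∉ K → ψ x = x := fun x hx => by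
    simp [hψ, image_eq_zero_of_notMem_tsupport hx]
  have hψΩ : MapsTo ψ Ω Ω := fun x hx => by
    by_cases hxK : x ∈ K
    · exact φ3 (m1 hxK)
    · rw [hψoff x hxK]; exact hx
  have hψc : ContDiff ℝ 1 ψ := contDiff_id.sub (φ1.const_smul τ)
  set v : Euc N → ℝ := fun x => h (ψ x) with hv
  have hvC : ContDiffOn ℝ 1 v Ω := (hh.of_le (by norm_num)).comp hψc.contDiffOn hψΩ
  -- L1 closeness
  have hiii : ∫⁻ x in Ω, ENNReal.ofReal (ω x * |v x - A.indicator 1 x|) ≤ ENNReal.ofReal κ' := by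
    rw [← lintegral_inter_add_sdiff _ Ω hKm, inter_eq_self_of_subset_right φ3]
    have p1 : ∫⁻ x in K, ENNReal.ofReal (ω x * |v x - A.indicator 1 x|) ≤
        ENNReal.ofReal W * (ENNReal.ofReal (2 * δ2) + ENNReal.ofReal (κ' / (2 * W))) := by
      calc ∫⁻ x in K, ENNReal.ofReal (ω x * |v x - A.indicator 1 x|)
          ≤ ∫⁻ x in K, ENNReal.ofReal W * (‖h (ψ x) - A.indicator 1 (ψ x)‖ₑ +
              ‖A.indicator (1 : Euc N → ℝ) (ψ x) - A.indicator 1 x‖ₑ) := by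
            refine setLIntegral_mono' hKm fun x hx => ?_
            calc ENNReal.ofReal (ω x * |v x - A.indicator 1 x|)
                ≤ ENNReal.ofReal (W * ‖v x - A.indicator 1 x‖) := by
                  refine ENNReal.ofReal_le_ofReal ?_
                  rw [Real.norm_eq_abs]
                  exact mul_le_mul_of_nonneg_right (hW x hx) (abs_nonneg _)
              _ = ENNReal.ofReal W * ‖v x - A.indicator 1 x‖ₑ := by
                  rw [ENNReal.ofReal_mul hW0.le, ofReal_norm]
              _ ≤ _ := by
                  gcongr
                  rw [← sub_add_sub_cancel (v x) (A.indicator 1 (ψ x))]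
                  exact enorm_add_le _ _
        _ = ENNReal.ofReal W * ((∫⁻ x in K, ‖h (ψ x) - A.indicator 1 (ψ x)‖ₑ) +
              ∫⁻ x in K, ‖A.indicator (1 : Euc N → ℝ) (ψ x) - A.indicator 1 x‖ₑ) := by
            rw [lintegral_const_mul' _ _ ENNReal.ofReal_ne_top, lintegral_add_right]
            have hm : Measurable (A.indicator (1 : Euc N → ℝ)) := measurable_one.indicator hA
            exact ((hm.comp hψc.continuous.measurable).sub hm).enorm
        _ ≤ _ := by
            gcongr
            refine (m2 K hKm m1 fun y => ‖h y - A.indicator 1 y‖ₑ).trans (le_trans ?_ h15)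
            gcongr
    have p2 : ∫⁻ x in Ω \ K, ENNReal.ofReal (ω x * |v x - A.indicator 1 x|) ≤
        ENNReal.ofReal δ2 := by
      refine le_trans ?_ hh1
      refine le_trans (setLIntegral_mono' (hΩ.measurableSet.diff hKm) fun x hx => ?_)
        (lintegral_mono_set sdiff_subset)
      simp only [hv, hψoff x hx.2]
      exact le_rfl
    refine (add_le_add p1 p2).trans ?_
    rw [← ENNReal.ofReal_add (by positivity) (by positivity), ← ENNReal.ofReal_mul hW0.le,
      ← ENNReal.ofReal_add (by positivity) (by positivity)]
    refine ENNReal.ofReal_le_ofReal ?_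
    have : W * (κ' / (2 * W)) = κ' / 2 := by field_simp
    linarith
  -- gradient
  have hvd : ∀ x ∈ Ω, fderiv ℝ v x =
      (fderiv ℝ h (ψ x)).comp (ContinuousLinearMap.id ℝ (Euc N) - τ • fderiv ℝ φ x) := by
    intro x hx
    have d1 : HasFDerivAt h (fderiv ℝ h (ψ x)) (ψ x) :=
      ((hh.contDiffAt (hΩ.mem_nhds (hψΩ hx))).differentiableAt (by norm_num)).hasFDerivAt
    have d2 : HasFDerivAt ψ (ContinuousLinearMap.id ℝ (Euc N) - τ • fderiv ℝ φ x) x :=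
      (hasFDerivAt_id x).sub ((φ1.differentiable one_ne_zero x).hasFDerivAt.const_smul τ)
    exact (d1.comp x d2).fderiv
  have hτM : ∀ x, ‖τ • fderiv ℝ φ x‖ ≤ θ := fun x => by
    rw [norm_smul, Real.norm_eq_abs]; exact m4 x
  have hvn : ∀ x ∈ Ω, ‖fderiv ℝ v x‖ ≤ (1 + θ) * ‖fderiv ℝ h (ψ x)‖ := by
    intro x hx
    rw [hvd x hx, mul_comm]
    refine (ContinuousLinearMap.opNorm_comp_le _ _).trans ?_
    gcongr
    refine (norm_sub_le _ _).trans (add_le_add ContinuousLinearMap.norm_id_le (hτM x))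
  have hGψ : ∫⁻ x in Ω, ‖fderiv ℝ h (ψ x)‖ₑ ≤ ENNReal.ofReal ((1 + θ) * (P + δ2)) := by
    refine (m2 Ω hΩ.measurableSet hψΩ fun y => ‖fderiv ℝ h y‖ₑ).trans ?_
    rw [ENNReal.ofReal_mul (by positivity)]
    gcongr
  have hgrad : ∫⁻ x in Ω, ‖fderiv ℝ v x‖ₑ ≤ ENNReal.ofReal ((1 + θ) * ((1 + θ) * (P + δ2))) := by
    rw [ENNReal.ofReal_mul (by positivity)]
    refine le_trans ?_ (mul_le_mul_right hGψ _)
    rw [← lintegral_const_mul' _ _ ENNReal.ofReal_ne_top]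
    refine setLIntegral_mono' hΩ.measurableSet fun x hx => ?_
    rw [← ofReal_norm, ← ofReal_norm, ← ENNReal.ofReal_mul (by positivity)]
    exact ENNReal.ofReal_le_ofReal (hvn x hx)
  have hvint : IntegrableOn (fderiv ℝ v) Ω :=
    ⟨(hvC.continuousOn_fderiv_of_isOpen hΩ le_rfl).aestronglyMeasurable hΩ.measurableSet,
      hgrad.trans_lt ENNReal.ofReal_lt_top⟩
  have hnorm : ∫ x in Ω, ‖fderiv ℝ v x‖ ≤ (1 + θ) * ((1 + θ) * (P + δ2)) :=
    int_le_of_lint (by positivity) (by simpa only [ofReal_norm] using hgrad)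
  obtain ⟨i1, i2, i3⟩ := ibp hΩ hvC φ1 φ2 φ3
  have hzero : ∀ x, x ∉ K → fderiv ℝ v x (φ x) = 0 := fun x hx => by
    rw [image_eq_zero_of_notMem_tsupport hx, map_zero]
  have hΩint : ∫ x in Ω, fderiv ℝ v x (φ x) = ∫ x, fderiv ℝ v x (φ x) :=
    setIntegral_eq_integral_of_forall_compl_eq_zero fun x hx => hzero x fun hc => hx (φ3 hc)
  have hdivA : (∫ x in A, diverg φ x) - ∫ x, v x * diverg φ x ≤ D * κ' := by
    rw [← integral_indicator hA, ← integral_sub ((diverg_integrable φ1 φ2).indicator hA) i1]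
    refine int_le_of_lint (by positivity) ?_
    rw [ENNReal.ofReal_mul hD0]
    refine le_trans ?_ (mul_le_mul_right hiii _)
    rw [← lintegral_const_mul' _ _ ENNReal.ofReal_ne_top, ← lintegral_indicator hΩ.measurableSet]
    refine lintegral_mono fun x => ?_
    by_cases hxK : x ∈ K
    · rw [indicator_of_mem (φ3 hxK), ← ENNReal.ofReal_mul hD0]
      refine ENNReal.ofReal_le_ofReal ?_
      have e : A.indicator (fun x => diverg φ x) x - v x * diverg φ x =
          -((v x - A.indicator 1 x) * diverg φ x) := by
        by_cases hxA : x ∈ A <;> simp [hxA] <;> ring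
      rw [e]
      refine (neg_le_abs _).trans ?_
      rw [abs_mul, mul_comm]
      refine mul_le_mul (hD x) (le_mul_of_one_le_left (abs_nonneg _) (hω1 x (φ3 hxK)))
        (abs_nonneg _) hD0
    · have hd0 := diverg_eq_zero hxK
      have : A.indicator (fun x => diverg φ x) x - v x * diverg φ x = 0 := by
        by_cases hxA : x ∈ A <;> simp [hxA, hd0]
      rw [this]; simp
  have hpar : (1 + θ) * ((1 + θ) * (P + δ2)) - P ≤ κ / 4 := by
    have a1 : (1 + θ) * ((1 + θ) * (P + δ2)) ≤ (1 + θ) * ((1 + θ) * (P + θ)) := by gcongr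
    have a2 : (1 + θ) * ((1 + θ) * (P + θ)) - P ≤ θ * (3 * P + 4) := by
      nlinarith [mul_nonneg hθ0.le hP0, mul_nonneg (mul_nonneg hθ0.le hP0) (sub_nonneg.2 hθ1),
        mul_nonneg hθ0.le (sub_nonneg.2 hθ1), mul_nonneg (mul_nonneg hθ0.le hθ0.le) (sub_nonneg.2 hθ1)]
    linarith
  have hi2' : IntegrableOn (fun x => fderiv ℝ v x (φ x)) Ω := i2.integrableOn
  have hi : ∫ x in Ω, (‖fderiv ℝ v x‖ + fderiv ℝ v x (φ x)) ≤ δ + κ / 2 := by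
    rw [integral_add hvint.norm hi2', hΩint]
    linarith
  have hnn : ∀ x, 0 ≤ ‖fderiv ℝ v x‖ + fderiv ℝ v x (φ x) := by
    intro x
    have : |fderiv ℝ v x (φ x)| ≤ ‖fderiv ℝ v x‖ :=
      ((fderiv ℝ v x).le_opNorm _).trans (mul_le_of_le_one_right (norm_nonneg _) (φ4 x))
    linarith [neg_abs_le (fderiv ℝ v x (φ x))]
  -- the slope estimate
  have hslope : -∫ x in A ∩ K, fderiv ℝ h (ψ x) (φ x) ≤ κ / 4 := by
    rw [hτ]
    have n2' : ∫⁻ x in K, ‖h (x - (s/2) • φ x) - A.indicator 1 (x - (s/2) • φ x)‖ₑ ≤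
        ENNReal.ofReal (2 * δ2) := by
      refine (n2 K hKm n1 fun y => ‖h y - A.indicator 1 y‖ₑ).trans (le_trans ?_ h15)
      gcongr
    have hF := key_slope hA φ1 hKc φ3 hh.continuousOn hδ20 n1 n2' hL1K
    rw [div_le_iff₀ (by positivity)]
    have hr : κ / 4 * (s / 2) = 3 * (s * κ / 24) := by ring
    linarith
  have hvA : -∫ x in A, fderiv ℝ v x (φ x) ≤ κ / 2 := by
    have e1 : ∫ x in A, fderiv ℝ v x (φ x) = ∫ x in A ∩ K, fderiv ℝ v x (φ x) := by
      rw [← setIntegral_indicator hKm]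
      refine setIntegral_congr_fun hA fun x hx => ?_
      by_cases hxK : x ∈ K
      · simp [hxK]
      · simp [hxK, hzero x hxK]
    have hc1 : ContinuousOn (fun x => fderiv ℝ h (ψ x) (φ x)) K :=
      (((hh.continuousOn_fderiv_of_isOpen hΩ (by norm_num)).comp hψc.continuous.continuousOn
        fun x hx => φ3 (m1 hx)).clm_apply φ1.continuous.continuousOn)
    have e2 : (-∫ x in A ∩ K, fderiv ℝ v x (φ x)) - (-∫ x in A ∩ K, fderiv ℝ h (ψ x) (φ x)) ≤
        θ * ((1 + θ) * (P + δ2)) := by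
      have j1 : IntegrableOn (fun x => -fderiv ℝ v x (φ x)) (A ∩ K) := i2.neg.integrableOn
      have j2 : IntegrableOn (fun x => -fderiv ℝ h (ψ x) (φ x)) (A ∩ K) :=
        ((hc1.integrableOn_compact hKc).mono_set inter_subset_right).neg
      rw [← integral_neg, ← integral_neg, ← integral_sub j1 j2]
      refine int_le_of_lint (by positivity) ?_
      rw [ENNReal.ofReal_mul hθ0.le]
      refine le_trans ?_ (mul_le_mul_right hGψ _)
      rw [← lintegral_const_mul' _ _ ENNReal.ofReal_ne_top]
      refine le_trans (setLIntegral_mono' hB fun x hx => ?_)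
        (lintegral_mono_set (inter_subset_right.trans φ3))
      rw [← ofReal_norm, ← ENNReal.ofReal_mul hθ0.le]
      refine ENNReal.ofReal_le_ofReal ?_
      rw [hvd x (φ3 hx.2)]
      have e3 : -((fderiv ℝ h (ψ x)).comp (ContinuousLinearMap.id ℝ (Euc N) - τ • fderiv ℝ φ x)) (φ x)
          - -(fderiv ℝ h (ψ x)) (φ x) = fderiv ℝ h (ψ x) ((τ • fderiv ℝ φ x) (φ x)) := by
        simp
      rw [e3]
      refine (le_abs_self _).trans (((fderiv ℝ h (ψ x)).le_opNorm _).trans ?_)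
      rw [mul_comm]
      gcongr
      refine ((τ • fderiv ℝ φ x).le_opNorm _).trans ?_
      exact (mul_le_of_le_one_right (norm_nonneg _) (φ4 x)).trans (hτM x)
    have e4 : θ * ((1 + θ) * (P + δ2)) ≤ κ / 4 := by nlinarith
    rw [e1]
    linarith
  refine ⟨v, hvC, hvint, by linarith, ?_, hiii.trans (ENNReal.ofReal_le_ofReal hκ'1)⟩
  have hsumint : IntegrableOn (fun x => ‖fderiv ℝ v x‖ + fderiv ℝ v x (φ x)) Ω :=
    hvint.norm.add hi2'
  have f1 : ∫ x in A, (‖fderiv ℝ v x‖ + fderiv ℝ v x (φ x)) ≤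
      ∫ x in Ω, (‖fderiv ℝ v x‖ + fderiv ℝ v x (φ x)) :=
    setIntegral_mono_set hsumint (Eventually.of_forall hnn) (LE.le.eventuallyLE hAΩ)
  rw [integral_add (hvint.mono_set hAΩ).norm i2.integrableOn] at f1
  linarith

lemma exists_Lr : ∃ L : ℝ, 0 < L ∧ ∀ y, 0 ≤ deriv Real.smoothTransition y ∧
    deriv Real.smoothTransition y ≤ L ∧ (y ≤ 0 → deriv Real.smoothTransition y = 0) ∧
    (1 ≤ y → deriv Real.smoothTransition y = 0) := by
  have hc : Continuous (deriv Real.smoothTransition) :=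
    (Real.smoothTransition.contDiff (n := 1)).continuous_deriv le_rfl
  obtain ⟨C, hC⟩ := (isCompact_Icc (a := (0:ℝ)) (b := 1)).exists_bound_of_continuousOn
    hc.continuousOn
  have h0 : ∀ y, y ≤ 0 → deriv Real.smoothTransition y = 0 := fun y hy => by
    refine IsLocalMin.deriv_eq_zero (Eventually.of_forall fun z => ?_)
    rw [Real.smoothTransition.zero_of_nonpos hy]
    exact Real.smoothTransition.nonneg z
  have h1 : ∀ y, 1 ≤ y → deriv Real.smoothTransition y = 0 := fun y hy => by
    refine IsLocalMax.deriv_eq_zero (Eventually.of_forall fun z => ?_)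
    rw [Real.smoothTransition.one_of_one_le hy]
    exact Real.smoothTransition.le_one z
  refine ⟨max C 1, by positivity, fun y => ⟨Real.smoothTransition.monotone.deriv_nonneg, ?_,
    h0 y, h1 y⟩⟩
  rcases le_total y 0 with hy | hy
  · rw [h0 y hy]; positivity
  rcases le_total 1 y with hy1 | hy1
  · rw [h1 y hy1]; positivity
  exact ((le_abs_self _).trans (hC y ⟨hy, hy1⟩)).trans (le_max_left _ _)

/-- Bound for the derivative of the smooth transition. -/
def Lr : ℝ := Classical.choose exists_Lr

lemma Lr_pos : 0 < Lr := (Classical.choose_spec exists_Lr).1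

/-- The ramp function at level `c` with slope of order `n`. -/
def rmp (n c y : ℝ) : ℝ := Real.smoothTransition (n * (y - c))

/-- The derivative of the ramp function. -/
def rmpd (n c y : ℝ) : ℝ := n * deriv Real.smoothTransition (n * (y - c))

lemma rmp_nonneg (n c y : ℝ) : 0 ≤ rmp n c y := Real.smoothTransition.nonneg _

lemma rmp_le_one (n c y : ℝ) : rmp n c y ≤ 1 := Real.smoothTransition.le_one _

lemma rmp_zero {n c y : ℝ} (hn : 0 < n) (h : y ≤ c) : rmp n c y = 0 :=
  Real.smoothTransition.zero_of_nonpos (mul_nonpos_of_nonneg_of_nonpos hn.le (by linarith))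

lemma one_le_of_le {n c y : ℝ} (hn : 0 < n) (h : c + 1 / n ≤ y) : 1 ≤ n * (y - c) := by
  have : 1 / n ≤ y - c := by linarith
  rwa [div_le_iff₀' hn] at this

lemma rmp_one {n c y : ℝ} (hn : 0 < n) (h : c + 1 / n ≤ y) : rmp n c y = 1 :=
  Real.smoothTransition.one_of_one_le (one_le_of_le hn h)

lemma rmp_contDiff (n c : ℝ) : ContDiff ℝ 1 (rmp n c) :=
  (Real.smoothTransition.contDiff (n := 1)).comp
    (contDiff_const.mul (contDiff_id.sub contDiff_const))

lemma rmp_hasDerivAt (n c y : ℝ) : HasDerivAt (rmp n c) (rmpd n c y) y := by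
  have h1 : HasDerivAt Real.smoothTransition (deriv Real.smoothTransition (n * (y - c)))
      (n * (y - c)) :=
    ((Real.smoothTransition.contDiff (n := 1)).differentiable one_ne_zero _).hasDerivAt
  have h2 : HasDerivAt (fun y : ℝ => n * (y - c)) (n * 1) y :=
    ((hasDerivAt_id y).sub_const c).const_mul n
  have := h1.comp y h2
  rw [mul_one, mul_comm] at this
  exact this

lemma rmpd_continuous (n c : ℝ) : Continuous (rmpd n c) := by
  have hc : Continuous (deriv Real.smoothTransition) :=
    (Real.smoothTransition.contDiff (n := 1)).continuous_deriv le_rfl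
  unfold rmpd
  fun_prop

lemma rmpd_nonneg {n : ℝ} (hn : 0 < n) (c y : ℝ) : 0 ≤ rmpd n c y :=
  mul_nonneg hn.le ((Classical.choose_spec exists_Lr).2 _).1

lemma rmpd_le {n : ℝ} (hn : 0 < n) (c y : ℝ) : rmpd n c y ≤ n * Lr :=
  mul_le_mul_of_nonneg_left ((Classical.choose_spec exists_Lr).2 _).2.1 hn.le

lemma rmpd_zero {n c y : ℝ} (hn : 0 < n) (h : y ≤ c) : rmpd n c y = 0 := by
  rw [rmpd, ((Classical.choose_spec exists_Lr).2 _).2.2.1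
    (mul_nonpos_of_nonneg_of_nonpos hn.le (by linarith)), mul_zero]

lemma rmpd_one {n c y : ℝ} (hn : 0 < n) (h : c + 1 / n ≤ y) : rmpd n c y = 0 := by
  rw [rmpd, ((Classical.choose_spec exists_Lr).2 _).2.2.2 (one_le_of_le hn h), mul_zero]

lemma rmp_tendsto (c y : ℝ) :
    Tendsto (fun n : ℕ => rmp n c y) atTop (𝓝 ((Ioi c).indicator 1 y)) := by
  by_cases h : y ≤ c
  · rw [indicator_of_notMem (by simpa using h)]
    refine tendsto_const_nhds.congr' ?_
    filter_upwards [eventually_gt_atTop 0] with n hn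
    rw [rmp_zero (by exact_mod_cast hn) h]
  · push Not at h
    rw [indicator_of_mem (by simpa using h)]
    refine tendsto_const_nhds.congr' ?_
    filter_upwards [eventually_gt_atTop 0,
      tendsto_one_div_atTop_nhds_zero_nat.eventually (gt_mem_nhds (sub_pos.2 h))] with n hn h2
    rw [rmp_one (by exact_mod_cast hn) (by linarith)]
    rfl

lemma fderiv_rmp {v : Euc N → ℝ} {x : Euc N} (hv : DifferentiableAt ℝ v x) (n c : ℝ) :
    fderiv ℝ (fun y => rmp n c (v y)) x = rmpd n c (v x) • fderiv ℝ v x :=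
  ((rmp_hasDerivAt n c (v x)).comp_hasFDerivAt x hv.hasFDerivAt).fderiv

lemma level_sel (m : Measure ℝ) {a b K : ℝ} (hab : a ≤ b)
    (h : m univ < ENNReal.ofReal (K * (b - a))) :
    ∃ c ∈ Ico a b, ∀ y ∈ Ioc c b, m (Ioc c y) ≤ ENNReal.ofReal (K * (y - c)) := by
  by_contra! hcon
  have hK : 0 < K := by
    by_contra! hK
    rw [ENNReal.ofReal_of_nonpos (mul_nonpos_of_nonpos_of_nonneg hK (by linarith))] at h
    simp at h
  set S : Set ℝ := {x | x ∈ Icc a b ∧ ENNReal.ofReal (K * (x - a)) ≤ m (Ioc a x)} with hS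
  have haS : a ∈ S := ⟨⟨le_rfl, hab⟩, by simp⟩
  have hbdd : BddAbove S := ⟨b, fun x hx => hx.1.2⟩
  set s := sSup S with hs
  have has : a ≤ s := le_csSup hbdd haS
  have hsb : s ≤ b := csSup_le ⟨a, haS⟩ fun x hx => hx.1.2
  have hsS : ENNReal.ofReal (K * (s - a)) ≤ m (Ioc a s) := by
    obtain ⟨u, -, hu, huS⟩ := exists_seq_tendsto_sSup ⟨a, haS⟩ hbdd
    have ht : Tendsto (fun n => ENNReal.ofReal (K * (u n - a))) atTop
        (𝓝 (ENNReal.ofReal (K * (s - a)))) :=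
      ENNReal.tendsto_ofReal ((hu.sub_const a).const_mul K)
    refine le_of_tendsto' ht fun n => (huS n).2.trans (measure_mono ?_)
    exact Ioc_subset_Ioc_right (le_csSup hbdd (huS n))
  rcases hsb.lt_or_eq with hlt | heq
  · obtain ⟨y, hy, hy2⟩ := hcon s ⟨has, hlt⟩
    have : y ∈ S := by
      refine ⟨⟨has.trans hy.1.le, hy.2⟩, ?_⟩
      rw [← Ioc_union_Ioc_eq_Ioc has hy.1.le, measure_union (Ioc_disjoint_Ioc_of_le le_rfl)
        measurableSet_Ioc]
      have e : K * (y - a) = K * (s - a) + K * (y - s) := by ring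
      rw [e, ENNReal.ofReal_add (mul_nonneg hK.le (by linarith))
        (mul_nonneg hK.le (by linarith [hy.1]))]
      exact add_le_add hsS hy2.le
    exact absurd (le_csSup hbdd this) (not_le.2 hy.1)
  · rw [heq] at hsS
    exact absurd (hsS.trans (measure_mono (subset_univ _))) (not_le.2 h)

lemma level_ramp {μ : Measure (Euc N)} [SFinite μ] {F : Euc N → ℝ≥0∞} {v : Euc N → ℝ}
    (hv : AEMeasurable v μ) {a b K : ℝ} (hab : a ≤ b)
    (h : ∫⁻ x, F x ∂μ < ENNReal.ofReal (K * (b - a))) :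
    ∃ c ∈ Ico a b, ∀ n : ℝ, 0 < n → c + 1 / n ≤ b →
      ∫⁻ x, ENNReal.ofReal (rmpd n c (v x)) * F x ∂μ ≤ ENNReal.ofReal (Lr * K) := by
  have hv' : AEMeasurable v (μ.withDensity F) :=
    hv.mono_ac (withDensity_absolutelyContinuous _ _)
  obtain ⟨c, hc, hc2⟩ := level_sel ((μ.withDensity F).map v) hab (K := K) (by
    rw [Measure.map_apply_of_aemeasurable hv' MeasurableSet.univ, preimage_univ,
      withDensity_apply', Measure.restrict_univ]; exact h)
  refine ⟨c, hc, fun n hn hnb => ?_⟩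
  have hn1 : 0 < 1 / n := by positivity
  have h3 := hc2 (c + 1 / n) ⟨by linarith, hnb⟩
  rw [Measure.map_apply_of_aemeasurable hv' measurableSet_Ioc, withDensity_apply'] at h3
  calc ∫⁻ x, ENNReal.ofReal (rmpd n c (v x)) * F x ∂μ
      ≤ ∫⁻ x, ENNReal.ofReal (n * Lr) * (v ⁻¹' Ioc c (c + 1 / n)).indicator F x ∂μ := by
        refine lintegral_mono fun x => ?_
        by_cases hx : x ∈ v ⁻¹' Ioc c (c + 1 / n)
        · rw [indicator_of_mem hx]
          gcongr
          exact rmpd_le hn c _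
        · rw [indicator_of_notMem hx]
          have : rmpd n c (v x) = 0 := by
            rcases le_or_gt (v x) c with h1 | h1
            · exact rmpd_zero hn h1
            · exact rmpd_one hn (by
                by_contra! h2
                exact hx ⟨h1, h2.le⟩)
          simp [this]
    _ = ENNReal.ofReal (n * Lr) * ∫⁻ x, (v ⁻¹' Ioc c (c + 1 / n)).indicator F x ∂μ :=
        lintegral_const_mul' _ _ ENNReal.ofReal_ne_top
    _ ≤ ENNReal.ofReal (n * Lr) * ENNReal.ofReal (K * (c + 1 / n - c)) := by
        gcongr
        exact (lintegral_indicator_le _ _).trans h3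
    _ = ENNReal.ofReal (Lr * K) := by
        rw [← ENNReal.ofReal_mul (mul_nonneg hn.le Lr_pos.le)]
        congr 1
        field_simp
        ring

/-- `E` has relaxed perimeter at most `c` in `Ω`, with `C^1` approximations valued in `[0,1]`. -/
def RelPer (Ω E : Set (Euc N)) (c : ℝ) : Prop :=
  ∃ w : ℕ → Euc N → ℝ, (∀ n, ContDiffOn ℝ 1 (w n) Ω) ∧ (∀ n x, 0 ≤ w n x ∧ w n x ≤ 1) ∧
    (∀ x ∈ Ω, Tendsto (fun n => w n x) atTop (𝓝 (E.indicator 1 x))) ∧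
    ∀ n, ∫⁻ x in Ω, ‖fderiv ℝ (w n) x‖ₑ ≤ ENNReal.ofReal c

lemma relper_integral {Ω E : Set (Euc N)} {c : ℝ} (hΩ : IsOpen Ω) (hE : MeasurableSet E)
    (hc : 0 ≤ c) (h : RelPer Ω E c) {φ : Euc N → Euc N} (hφ : φ ∈ TestVF Ω) :
    ∫ x in E, diverg φ x ≤ c := by
  obtain ⟨w, w1, w2, w3, w4⟩ := h
  obtain ⟨φ1, φ2, φ3, φ4⟩ := hφ
  rw [← integral_indicator hE]
  have hlim : Tendsto (fun n => ∫ x, w n x * diverg φ x) atTop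
      (𝓝 (∫ x, E.indicator (diverg φ) x)) := by
    refine tendsto_integral_of_dominated_convergence (fun x => |diverg φ x|) (fun n =>
      (ibp hΩ (w1 n) φ1 φ2 φ3).1.aestronglyMeasurable) (diverg_integrable φ1 φ2).abs
      (fun n => Eventually.of_forall fun x => ?_) (Eventually.of_forall fun x => ?_)
    · rw [norm_mul, Real.norm_eq_abs, Real.norm_eq_abs, abs_of_nonneg (w2 n x).1]
      exact mul_le_of_le_one_left (abs_nonneg _) (w2 n x).2
    · by_cases hx : x ∈ tsupport φ
      · have e : E.indicator (diverg φ) x = E.indicator 1 x * diverg φ x := by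
          by_cases hxE : x ∈ E <;> simp [hxE]
        rw [e]
        exact (w3 x (φ3 hx)).mul_const _
      · have e : E.indicator (diverg φ) x = 0 := by
          by_cases hxE : x ∈ E <;> simp [hxE, diverg_eq_zero hx]
        simp only [e, diverg_eq_zero hx, mul_zero, tendsto_const_nhds]
  refine le_of_tendsto' hlim fun n => ?_
  rw [(ibp hΩ (w1 n) φ1 φ2 φ3).2.2, ← integral_neg]
  refine int_le_of_lint hc (le_trans ?_ (w4 n))
  rw [← lintegral_indicator hΩ.measurableSet]
  refine lintegral_mono fun x => ?_
  by_cases hx : x ∈ tsupport φ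
  · rw [indicator_of_mem (φ3 hx), ← ofReal_norm]
    refine ENNReal.ofReal_le_ofReal ((neg_le_abs _).trans ?_)
    exact ((fderiv ℝ (w n) x).le_opNorm _).trans (mul_le_of_le_one_right (norm_nonneg _) (φ4 x))
  · rw [image_eq_zero_of_notMem_tsupport hx]; simp

lemma relper_union {Ω E F : Set (Euc N)} {c d : ℝ} (hΩ : IsOpen Ω) (hc : 0 ≤ c) (hd : 0 ≤ d)
    (hE : RelPer Ω E c) (hF : RelPer Ω F d) : RelPer Ω (E ∪ F) (c + d) := by
  obtain ⟨w, w1, w2, w3, w4⟩ := hE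
  obtain ⟨u, u1, u2, u3, u4⟩ := hF
  refine ⟨fun n x => 1 - (1 - w n x) * (1 - u n x), fun n => ?_, fun n x => ?_, fun x hx => ?_,
    fun n => ?_⟩
  · exact contDiffOn_const.sub ((contDiffOn_const.sub (w1 n)).mul (contDiffOn_const.sub (u1 n)))
  · have a1 := w2 n x
    have a2 := u2 n x
    constructor
    · have : (1 - w n x) * (1 - u n x) ≤ 1 := mul_le_one₀ (by linarith) (by linarith) (by linarith)
      linarith
    · have : 0 ≤ (1 - w n x) * (1 - u n x) := mul_nonneg (by linarith) (by linarith)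
      linarith
  · have e : (E ∪ F).indicator (1 : Euc N → ℝ) x =
        1 - (1 - E.indicator 1 x) * (1 - F.indicator 1 x) := by
      by_cases h1 : x ∈ E <;> by_cases h2 : x ∈ F <;> simp [h1, h2]
    rw [e]
    exact tendsto_const_nhds.sub ((tendsto_const_nhds.sub (w3 x hx)).mul
      (tendsto_const_nhds.sub (u3 x hx)))
  · rw [ENNReal.ofReal_add hc hd]
    refine le_trans ?_ (add_le_add (w4 n) (u4 n))
    rw [← lintegral_add_left ((measurable_fderiv ℝ (w n)).enorm)]
    refine setLIntegral_mono' hΩ.measurableSet fun x hx => ?_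
    have d1 : HasFDerivAt (w n) (fderiv ℝ (w n) x) x :=
      (((w1 n).contDiffAt (hΩ.mem_nhds hx)).differentiableAt one_ne_zero).hasFDerivAt
    have d2 : HasFDerivAt (u n) (fderiv ℝ (u n) x) x :=
      (((u1 n).contDiffAt (hΩ.mem_nhds hx)).differentiableAt one_ne_zero).hasFDerivAt
    have d3 := ((d1.const_sub 1).mul (d2.const_sub 1)).const_sub 1
    have d4 : fderiv ℝ (fun x => 1 - (1 - w n x) * (1 - u n x)) x =
        (1 - w n x) • fderiv ℝ (u n) x + (1 - u n x) • fderiv ℝ (w n) x := by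
      refine d3.fderiv.trans ?_
      simp only [smul_neg, neg_add_rev, neg_neg]
      abel
    rw [d4, add_comm ‖fderiv ℝ (w n) x‖ₑ]
    refine (enorm_add_le (E := Euc N →L[ℝ] ℝ) _ _).trans (add_le_add ?_ ?_)
    · rw [← ofReal_norm, ← ofReal_norm, norm_smul, Real.norm_eq_abs,
        abs_of_nonneg (by linarith [(w2 n x).2])]
      exact ENNReal.ofReal_le_ofReal
        (mul_le_of_le_one_left (norm_nonneg _) (by linarith [(w2 n x).1]))
    · rw [← ofReal_norm, ← ofReal_norm, norm_smul, Real.norm_eq_abs,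
        abs_of_nonneg (by linarith [(u2 n x).2])]
      exact ENNReal.ofReal_le_ofReal
        (mul_le_of_le_one_left (norm_nonneg _) (by linarith [(u2 n x).1]))

lemma relper_finset {ι : Type*} {Ω E : Set (Euc N)} {c : ℝ} (hΩ : IsOpen Ω) (hc : 0 ≤ c)
    (hE : RelPer Ω E c) (B : ι → Set (Euc N)) (d : ι → ℝ) (hd : ∀ i, 0 ≤ d i)
    (hB : ∀ i, RelPer Ω (B i) (d i)) (s : Finset ι) :
    RelPer Ω (E ∪ ⋃ i ∈ s, B i) (c + ∑ i ∈ s, d i) := by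
  classical
  induction s using Finset.induction_on with
  | empty => simpa using hE
  | insert a s ha ih =>
    rw [Finset.sum_insert ha, Finset.set_biUnion_insert, add_comm (d a), ← add_assoc,
      union_comm (B a), ← union_assoc]
    exact relper_union hΩ (add_nonneg hc (Finset.sum_nonneg fun i _ => hd i)) (hd a) ih (hB a)

lemma vol_ball (x : Euc N) {r : ℝ} (hr : 0 < r) :
    volume (ball x r) = ENNReal.ofReal (r ^ N) * volume (ball (0 : Euc N) 1) := by
  rw [Measure.addHaar_ball_of_pos _ _ hr]
  simp

/-- The volume of the unit ball. -/
def vb (N : ℕ) : ℝ := (volume (ball (0 : Euc N) 1)).toReal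

lemma vb_pos (N : ℕ) : 0 < vb N :=
  ENNReal.toReal_pos (measure_ball_pos _ _ one_pos).ne' measure_ball_lt_top.ne

lemma vol_ball' (x : Euc N) {r : ℝ} (hr : 0 < r) :
    volume (ball x r) = ENNReal.ofReal (r ^ N * vb N) := by
  rw [vol_ball x hr, ENNReal.ofReal_mul (by positivity), vb,
    ENNReal.ofReal_toReal measure_ball_lt_top.ne]

lemma relper_ball (Ω : Set (Euc N)) (x₀ : Euc N) {r : ℝ} (hr : 0 < r) :
    RelPer Ω (ball x₀ r) (2 * Lr * N * vb N * (r ^ N / r)) := by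
  have hp : ∀ x : Euc N, HasFDerivAt (fun x : Euc N => 1 - ‖x - x₀‖ ^ 2 / r ^ 2)
      (-((2 / r ^ 2) • innerSL ℝ (x - x₀))) x := by
    intro x
    have h1 : HasFDerivAt (fun x : Euc N => x - x₀) (ContinuousLinearMap.id ℝ (Euc N)) x :=
      (hasFDerivAt_id x).sub_const x₀
    have h2 := (h1.norm_sq.const_mul (1 / r ^ 2)).const_sub 1
    refine HasFDerivAt.congr_fderiv (h2.congr_of_eventuallyEq (Eventually.of_forall fun y => ?_)) ?_
    · simp only; ring
    · ext z
      simp only [neg_apply, smul_apply,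
        ContinuousLinearMap.comp_apply, ContinuousLinearMap.id_apply, smul_eq_mul]
      simp
      ring
  have hpc : ContDiff ℝ 1 (fun x : Euc N => 1 - ‖x - x₀‖ ^ 2 / r ^ 2) :=
    contDiff_const.sub (((contDiff_id.sub contDiff_const).norm_sq ℝ).div_const _)
  have hpos : ∀ x : Euc N, 0 < 1 - ‖x - x₀‖ ^ 2 / r ^ 2 ↔ x ∈ ball x₀ r := by
    intro x
    rw [sub_pos, div_lt_one (by positivity), mem_ball, dist_eq_norm,
      sq_lt_sq₀ (norm_nonneg _) hr.le]
  refine ⟨fun n x => rmp (n + 2 : ℝ) 0 (1 - ‖x - x₀‖ ^ 2 / r ^ 2), fun n => ?_, fun n x => ?_,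
    fun x _ => ?_, fun n => ?_⟩
  · exact ((rmp_contDiff _ _).comp hpc).contDiffOn
  · exact ⟨rmp_nonneg _ _ _, rmp_le_one _ _ _⟩
  · have := (rmp_tendsto 0 (1 - ‖x - x₀‖ ^ 2 / r ^ 2)).comp (tendsto_add_atTop_nat 2)
    have e : (ball x₀ r).indicator (1 : Euc N → ℝ) x =
        (Ioi (0:ℝ)).indicator 1 (1 - ‖x - x₀‖ ^ 2 / r ^ 2) := by
      by_cases h : x ∈ ball x₀ r
      · rw [indicator_of_mem h, indicator_of_mem (by exact (hpos x).2 h)]; rfl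
      · rw [indicator_of_notMem h, indicator_of_notMem (by exact fun hh => h ((hpos x).1 hh))]
    rw [e]
    refine this.congr fun n => ?_
    simp
  · set m : ℝ := n + 2 with hm
    have hm0 : 0 < m := by positivity
    have h1 : 1 / m < 1 := by rw [div_lt_one hm0, hm]; linarith [n.cast_nonneg (α := ℝ)]
    set S := ball x₀ r \ ball x₀ (r * (1 - 1 / m)) with hS
    have hSm : MeasurableSet S := measurableSet_ball.diff measurableSet_ball
    have hbd : ∀ x, ‖fderiv ℝ (fun x : Euc N => rmp m 0 (1 - ‖x - x₀‖ ^ 2 / r ^ 2)) x‖ₑ ≤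
        S.indicator (fun _ => ENNReal.ofReal (2 * m * Lr / r)) x := by
      intro x
      rw [fderiv_rmp (hp x).differentiableAt, (hp x).fderiv]
      by_cases hx : x ∈ S
      · rw [indicator_of_mem hx, ← ofReal_norm]
        refine ENNReal.ofReal_le_ofReal ?_
        rw [norm_smul, norm_neg, norm_smul, innerSL_apply_norm, Real.norm_eq_abs, Real.norm_eq_abs,
          abs_of_nonneg (rmpd_nonneg hm0 _ _), abs_of_nonneg (by positivity)]
        have h1 : ‖x - x₀‖ ≤ r := by
          have := hx.1
          rw [mem_ball, dist_eq_norm] at this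
          exact this.le
        calc _ ≤ (m * Lr) * (2 / r ^ 2 * r) := by
              gcongr
              · exact mul_nonneg hm0.le Lr_pos.le
              · exact rmpd_le hm0 _ _
          _ = _ := by field_simp
      · have : rmpd m 0 (1 - ‖x - x₀‖ ^ 2 / r ^ 2) = 0 := by
          by_cases h1 : x ∈ ball x₀ r
          · have h2 : x ∈ ball x₀ (r * (1 - 1 / m)) := by
              by_contra h2
              exact hx ⟨h1, h2⟩
            rw [mem_ball, dist_eq_norm] at h2
            refine rmpd_one hm0 ?_
            have h3 : ‖x - x₀‖ / r ≤ 1 - 1 / m := by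
              rw [div_le_iff₀ hr]; linarith
            have h4 : 0 ≤ ‖x - x₀‖ / r := by positivity
            have h5 : 0 < 1 / m := by positivity
            rw [← div_pow]
            nlinarith
          · exact rmpd_zero hm0 (not_lt.1 fun hh => h1 ((hpos x).1 hh))
        rw [this, zero_smul, ← ofReal_norm, norm_zero, ENNReal.ofReal_zero]
        exact zero_le
    calc _ ≤ ∫⁻ x, S.indicator (fun _ => ENNReal.ofReal (2 * m * Lr / r)) x :=
          (setLIntegral_le_lintegral _ _).trans (lintegral_mono hbd)
      _ = ENNReal.ofReal (2 * m * Lr / r) * volume S := lintegral_indicator_const hSm _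
      _ ≤ ENNReal.ofReal (2 * m * Lr / r) * ENNReal.ofReal (r ^ N * vb N * (N / m)) := by
          gcongr
          have hr' : 0 < r * (1 - 1 / m) := mul_pos hr (by linarith)
          rw [hS, measure_sdiff (ball_subset_ball (by nlinarith [show 0 < 1 / m by positivity]))
            measurableSet_ball.nullMeasurableSet measure_ball_lt_top.ne, vol_ball' x₀ hr,
            vol_ball' x₀ hr', ← ENNReal.ofReal_sub _ (by have := vb_pos N; positivity)]
          refine ENNReal.ofReal_le_ofReal ?_
          have hB := one_add_mul_le_pow (a := -(1 / m)) (by linarith) N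
          rw [mul_pow]
          have : 0 ≤ r ^ N * vb N := by have := vb_pos N; positivity
          have e : N / m = N * (1 / m) := by ring
          rw [e]
          have e2 : 1 - 1 / m = 1 + -(1 / m) := by ring
          rw [e2]
          nlinarith
      _ = _ := by
          rw [← ENNReal.ofReal_mul (by have := Lr_pos; positivity)]
          congr 1
          field_simp

lemma lin_div {Ω : Set (Euc N)} (hΩ : IsOpen Ω) {φ : Euc N → Euc N} (hs : tsupport φ ⊆ Ω)
    {D : ℝ} (hD0 : 0 ≤ D) (hD : ∀ x, |diverg φ x| ≤ D) {k : Euc N → ℝ} {κ : ℝ} (hκ : 0 ≤ κ)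
    (hk : ∫⁻ x in Ω, ENNReal.ofReal |k x| ≤ ENNReal.ofReal κ) :
    ∫ x, k x * diverg φ x ≤ D * κ := by
  refine int_le_of_lint (by positivity) ?_
  rw [ENNReal.ofReal_mul hD0]
  refine le_trans ?_ (mul_le_mul_right hk _)
  rw [← lintegral_const_mul' _ _ ENNReal.ofReal_ne_top, ← lintegral_indicator hΩ.measurableSet]
  refine lintegral_mono fun x => ?_
  by_cases hx : x ∈ tsupport φ
  · rw [indicator_of_mem (hs hx), ← ENNReal.ofReal_mul hD0]
    refine ENNReal.ofReal_le_ofReal ((le_abs_self _).trans ?_)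
    rw [abs_mul, mul_comm]
    exact mul_le_mul_of_nonneg_right (hD x) (abs_nonneg _)
  · simp [diverg_eq_zero hx]

lemma lint_four {Ω A : Set (Euc N)} {v : Euc N → ℝ} {κ : ℝ}
    (hL1 : ∫⁻ x in Ω, ENNReal.ofReal |v x - A.indicator 1 x| ≤ ENNReal.ofReal κ)
    (hΩ : MeasurableSet Ω) {f : Euc N → ℝ} (hf : ∀ x ∈ Ω, f x ≤ 4 * |v x - A.indicator 1 x|) :
    ∫⁻ x in Ω, ENNReal.ofReal (f x) ≤ ENNReal.ofReal (4 * κ) := by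
  rw [ENNReal.ofReal_mul (by norm_num)]
  refine le_trans ?_ (mul_le_mul_right hL1 _)
  rw [← lintegral_const_mul' _ _ ENNReal.ofReal_ne_top]
  refine setLIntegral_mono' hΩ fun x hx => ?_
  rw [← ENNReal.ofReal_mul (by norm_num)]
  exact ENNReal.ofReal_le_ofReal (hf x hx)

lemma lint_four_vol {Ω A S : Set (Euc N)} {v : Euc N → ℝ} {κ : ℝ}
    (hL1 : ∫⁻ x in Ω, ENNReal.ofReal |v x - A.indicator 1 x| ≤ ENNReal.ofReal κ)
    (hΩ : MeasurableSet Ω) (hS : MeasurableSet S) (hSΩ : S ⊆ Ω)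
    (hf : ∀ x ∈ S, 1 ≤ 4 * |v x - A.indicator 1 x|) :
    volume S ≤ ENNReal.ofReal (4 * κ) := by
  have := lint_four hL1 hΩ (f := S.indicator 1) (fun x hx => by
    by_cases h : x ∈ S
    · rw [indicator_of_mem h]; exact hf x h
    · rw [indicator_of_notMem h]; positivity)
  refine le_trans ?_ this
  rw [← setLIntegral_one]
  refine le_trans (setLIntegral_mono' hS fun x hx => ?_) (lintegral_mono_set hSΩ)
  simp [hx]

lemma U0_relper {Ω A : Set (Euc N)} (hΩ : IsOpen Ω) (hA : MeasurableSet A)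
    (hper : perimeter A Ω < ⊤) {φ : Euc N → Euc N} (hφ : φ ∈ TestVF Ω)
    {D : ℝ} (hD0 : 0 ≤ D) (hD : ∀ x, |diverg φ x| ≤ D)
    {v : Euc N → ℝ} (hv : ContDiffOn ℝ 1 v Ω) (hvint : IntegrableOn (fderiv ℝ v) Ω)
    {M K κ : ℝ} (hκ : 0 ≤ κ) (hM0 : 0 ≤ M)
    (hM : ∫ x in Ω, (‖fderiv ℝ v x‖ + fderiv ℝ v x (φ x)) ≤ M) (hK : M < K * (1 / 4))
    (hL1 : ∫⁻ x in Ω, ENNReal.ofReal |v x - A.indicator 1 x| ≤ ENNReal.ofReal κ) :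
    ∃ t ∈ Ico (1/4 : ℝ) (1/2), RelPer Ω {x | x ∈ Ω ∧ t < v x}
      (Lr * K + (perimeter A Ω).toReal + D * (4 * κ)) := by
  have hφ' := hφ
  obtain ⟨φ1, φ2, φ3, φ4⟩ := hφ
  have hK0 : 0 < K := by linarith
  have hnn : ∀ x, 0 ≤ ‖fderiv ℝ v x‖ + fderiv ℝ v x (φ x) := by
    intro x
    have : |fderiv ℝ v x (φ x)| ≤ ‖fderiv ℝ v x‖ :=
      ((fderiv ℝ v x).le_opNorm _).trans (mul_le_of_le_one_right (norm_nonneg _) (φ4 x))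
    linarith [neg_abs_le (fderiv ℝ v x (φ x))]
  have hexc : IntegrableOn (fun x => ‖fderiv ℝ v x‖ + fderiv ℝ v x (φ x)) Ω :=
    hvint.norm.add (ibp hΩ hv φ1 φ2 φ3).2.1.integrableOn
  have hvm : AEMeasurable v (volume.restrict Ω) := hv.continuousOn.aemeasurable hΩ.measurableSet
  obtain ⟨t, ht, hr⟩ := level_ramp (μ := volume.restrict Ω)
    (F := fun x => ENNReal.ofReal (‖fderiv ℝ v x‖ + fderiv ℝ v x (φ x))) hvm
    (a := 1/4) (b := 1/2) (K := K) (by norm_num) (by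
      rw [← ofReal_integral_eq_lintegral_ofReal hexc (Eventually.of_forall hnn)]
      rw [ENNReal.ofReal_lt_ofReal_iff (by linarith)]
      linarith)
  refine ⟨t, ht, ?_⟩
  obtain ⟨n0, hn0⟩ := exists_nat_gt (1 / (1/2 - t))
  have hbd : ∀ m : ℝ, 0 < m → t + 1 / m ≤ 1 / 2 →
      ∫⁻ x in Ω, ‖fderiv ℝ (fun y => rmp m t (v y)) x‖ₑ ≤
        ENNReal.ofReal (Lr * K + (perimeter A Ω).toReal + D * (4 * κ)) := by
    intro m hm hmt
    have hw : ContDiffOn ℝ 1 (fun y => rmp m t (v y)) Ω := (rmp_contDiff m t).comp_contDiffOn hv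
    have hfd : ∀ x ∈ Ω, fderiv ℝ (fun y => rmp m t (v y)) x = rmpd m t (v x) • fderiv ℝ v x :=
      fun x hx => fderiv_rmp ((hv.contDiffAt (hΩ.mem_nhds hx)).differentiableAt one_ne_zero) m t
    obtain ⟨i1, i2, i3⟩ := ibp hΩ hw φ1 φ2 φ3
    have hrm : AEStronglyMeasurable (fun x => rmpd m t (v x)) (volume.restrict Ω) :=
      ((rmpd_continuous m t).measurable.comp_aemeasurable hvm).aestronglyMeasurable
    have hrb : ∀ᵐ x ∂(volume.restrict Ω), ‖rmpd m t (v x)‖ ≤ m * Lr :=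
      Eventually.of_forall fun x => by
        rw [Real.norm_eq_abs, abs_of_nonneg (rmpd_nonneg hm _ _)]
        exact rmpd_le hm _ _
    have iq : IntegrableOn (fun x => rmpd m t (v x) * ‖fderiv ℝ v x‖) Ω :=
      hvint.norm.bdd_mul hrm hrb
    have ie : IntegrableOn
        (fun x => rmpd m t (v x) * (‖fderiv ℝ v x‖ + fderiv ℝ v x (φ x))) Ω :=
      hexc.bdd_mul hrm hrb
    have e1 : ∫⁻ x in Ω, ‖fderiv ℝ (fun y => rmp m t (v y)) x‖ₑ =
        ENNReal.ofReal (∫ x in Ω, rmpd m t (v x) * ‖fderiv ℝ v x‖) := by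
      rw [ofReal_integral_eq_lintegral_ofReal iq
        (Eventually.of_forall fun x => mul_nonneg (rmpd_nonneg hm _ _) (norm_nonneg _))]
      refine setLIntegral_congr_fun hΩ.measurableSet fun x hx => ?_
      rw [hfd x hx, ← ofReal_norm, norm_smul, Real.norm_eq_abs,
        abs_of_nonneg (rmpd_nonneg hm _ _)]
    rw [e1]
    refine ENNReal.ofReal_le_ofReal ?_
    have e2 : ∫ x in Ω, rmpd m t (v x) * ‖fderiv ℝ v x‖ =
        (∫ x in Ω, rmpd m t (v x) * (‖fderiv ℝ v x‖ + fderiv ℝ v x (φ x))) -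
          ∫ x in Ω, fderiv ℝ (fun y => rmp m t (v y)) x (φ x) := by
      rw [← integral_sub ie i2.integrableOn]
      refine setIntegral_congr_fun hΩ.measurableSet fun x hx => ?_
      rw [hfd x hx]
      simp only [smul_apply, smul_eq_mul]
      ring
    have e3 : ∫ x in Ω, fderiv ℝ (fun y => rmp m t (v y)) x (φ x) =
        ∫ x, fderiv ℝ (fun y => rmp m t (v y)) x (φ x) :=
      setIntegral_eq_integral_of_forall_compl_eq_zero fun x hx => by
        rw [image_eq_zero_of_notMem_tsupport (fun hc => hx (φ3 hc)), map_zero]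
    have e4 : ∫ x in Ω, rmpd m t (v x) * (‖fderiv ℝ v x‖ + fderiv ℝ v x (φ x)) ≤ Lr * K := by
      refine int_le_of_lint (mul_nonneg Lr_pos.le hK0.le) (le_trans (le_of_eq ?_) (hr m hm hmt))
      refine lintegral_congr fun x => ?_
      rw [ENNReal.ofReal_mul (rmpd_nonneg hm _ _)]
    have e5 : (∫ x, rmp m t (v x) * diverg φ x) - ∫ x in A, diverg φ x ≤ D * (4 * κ) := by
      rw [← integral_indicator hA, ← integral_sub i1 ((diverg_integrable φ1 φ2).indicator hA)]
      have e6 := lin_div hΩ φ3 hD0 hD (k := fun x => rmp m t (v x) - A.indicator 1 x)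
        (κ := 4 * κ) (by positivity) (lint_four hL1 hΩ.measurableSet fun x hx => by
          have r0 := rmp_nonneg m t (v x)
          have r1 := rmp_le_one m t (v x)
          by_cases hxA : x ∈ A
          · simp only [hxA, indicator_of_mem, Pi.one_apply]
            rcases le_or_gt (1/2) (v x) with h | h
            · rw [rmp_one hm (by linarith)]; simp
            · rw [abs_of_nonpos (by linarith), abs_of_nonpos (by linarith)]; linarith
          · simp only [hxA, not_false_eq_true, indicator_of_notMem, sub_zero]
            rcases le_or_gt (v x) t with h | h
            · rw [rmp_zero hm h]; simp
            · rw [abs_of_nonneg r0, abs_of_pos (by linarith [ht.1])]; linarith [ht.1])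
      refine le_trans (le_of_eq ?_) e6
      refine integral_congr_ae (Eventually.of_forall fun x => ?_)
      by_cases hxA : x ∈ A <;> simp [hxA]
      ring
    have e7 := testVF_integral_le hper hφ'
    rw [e2, e3]
    linarith
  have hn0' : 0 < 1 / (1/2 - t) := by
    have := ht.2
    exact one_div_pos.2 (by linarith)
  refine ⟨fun n x => rmp ((n + n0 : ℕ) : ℝ) t (v x), fun n => ?_, fun n x => ?_, fun x hx => ?_,
    fun n => ?_⟩
  · exact (rmp_contDiff _ t).comp_contDiffOn hv
  · exact ⟨rmp_nonneg _ _ _, rmp_le_one _ _ _⟩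
  · have := (rmp_tendsto t (v x)).comp (tendsto_add_atTop_nat n0)
    have e : ({x | x ∈ Ω ∧ t < v x} : Set (Euc N)).indicator (1 : Euc N → ℝ) x =
        (Ioi t).indicator 1 (v x) := by
      by_cases h : t < v x <;> simp [h, hx]
    rw [e]
    exact this
  · have h1 : 1 / (1/2 - t) < ((n + n0 : ℕ) : ℝ) :=
      hn0.trans_le (by push_cast; linarith [n.cast_nonneg (α := ℝ)])
    refine hbd _ (hn0'.trans h1) ?_
    have h2 : 1 / ((n + n0 : ℕ) : ℝ) < 1/2 - t := by
      rw [one_div_lt (hn0'.trans h1) (by linarith [ht.2])]; exact h1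
    linarith

lemma E_level {Ω A : Set (Euc N)} (hΩ : IsOpen Ω) (hA : MeasurableSet A) (hAΩ : A ⊆ Ω)
    {v : Euc N → ℝ} (hv : ContDiffOn ℝ 1 v Ω) {κ c : ℝ} (hc : c ∈ Ico (1/2 : ℝ) (3/4))
    (hL1 : ∫⁻ x in Ω, ENNReal.ofReal |v x - A.indicator 1 x| ≤ ENNReal.ofReal κ)
    {η : ℝ} (hη : 0 < η) :
    ∃ n : ℝ, 0 < n ∧ c + 1 / n ≤ 3/4 ∧
      ∫⁻ x in A, ENNReal.ofReal |rmp n c (v x) - (Ioi c).indicator 1 (v x)| ≤ ENNReal.ofReal η := by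
  have hvm : AEMeasurable v (volume.restrict A) :=
    (hv.continuousOn.mono hAΩ).aemeasurable hA
  have hev : ∀ᶠ n : ℕ in atTop, (0 : ℝ) < n ∧ c + 1 / n ≤ 3/4 := by
    filter_upwards [eventually_gt_atTop 0, tendsto_one_div_atTop_nhds_zero_nat.eventually
      (gt_mem_nhds (show 0 < 3/4 - c by linarith [hc.2]))] with n h1 h2
    exact ⟨by exact_mod_cast h1, by linarith⟩
  obtain ⟨n0, hn0⟩ := eventually_atTop.1 hev
  have hlim : Tendsto (fun n : ℕ => ∫⁻ x in A, ENNReal.ofReal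
      |rmp ((n + n0 : ℕ) : ℝ) c (v x) - (Ioi c).indicator 1 (v x)|) atTop (𝓝 (∫⁻ x in A, 0)) := by
    refine tendsto_lintegral_of_dominated_convergence'
      (fun x => ENNReal.ofReal 4 * ENNReal.ofReal |v x - A.indicator 1 x|) ?_ ?_ ?_ ?_
    · intro n
      have h1 : AEMeasurable (fun x => rmp ((n + n0 : ℕ) : ℝ) c (v x)) (volume.restrict A) :=
        (rmp_contDiff _ c).continuous.measurable.comp_aemeasurable hvm
      have h2 : AEMeasurable (fun x => (Ioi c).indicator (1 : ℝ → ℝ) (v x)) (volume.restrict A) :=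
        (measurable_one.indicator measurableSet_Ioi).comp_aemeasurable hvm
      exact (h1.sub h2).abs.ennreal_ofReal
    · intro n
      have hn := hn0 (n + n0) (Nat.le_add_left _ _)
      refine (ae_restrict_iff' hA).2 (Eventually.of_forall fun x hx => ?_)
      show ENNReal.ofReal _ ≤ ENNReal.ofReal 4 * ENNReal.ofReal _
      rw [← ENNReal.ofReal_mul (by norm_num)]
      refine ENNReal.ofReal_le_ofReal ?_
      rw [indicator_of_mem hx]
      simp only [Pi.one_apply]
      have r0 := rmp_nonneg ((n + n0 : ℕ) : ℝ) c (v x)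
      have r1 := rmp_le_one ((n + n0 : ℕ) : ℝ) c (v x)
      rcases le_or_gt (v x) c with h | h
      · rw [rmp_zero hn.1 h, indicator_of_notMem (by simpa using h)]; simp
      · rw [indicator_of_mem (by exact h)]
        simp only [Pi.one_apply]
        rcases le_or_gt (3/4) (v x) with h1 | h1
        · rw [rmp_one hn.1 (by linarith)]; simp
        · rw [abs_of_nonpos (by linarith), abs_of_nonpos (by linarith)]; linarith
    · rw [lintegral_const_mul' _ _ ENNReal.ofReal_ne_top]
      exact ENNReal.mul_ne_top ENNReal.ofReal_ne_top
        (((lintegral_mono_set hAΩ).trans hL1).trans_lt ENNReal.ofReal_lt_top).ne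
    · refine Eventually.of_forall fun x => ?_
      have := (((rmp_tendsto c (v x)).comp (tendsto_add_atTop_nat n0)).sub_const ((Ioi c).indicator 1 (v x))).abs
      rw [sub_self, abs_zero] at this
      simpa [Function.comp_def] using ENNReal.tendsto_ofReal this
  rw [lintegral_zero] at hlim
  have h2 := hlim.eventually (gt_mem_nhds (ENNReal.ofReal_pos.2 hη))
  obtain ⟨n, hn2⟩ := h2.exists
  have hn := hn0 (n + n0) (Nat.le_add_left _ _)
  exact ⟨((n + n0 : ℕ) : ℝ), hn.1, hn.2, hn2.le⟩

lemma E_approx {Ω A : Set (Euc N)} (hΩ : IsOpen Ω) (hA : MeasurableSet A) (hAΩ : A ⊆ Ω)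
    (hper : perimeter A Ω < ⊤) {φ : Euc N → Euc N} (hφ : φ ∈ TestVF Ω) {δ : ℝ}
    (hφδ : (perimeter A Ω).toReal - δ < ∫ x in A, diverg φ x)
    {D : ℝ} (hD0 : 0 ≤ D) (hD : ∀ x, |diverg φ x| ≤ D)
    {v : Euc N → ℝ} (hv : ContDiffOn ℝ 1 v Ω) (hvint : IntegrableOn (fderiv ℝ v) Ω)
    {M K κ : ℝ} (hκ : 0 ≤ κ) (hM0 : 0 ≤ M)
    (hM : ∫ x in A, ‖fderiv ℝ v x‖ ≤ M) (hK : M < K * (1 / 4))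
    (hL1 : ∫⁻ x in Ω, ENNReal.ofReal |v x - A.indicator 1 x| ≤ ENNReal.ofReal κ) :
    ∃ c ∈ Ico (1/2 : ℝ) (3/4), ∀ η : ℝ, 0 < η → ∃ e : Euc N → ℝ, ContDiffOn ℝ 1 e Ω ∧
      ∫⁻ x in Ω, ‖fderiv ℝ e x‖ₑ ≤ ENNReal.ofReal (δ + 2 * (Lr * K) + D * (4 * κ) + η) ∧
      ∫⁻ x in Ω, ENNReal.ofReal |e x - (A ∩ {x | v x ≤ c}).indicator 1 x| ≤ ENNReal.ofReal η := by
  obtain ⟨φ1, φ2, φ3, φ4⟩ := hφ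
  have hK0 : 0 < K := by linarith
  have hLK : 0 ≤ Lr * K := mul_nonneg Lr_pos.le hK0.le
  have hvm : AEMeasurable v (volume.restrict A) := (hv.continuousOn.mono hAΩ).aemeasurable hA
  have hvmΩ : AEMeasurable v (volume.restrict Ω) :=
    hv.continuousOn.aemeasurable hΩ.measurableSet
  obtain ⟨c, hc, hr⟩ := level_ramp (μ := volume.restrict A)
    (F := fun x => ENNReal.ofReal ‖fderiv ℝ v x‖) hvm
    (a := 1/2) (b := 3/4) (K := K) (by norm_num) (by
      rw [← ofReal_integral_eq_lintegral_ofReal (hvint.mono_set hAΩ).norm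
        (Eventually.of_forall fun x => norm_nonneg _)]
      rw [ENNReal.ofReal_lt_ofReal_iff (by linarith)]
      linarith)
  refine ⟨c, hc, fun η hη => ?_⟩
  obtain ⟨n, hn, hnc, hnη⟩ := E_level hΩ hA hAΩ hv hc hL1 (show 0 < η / 4 by positivity)
  have hrA := hr n hn hnc
  set g : Euc N → ℝ := fun y => rmp n c (v y) with hg
  have g0 : ∀ x, 0 ≤ g x := fun x => rmp_nonneg _ _ _
  have g1 : ∀ x, g x ≤ 1 := fun x => rmp_le_one _ _ _
  have hgC : ContDiffOn ℝ 1 g Ω := (rmp_contDiff n c).comp_contDiffOn hv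
  have hfd : ∀ x ∈ Ω, fderiv ℝ g x = rmpd n c (v x) • fderiv ℝ v x :=
    fun x hx => fderiv_rmp ((hv.contDiffAt (hΩ.mem_nhds hx)).differentiableAt one_ne_zero) n c
  have hfdn : ∀ x ∈ Ω, ‖fderiv ℝ g x‖ = rmpd n c (v x) * ‖fderiv ℝ v x‖ := fun x hx => by
    rw [hfd x hx, norm_smul, Real.norm_eq_abs, abs_of_nonneg (rmpd_nonneg hn _ _)]
  have hgA : ∫⁻ x in A, ENNReal.ofReal ‖fderiv ℝ g x‖ ≤ ENNReal.ofReal (Lr * K) := by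
    refine le_trans (le_of_eq ?_) hrA
    refine setLIntegral_congr_fun hA fun x hx => ?_
    rw [hfdn x (hAΩ hx), ENNReal.ofReal_mul (rmpd_nonneg hn _ _)]
  set Φ : Euc N → Euc N := fun x => g x • φ x with hΦ
  have Φ1 : ContDiff ℝ 1 Φ := contDiff_smul_of_tsupport hΩ hgC φ1 φ3
  have Φ2 : HasCompactSupport Φ := hcs_smul g φ2
  have Φ3 : tsupport Φ ⊆ Ω := (tsupport_smul_sub g φ).trans φ3
  have hω : ContinuousOn (fun x => 1 + |diverg Φ x| + ‖fderiv ℝ g x‖) Ω :=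
    (continuousOn_const.add (diverg_continuous Φ1).continuousOn.abs).add
      (hgC.continuousOn_fderiv_of_isOpen hΩ le_rfl).norm
  obtain ⟨h, hh, hh1, hh2⟩ := AG hΩ hA hper hω (show 0 < η / 4 by positivity)
  have hhC : ContDiffOn ℝ 1 h Ω := hh.of_le (by norm_num)
  set P := (perimeter A Ω).toReal with hP
  have hP0 : 0 ≤ P := ENNReal.toReal_nonneg
  set b : Euc N → ℝ := fun x => |h x - A.indicator 1 x| with hb
  have b0 : ∀ x, 0 ≤ b x := fun x => abs_nonneg _
  have hsub : ∀ f : Euc N → ℝ, (∀ x ∈ Ω, f x ≤ (1 + |diverg Φ x| + ‖fderiv ℝ g x‖) * b x) →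
      ∫⁻ x in Ω, ENNReal.ofReal (f x) ≤ ENNReal.ofReal (η / 4) := fun f hf =>
    le_trans (setLIntegral_mono' hΩ.measurableSet fun x hx =>
      ENNReal.ofReal_le_ofReal (hf x hx)) hh1
  -- gradient integrability of `h`
  have hderivIntg : IntegrableOn (fderiv ℝ h) Ω :=
    ⟨(measurable_fderiv ℝ h).aestronglyMeasurable, hh2.trans_lt ENNReal.ofReal_lt_top⟩
  have hhn : ∫ x in Ω, ‖fderiv ℝ h x‖ ≤ P + η / 4 :=
    int_le_of_lint (by positivity) (by simpa only [ofReal_norm] using hh2)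
  have hgm : AEStronglyMeasurable g (volume.restrict Ω) :=
    hgC.continuousOn.aestronglyMeasurable hΩ.measurableSet
  have igh : IntegrableOn (fun x => g x * ‖fderiv ℝ h x‖) Ω :=
    hderivIntg.norm.bdd_mul (c := 1) hgm (Eventually.of_forall fun x => by
      rw [Real.norm_eq_abs, abs_of_nonneg (g0 x)]; exact g1 x)
  obtain ⟨i1, i2, i3⟩ := ibp hΩ hhC Φ1 Φ2 Φ3
  have p1 : -∫ x in Ω, g x * ‖fderiv ℝ h x‖ ≤ ∫ x, fderiv ℝ h x (Φ x) := by
    have e3 : ∫ x in Ω, fderiv ℝ h x (Φ x) = ∫ x, fderiv ℝ h x (Φ x) :=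
      setIntegral_eq_integral_of_forall_compl_eq_zero fun x hx => by
        rw [image_eq_zero_of_notMem_tsupport (fun hc => hx (Φ3 hc)), map_zero]
    rw [← e3, ← integral_neg]
    refine integral_mono igh.neg i2.integrableOn fun x => ?_
    simp only [hΦ, map_smul, smul_eq_mul]
    have : |fderiv ℝ h x (φ x)| ≤ ‖fderiv ℝ h x‖ :=
      ((fderiv ℝ h x).le_opNorm _).trans (mul_le_of_le_one_right (norm_nonneg _) (φ4 x))
    have h2 := neg_abs_le (fderiv ℝ h x (φ x))
    show -(g x * ‖fderiv ℝ h x‖) ≤ g x * fderiv ℝ h x (φ x)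
    nlinarith [g0 x]
  have p2 : (∫ x in A, diverg Φ x) - ∫ x, h x * diverg Φ x ≤ η / 4 := by
    rw [← integral_indicator hA, ← integral_sub ((diverg_integrable Φ1 Φ2).indicator hA) i1]
    refine int_le_of_lint (by positivity) (le_trans ?_ (hsub (fun x => |diverg Φ x| * b x) ?_))
    · rw [← lintegral_indicator hΩ.measurableSet]
      refine lintegral_mono fun x => ?_
      by_cases hx : x ∈ tsupport Φ
      · rw [indicator_of_mem (Φ3 hx)]
        refine ENNReal.ofReal_le_ofReal ((le_abs_self _).trans (le_of_eq ?_))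
        rw [hb, ← abs_mul, ← abs_neg]
        congr 1
        by_cases hxA : x ∈ A <;> simp [hxA] <;> ring
      · have hd0 := diverg_eq_zero hx
        by_cases hxA : x ∈ A <;> simp [hxA, hd0]
    · intro x _
      nlinarith [b0 x, norm_nonneg (fderiv ℝ g x), mul_nonneg (norm_nonneg (fderiv ℝ g x)) (b0 x)]
  have hdA : IntegrableOn (diverg φ) A := (diverg_integrable φ1 φ2).integrableOn
  obtain ⟨k1, k2, -⟩ := ibp hΩ hgC φ1 φ2 φ3
  have p3 : ∫ x in A, diverg Φ x = (∫ x in A, g x * diverg φ x) + ∫ x in A, fderiv ℝ g x (φ x) := by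
    rw [← integral_add k1.integrableOn k2.integrableOn]
    refine setIntegral_congr_fun hA fun x hx => ?_
    exact diverg_smul ((hgC.contDiffAt (hΩ.mem_nhds (hAΩ hx))).differentiableAt one_ne_zero)
      (φ1.differentiable one_ne_zero x)
  have p4 : (∫ x in A, diverg φ x) - ∫ x in A, g x * diverg φ x ≤ D * (4 * κ) := by
    rw [← integral_sub hdA k1.integrableOn, ← integral_indicator hA]
    have e6 := lin_div hΩ φ3 hD0 hD (k := fun x => A.indicator (fun x => 1 - g x) x)
      (κ := 4 * κ) (by positivity) (lint_four hL1 hΩ.measurableSet fun x hx => by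
        by_cases hxA : x ∈ A
        · simp only [hxA, indicator_of_mem, Pi.one_apply]
          rcases le_or_gt (3/4) (v x) with h | h
          · have : g x = 1 := rmp_one hn (by linarith)
            rw [this]; simp
          · rw [abs_of_nonneg (by linarith [g1 x]), abs_of_nonpos (by linarith)]
            linarith [g0 x]
        · simp only [hxA, not_false_eq_true, indicator_of_notMem, abs_zero]
          positivity)
    refine le_trans (le_of_eq ?_) e6
    refine integral_congr_ae (Eventually.of_forall fun x => ?_)
    by_cases hxA : x ∈ A <;> simp [hxA]
    ring
  have p5 : -∫ x in A, fderiv ℝ g x (φ x) ≤ Lr * K := by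
    rw [← integral_neg]
    refine int_le_of_lint hLK (le_trans (lintegral_mono fun x => ENNReal.ofReal_le_ofReal ?_) hgA)
    exact (neg_le_abs _).trans
      (((fderiv ℝ g x).le_opNorm _).trans (mul_le_of_le_one_right (norm_nonneg _) (φ4 x)))
  have p6 : ∫ x in Ω, (1 - g x) * ‖fderiv ℝ h x‖ ≤ δ + Lr * K + D * (4 * κ) + η / 2 := by
    have : ∫ x in Ω, (1 - g x) * ‖fderiv ℝ h x‖ =
        (∫ x in Ω, ‖fderiv ℝ h x‖) - ∫ x in Ω, g x * ‖fderiv ℝ h x‖ := by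
      rw [← integral_sub hderivIntg.norm igh]
      refine integral_congr_ae (Eventually.of_forall fun x => ?_)
      simp only
      ring
    rw [this]
    linarith
  have p6' : ∫⁻ x in Ω, ENNReal.ofReal ((1 - g x) * ‖fderiv ℝ h x‖) ≤
      ENNReal.ofReal (δ + Lr * K + D * (4 * κ) + η / 2) := by
    have ii : IntegrableOn (fun x => (1 - g x) * ‖fderiv ℝ h x‖) Ω := by
      refine (hderivIntg.norm.sub igh).congr (Eventually.of_forall fun x => ?_)
      simp only [Pi.sub_apply]
      ring
    rw [← ofReal_integral_eq_lintegral_ofReal ii (Eventually.of_forall fun x =>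
      mul_nonneg (by linarith [g1 x]) (norm_nonneg _))]
    exact ENNReal.ofReal_le_ofReal p6
  have p7 : ∫⁻ x in Ω, ENNReal.ofReal (A.indicator (fun x => ‖fderiv ℝ g x‖) x) ≤
      ENNReal.ofReal (Lr * K) := by
    refine le_trans (le_of_eq ?_) hgA
    rw [← inter_eq_self_of_subset_left hAΩ, ← setLIntegral_indicator hA,
      inter_eq_self_of_subset_left hAΩ]
    refine lintegral_congr fun x => ?_
    by_cases hxA : x ∈ A <;> simp [hxA]
  have p8 := hsub (fun x => b x * ‖fderiv ℝ g x‖) (fun x _ => by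
    nlinarith [b0 x, abs_nonneg (diverg Φ x), mul_nonneg (abs_nonneg (diverg Φ x)) (b0 x)])
  have p9 := hsub b (fun x _ => by
    nlinarith [b0 x, mul_nonneg (abs_nonneg (diverg Φ x)) (b0 x),
      mul_nonneg (norm_nonneg (fderiv ℝ g x)) (b0 x)])
  have hδ0 : 0 ≤ δ + Lr * K + D * (4 * κ) + η / 2 := le_trans (integral_nonneg fun x =>
      mul_nonneg (by linarith [g1 x]) (norm_nonneg _)) p6
  refine ⟨fun x => h x * (1 - g x), hhC.mul (contDiffOn_const.sub hgC), ?_, ?_⟩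
  · have key : ∀ x ∈ Ω, ‖fderiv ℝ (fun x => h x * (1 - g x)) x‖ₑ ≤
        ENNReal.ofReal ((1 - g x) * ‖fderiv ℝ h x‖) +
          (ENNReal.ofReal (A.indicator (fun x => ‖fderiv ℝ g x‖) x) +
            ENNReal.ofReal (b x * ‖fderiv ℝ g x‖)) := by
      intro x hx
      have d1 : HasFDerivAt h (fderiv ℝ h x) x :=
        ((hhC.contDiffAt (hΩ.mem_nhds hx)).differentiableAt one_ne_zero).hasFDerivAt
      have d2 : HasFDerivAt g (fderiv ℝ g x) x :=
        ((hgC.contDiffAt (hΩ.mem_nhds hx)).differentiableAt one_ne_zero).hasFDerivAt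
      have d3 : fderiv ℝ (fun x => h x * (1 - g x)) x =
          h x • -fderiv ℝ g x + (1 - g x) • fderiv ℝ h x := (d1.mul (d2.const_sub 1)).fderiv
      rw [d3]
      have n0 : 0 ≤ A.indicator (fun x => ‖fderiv ℝ g x‖) x :=
        indicator_nonneg (fun _ _ => norm_nonneg _) x
      rw [← ENNReal.ofReal_add n0 (mul_nonneg (b0 x) (norm_nonneg _)),
        ← ENNReal.ofReal_add (mul_nonneg (by linarith [g1 x]) (norm_nonneg _))
          (add_nonneg n0 (mul_nonneg (b0 x) (norm_nonneg _))), ← ofReal_norm]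
      refine ENNReal.ofReal_le_ofReal ((norm_add_le _ _).trans ?_)
      rw [norm_smul, norm_smul, norm_neg, Real.norm_eq_abs, Real.norm_eq_abs,
        abs_of_nonneg (show 0 ≤ 1 - g x by linarith [g1 x])]
      have h3 : |h x| * ‖fderiv ℝ g x‖ ≤
          A.indicator (fun x => ‖fderiv ℝ g x‖) x + b x * ‖fderiv ℝ g x‖ := by
        by_cases hxA : x ∈ A
        · simp only [hb, hxA, indicator_of_mem, Pi.one_apply]
          have : |h x| ≤ 1 + |h x - 1| := by
            have := abs_add_le (1:ℝ) (h x - 1)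
            simpa using this
          nlinarith [norm_nonneg (fderiv ℝ g x)]
        · simp [hb, hxA]
      linarith
    refine (setLIntegral_mono' hΩ.measurableSet key).trans ?_
    have m1 : AEMeasurable (fun x => ENNReal.ofReal ((1 - g x) * ‖fderiv ℝ h x‖))
        (volume.restrict Ω) :=
      ((hgm.aemeasurable.const_sub 1).mul
        (measurable_fderiv ℝ h).norm.aemeasurable).ennreal_ofReal
    have m2 : Measurable (fun x => ENNReal.ofReal (A.indicator (fun x => ‖fderiv ℝ g x‖) x)) :=
      ((measurable_fderiv ℝ g).norm.indicator hA).ennreal_ofReal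
    rw [lintegral_add_left' m1, lintegral_add_left m2]
    refine (add_le_add p6' (add_le_add p7 p8)).trans ?_
    rw [← ENNReal.ofReal_add hLK (by positivity), ← ENNReal.ofReal_add hδ0 (by positivity)]
    exact ENNReal.ofReal_le_ofReal (by linarith)
  · have key : ∀ x ∈ Ω, ENNReal.ofReal |h x * (1 - g x) - (A ∩ {x | v x ≤ c}).indicator 1 x| ≤
        ENNReal.ofReal (b x) + A.indicator (fun x => ENNReal.ofReal
          |rmp n c (v x) - (Ioi c).indicator 1 (v x)|) x := by
      intro x hx
      have e0 : A.indicator (fun x => ENNReal.ofReal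
          |rmp n c (v x) - (Ioi c).indicator 1 (v x)|) x = ENNReal.ofReal (A.indicator 1 x *
          |rmp n c (v x) - (Ioi c).indicator 1 (v x)|) := by
        by_cases hxA : x ∈ A <;> simp [hxA]
      have n1 : 0 ≤ A.indicator (1 : Euc N → ℝ) x := indicator_nonneg (fun _ _ => zero_le_one) x
      rw [e0, ← ENNReal.ofReal_add (b0 x) (mul_nonneg n1 (abs_nonneg _))]
      refine ENNReal.ofReal_le_ofReal ?_
      have e1 : h x * (1 - g x) - (A ∩ {x | v x ≤ c}).indicator 1 x =
          (h x - A.indicator 1 x) * (1 - g x) +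
            -(A.indicator 1 x * (rmp n c (v x) - (Ioi c).indicator 1 (v x))) := by
        rcases le_or_gt (v x) c with hxc | hxc
        · by_cases hxA : x ∈ A <;> simp [hxA, hxc, hxc.not_gt, hg]
          ring
        · by_cases hxA : x ∈ A <;> simp [hxA, hxc, hxc.not_ge, hg]
          ring
      rw [e1]
      refine (abs_add_le _ _).trans (add_le_add ?_ (le_of_eq ?_))
      · rw [abs_mul, abs_of_nonneg (show 0 ≤ 1 - g x by linarith [g1 x])]
        exact mul_le_of_le_one_right (abs_nonneg _) (by linarith [g0 x])
      · rw [abs_neg, abs_mul, abs_of_nonneg n1]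
    refine (setLIntegral_mono' hΩ.measurableSet key).trans ?_
    have m1 : AEMeasurable (fun x => ENNReal.ofReal (b x)) (volume.restrict Ω) :=
      ((hhC.continuousOn.aemeasurable hΩ.measurableSet).sub
        (measurable_one.indicator hA).aemeasurable).abs.ennreal_ofReal
    rw [lintegral_add_left' m1, setLIntegral_indicator hA, inter_eq_self_of_subset_left hAΩ]
    refine (add_le_add p9 hnη).trans ?_
    rw [← ENNReal.ofReal_add (by positivity) (by positivity)]
    exact ENNReal.ofReal_le_ofReal (by linarith)

lemma seg_ftc {Ω : Set (Euc N)} (hΩ : IsOpen Ω) {e : Euc N → ℝ} (he : ContDiffOn ℝ 1 e Ω)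
    {x₀ : Euc N} {r : ℝ} (hB : ball x₀ r ⊆ Ω) {x y : Euc N} (hx : x ∈ ball x₀ r)
    (hy : y ∈ ball x₀ r) :
    ‖e y - e x‖ₑ ≤ ∫⁻ s in Icc (0:ℝ) 1, ENNReal.ofReal (2 * r) *
      (ball x₀ r).indicator (fun z => ‖fderiv ℝ e z‖ₑ) (x + s • (y - x)) := by
  have hmem : ∀ s ∈ Icc (0:ℝ) 1, x + s • (y - x) ∈ ball x₀ r := fun s hs =>
    (convex_ball x₀ r).add_smul_sub_mem hx hy hs
  have hder : ∀ s ∈ uIcc (0:ℝ) 1, HasDerivAt (fun s : ℝ => e (x + s • (y - x)))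
      (fderiv ℝ e (x + s • (y - x)) (y - x)) s := by
    intro s hs
    rw [uIcc_of_le zero_le_one] at hs
    have h1 : HasFDerivAt e (fderiv ℝ e (x + s • (y - x))) (x + s • (y - x)) :=
      ((he.contDiffAt (hΩ.mem_nhds (hB (hmem s hs)))).differentiableAt one_ne_zero).hasFDerivAt
    have h2 : HasDerivAt (fun s : ℝ => x + s • (y - x)) (y - x) s := by
      simpa using ((hasDerivAt_id s).smul_const (y - x)).const_add x
    exact h1.comp_hasDerivAt s h2
  have hcont : ContinuousOn (fun s : ℝ => fderiv ℝ e (x + s • (y - x)) (y - x)) (uIcc (0:ℝ) 1) := by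
    rw [uIcc_of_le zero_le_one]
    refine ContinuousOn.clm_apply ?_ continuousOn_const
    refine (he.continuousOn_fderiv_of_isOpen hΩ le_rfl).comp (by fun_prop) fun s hs => hB (hmem s hs)
  have h3 := intervalIntegral.integral_eq_sub_of_hasDerivAt hder hcont.intervalIntegrable
  simp only [one_smul, zero_smul, add_zero, add_sub_cancel] at h3
  rw [← h3, intervalIntegral.integral_of_le zero_le_one, ← integral_Icc_eq_integral_Ioc]
  refine (enorm_integral_le_lintegral_enorm _).trans ?_
  refine setLIntegral_mono' measurableSet_Icc fun s hs => ?_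
  rw [indicator_of_mem (hmem s hs), ← ofReal_norm, ← ofReal_norm,
    ← ENNReal.ofReal_mul (by linarith [pos_of_mem_ball hx])]
  refine ENNReal.ofReal_le_ofReal (((fderiv ℝ e _).le_opNorm _).trans ?_)
  rw [mul_comm]
  refine mul_le_mul_of_nonneg_right ?_ (norm_nonneg _)
  rw [← dist_eq_norm]
  have := dist_triangle_right y x x₀
  rw [mem_ball] at hx hy
  linarith

lemma lint_affine {G : Euc N → ℝ≥0∞} (hG : Measurable G) (a : Euc N) {s : ℝ} (hs : 1/2 ≤ s) :
    ∫⁻ y, G (a + s • y) ≤ 2 ^ N * ∫⁻ y, G y := by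
  have h1 : ∫⁻ y, G (a + s • y) = ENNReal.ofReal |(s ^ N)⁻¹| * ∫⁻ y, G (a + y) := by
    have h2 := Measure.map_addHaar_smul (volume : Measure (Euc N)) (show s ≠ 0 by linarith)
    have h3 : ∫⁻ y, G (a + y) ∂(Measure.map (fun y : Euc N => s • y) volume) = ∫⁻ y, G (a + s • y) :=
      lintegral_map (hG.comp (measurable_const_add a)) (measurable_const_smul s)
    rw [← h3]
    have h4 : Measure.map (fun y : Euc N => s • y) volume =
      ENNReal.ofReal |(s ^ N)⁻¹| • (volume : Measure (Euc N)) := by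
      simpa using h2
    rw [h4, lintegral_smul_measure, smul_eq_mul]
  rw [h1, lintegral_add_left_eq_self]
  refine mul_le_mul_left ?_ _
  rw [show (2 : ℝ≥0∞) ^ N = ENNReal.ofReal (2 ^ N) by
    rw [ENNReal.ofReal_pow (by norm_num)]; norm_num]
  refine ENNReal.ofReal_le_ofReal ?_
  rw [abs_of_nonneg (by positivity), ← inv_pow]
  refine pow_le_pow_left₀ (by positivity) ?_ _
  rw [inv_le_comm₀ (by linarith) (by norm_num)]
  linarith

lemma poincare_aux {G : Euc N → ℝ≥0∞} (hG : Measurable G) (B : Set (Euc N)) {s : ℝ} :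
    ∫⁻ x in B, ∫⁻ y in B, G (x + s • (y - x)) ≤ 2 ^ N * (∫⁻ y, G y) * volume B := by
  rcases le_total (1/2) s with hs | hs
  · calc ∫⁻ x in B, ∫⁻ y in B, G (x + s • (y - x)) ≤ ∫⁻ x in B, 2 ^ N * ∫⁻ y, G y := by
          refine lintegral_mono fun x => (setLIntegral_le_lintegral _ _).trans ?_
          refine le_trans (le_of_eq ?_) (lint_affine hG (x - s • x) hs)
          refine lintegral_congr fun y => ?_
          congr 1
          rw [smul_sub]; abel
      _ = _ := setLIntegral_const _ _
  · rw [lintegral_lintegral_swap]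
    · calc ∫⁻ y in B, ∫⁻ x in B, G (x + s • (y - x)) ≤ ∫⁻ y in B, 2 ^ N * ∫⁻ y, G y := by
            refine lintegral_mono fun y => (setLIntegral_le_lintegral _ _).trans ?_
            refine le_trans (le_of_eq ?_) (lint_affine hG (s • y) (s := 1 - s) (by linarith))
            refine lintegral_congr fun x => ?_
            congr 1
            rw [smul_sub, sub_smul, one_smul]; abel
        _ = _ := setLIntegral_const _ _
    · refine Measurable.aemeasurable (hG.comp ?_)
      fun_prop

lemma poincare {Ω : Set (Euc N)} (hΩ : IsOpen Ω) {e : Euc N → ℝ} (he : ContDiffOn ℝ 1 e Ω)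
    {x₀ : Euc N} {r : ℝ} (hB : ball x₀ r ⊆ Ω) :
    ∫⁻ x in ball x₀ r, ∫⁻ y in ball x₀ r, ‖e y - e x‖ₑ ≤
      ENNReal.ofReal (2 * r) * (2 ^ N * (∫⁻ y in ball x₀ r, ‖fderiv ℝ e y‖ₑ) *
        volume (ball x₀ r)) := by
  set B := ball x₀ r with hBdef
  set G : Euc N → ℝ≥0∞ := B.indicator (fun z => ‖fderiv ℝ e z‖ₑ) with hGdef
  have hG : Measurable G := (measurable_fderiv ℝ e).enorm.indicator measurableSet_ball
  have hGi : ∫⁻ y, G y = ∫⁻ y in B, ‖fderiv ℝ e y‖ₑ := lintegral_indicator measurableSet_ball _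
  rw [← hGi]
  have m3 : Measurable (fun p : (Euc N × Euc N) × ℝ => G (p.1.1 + p.2 • (p.1.2 - p.1.1))) :=
    hG.comp (by fun_prop)
  calc ∫⁻ x in B, ∫⁻ y in B, ‖e y - e x‖ₑ
      ≤ ∫⁻ x in B, ∫⁻ y in B, ∫⁻ s in Icc (0:ℝ) 1, ENNReal.ofReal (2 * r) * G (x + s • (y - x)) := by
        refine setLIntegral_mono' measurableSet_ball fun x hx => ?_
        exact setLIntegral_mono' measurableSet_ball fun y hy => seg_ftc hΩ he hB hx hy
    _ = ENNReal.ofReal (2 * r) * ∫⁻ x in B, ∫⁻ y in B, ∫⁻ s in Icc (0:ℝ) 1, G (x + s • (y - x)) := by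
        simp_rw [lintegral_const_mul' _ _ ENNReal.ofReal_ne_top]
    _ = ENNReal.ofReal (2 * r) * ∫⁻ s in Icc (0:ℝ) 1, ∫⁻ x in B, ∫⁻ y in B, G (x + s • (y - x)) := by
        congr 1
        have h1 : ∀ x, ∫⁻ y in B, ∫⁻ s in Icc (0:ℝ) 1, G (x + s • (y - x)) =
            ∫⁻ s in Icc (0:ℝ) 1, ∫⁻ y in B, G (x + s • (y - x)) := fun x => by
          rw [lintegral_lintegral_swap]
          exact Measurable.aemeasurable (hG.comp (by fun_prop))
        simp_rw [h1]
        rw [lintegral_lintegral_swap]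
        refine Measurable.aemeasurable ?_
        have m4 : Measurable (fun p : (Euc N × ℝ) × Euc N => G (p.1.1 + p.1.2 • (p.2 - p.1.1))) :=
          hG.comp (by fun_prop)
        exact m4.lintegral_prod_right'
    _ ≤ ENNReal.ofReal (2 * r) * ∫⁻ s in Icc (0:ℝ) 1, 2 ^ N * (∫⁻ y, G y) * volume B := by
        gcongr with s
        exact poincare_aux hG B
    _ = _ := by
        rw [setLIntegral_const]; simp

lemma poinc_dens {Ω : Set (Euc N)} (hΩ : IsOpen Ω) {e : Euc N → ℝ} (he : ContDiffOn ℝ 1 e Ω)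
    {E : Set (Euc N)} (hE : MeasurableSet E)
    {x₀ : Euc N} {r : ℝ} (hr : 0 < r) (hB : ball x₀ r ⊆ Ω)
    (h1 : volume (ball x₀ r) ≤ 2 ^ (N + 1) * volume (E ∩ ball x₀ r))
    (h2 : 2 * volume (E ∩ ball x₀ r) ≤ volume (ball x₀ r)) :
    volume (ball x₀ r) ≤ 2 ^ (N + 2) * (ENNReal.ofReal (2 * r) * 2 ^ N *
      (∫⁻ y in ball x₀ r, ‖fderiv ℝ e y‖ₑ) +
        ∫⁻ y in ball x₀ r, ENNReal.ofReal |e y - E.indicator 1 y|) := by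
  have hp := poincare hΩ he hB
  set B := ball x₀ r with hBdef
  have hBm : MeasurableSet B := measurableSet_ball
  have hB0 : volume B ≠ 0 := (measure_ball_pos _ _ hr).ne'
  have hBt : volume B ≠ ⊤ := measure_ball_lt_top.ne
  set b : Euc N → ℝ≥0∞ := fun y => ENNReal.ofReal |e y - E.indicator 1 y| with hb
  have hbm : AEMeasurable b (volume.restrict B) :=
    (((he.continuousOn.mono hB).aemeasurable hBm).sub
      (measurable_one.indicator hE).aemeasurable).abs.ennreal_ofReal
  have hvol : volume B = volume (B ∩ E) + volume (B \ E) := (measure_inter_add_sdiff B hE).symm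
  have hhalf : volume B ≤ 2 * volume (B \ E) := by
    have : volume (B ∩ E) ≤ volume (B \ E) := by
      rw [inter_comm] at h2
      have ht : volume (B ∩ E) ≠ ⊤ := ((measure_mono inter_subset_left).trans_lt
        (lt_top_iff_ne_top.2 hBt)).ne
      rw [hvol, two_mul] at h2
      exact (ENNReal.add_le_add_iff_left ht).1 h2
    rw [hvol, two_mul]
    gcongr
  have hprod : volume (B ∩ E) * volume (B \ E) ≤
      ENNReal.ofReal (2 * r) * (2 ^ N * (∫⁻ y in B, ‖fderiv ℝ e y‖ₑ) * volume B) +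
        volume B * ∫⁻ y in B, b y := by
    have hpt : ∀ x ∈ B ∩ E, ∀ y ∈ B \ E, (1 : ℝ≥0∞) ≤ ‖e y - e x‖ₑ + (b y + b x) := by
      intro x hx y hy
      rw [← ofReal_norm, ← ENNReal.ofReal_add (abs_nonneg _) (abs_nonneg _),
        ← ENNReal.ofReal_add (norm_nonneg _) (add_nonneg (abs_nonneg _) (abs_nonneg _)),
        ← ENNReal.ofReal_one]
      refine ENNReal.ofReal_le_ofReal ?_
      rw [indicator_of_mem hx.2, indicator_of_notMem hy.2, Real.norm_eq_abs]
      simp only [Pi.one_apply, sub_zero]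
      have t1 := neg_abs_le (e y - e x)
      have t2 := neg_abs_le (e x - 1)
      have t3 := le_abs_self (e y)
      linarith
    calc volume (B ∩ E) * volume (B \ E) = ∫⁻ x in B ∩ E, ∫⁻ y in B \ E, 1 := by
          rw [setLIntegral_const, setLIntegral_const, one_mul, mul_comm]
      _ ≤ ∫⁻ x in B ∩ E, ∫⁻ y in B \ E, (‖e y - e x‖ₑ + (b y + b x)) := by
          refine setLIntegral_mono' (hBm.inter hE) fun x hx => ?_
          exact setLIntegral_mono' (hBm.diff hE) fun y hy => hpt x hx y hy
      _ ≤ ∫⁻ x in B ∩ E, ((∫⁻ y in B, ‖e y - e x‖ₑ) +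
            ((∫⁻ y in B \ E, b y) + b x * volume B)) := by
          refine lintegral_mono fun x => ?_
          have hb' : AEMeasurable b (volume.restrict (B \ E)) := hbm.mono_set sdiff_subset
          have hbx : AEMeasurable (fun y => b y + b x) (volume.restrict (B \ E)) :=
            hb'.add_const _
          rw [lintegral_add_right' _ hbx, lintegral_add_right _ measurable_const, setLIntegral_const]
          gcongr
          · exact sdiff_subset
          · exact sdiff_subset
      _ ≤ (∫⁻ x in B, ∫⁻ y in B, ‖e y - e x‖ₑ) + ((∫⁻ y in B \ E, b y) * volume B +
            (∫⁻ x in B ∩ E, b x) * volume B) := by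
          have hb2 : AEMeasurable b (volume.restrict (B ∩ E)) := hbm.mono_set inter_subset_left
          have hbx : AEMeasurable (fun x => (∫⁻ y in B \ E, b y) + b x * volume B)
              (volume.restrict (B ∩ E)) := (hb2.mul_const _).const_add _
          rw [lintegral_add_right' _ hbx, lintegral_add_left measurable_const, setLIntegral_const,
            lintegral_mul_const' _ _ hBt]
          gcongr
          · exact inter_subset_left
          · exact inter_subset_left
      _ ≤ _ := by
          rw [← add_mul, add_comm (∫⁻ y in B \ E, b y), lintegral_inter_add_sdiff _ _ hE,
            mul_comm (∫⁻ y in B, b y)]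
          gcongr
  set I := ∫⁻ y in B, ‖fderiv ℝ e y‖ₑ with hI
  set J := ∫⁻ y in B, b y with hJ
  have h3 : volume B * volume B ≤ volume B *
      (2 ^ (N + 2) * (ENNReal.ofReal (2 * r) * 2 ^ N * I + J)) := by
    calc volume B * volume B ≤ (2 ^ (N + 1) * volume (B ∩ E)) * (2 * volume (B \ E)) := by
          rw [inter_comm] at h1
          gcongr
      _ = 2 ^ (N + 2) * (volume (B ∩ E) * volume (B \ E)) := by ring
      _ ≤ 2 ^ (N + 2) * (ENNReal.ofReal (2 * r) * (2 ^ N * I * volume B) + volume B * J) := by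
          gcongr
      _ = _ := by ring
  exact (ENNReal.mul_le_mul_iff_right hB0 hBt).1 h3

/-- Truncated distance to the complement. -/
def rdist (Ω : Set (Euc N)) (x : Euc N) : ℝ := (min 1 (infEDist x Ωᶜ)).toReal

lemma rdist_ne_top (Ω : Set (Euc N)) (x : Euc N) : min 1 (infEDist x Ωᶜ) ≠ ⊤ :=
  ((min_le_left _ _).trans_lt ENNReal.one_lt_top).ne

lemma rdist_le_one (Ω : Set (Euc N)) (x : Euc N) : rdist Ω x ≤ 1 := by
  have := ENNReal.toReal_mono ENNReal.one_ne_top (min_le_left 1 (infEDist x Ωᶜ))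
  simpa [rdist] using this

lemma rdist_le_add (Ω : Set (Euc N)) (x y : Euc N) : rdist Ω x ≤ rdist Ω y + dist x y := by
  have h : min 1 (infEDist x Ωᶜ) ≤ min 1 (infEDist y Ωᶜ) + edist x y := by
    rw [← min_add_add_right]
    exact le_min ((min_le_left _ _).trans le_self_add)
      ((min_le_right _ _).trans infEDist_le_infEDist_add_edist)
  have h2 := ENNReal.toReal_mono (ENNReal.add_ne_top.2 ⟨rdist_ne_top Ω y, edist_ne_top x y⟩) h
  rw [ENNReal.toReal_add (rdist_ne_top Ω y) (edist_ne_top x y)] at h2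
  rwa [dist_edist]

lemma rdist_continuous (Ω : Set (Euc N)) : Continuous (rdist Ω) :=
  (LipschitzWith.of_le_add (rdist_le_add Ω)).continuous

lemma rdist_pos {Ω : Set (Euc N)} (hΩ : IsOpen Ω) {x : Euc N} (hx : x ∈ Ω) : 0 < rdist Ω x := by
  refine ENNReal.toReal_pos (ne_of_gt (lt_min one_pos ?_)) (rdist_ne_top Ω x)
  rw [infEDist_pos_iff_notMem_closure, hΩ.isClosed_compl.closure_eq]
  exact fun h => h hx

lemma ball_rdist_subset (Ω : Set (Euc N)) (x : Euc N) : ball x (rdist Ω x) ⊆ Ω := by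
  intro y hy
  by_contra hyΩ
  have h1 : min 1 (infEDist x Ωᶜ) ≤ edist x y :=
    (min_le_right _ _).trans (infEDist_le_edist_of_mem hyΩ)
  have h2 := ENNReal.toReal_mono (edist_ne_top x y) h1
  rw [← dist_edist, dist_comm] at h2
  rw [mem_ball] at hy
  exact absurd hy (not_lt.2 h2)

/-- The weight. -/
def wgt (Ω : Set (Euc N)) (x : Euc N) : ℝ := 1 + 8 * 40 ^ N / vb N * ((rdist Ω x) ^ N)⁻¹

lemma wgt_cont {Ω : Set (Euc N)} (hΩ : IsOpen Ω) : ContinuousOn (wgt Ω) Ω := by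
  refine continuousOn_const.add (continuousOn_const.mul (ContinuousOn.inv₀ ?_ ?_))
  · exact ((rdist_continuous Ω).pow N).continuousOn
  · exact fun x hx => (pow_pos (rdist_pos hΩ hx) N).ne'

lemma wgt_ge_one {Ω : Set (Euc N)} (hΩ : IsOpen Ω) : ∀ x ∈ Ω, 1 ≤ wgt Ω x := by
  intro x hx
  have := rdist_pos hΩ hx
  have := vb_pos N
  unfold wgt
  have : 0 ≤ 8 * 40 ^ N / vb N * ((rdist Ω x) ^ N)⁻¹ := by positivity
  linarith

lemma small_dens {Ω E : Set (Euc N)} (hΩ : IsOpen Ω) (hE : MeasurableSet E) (hEΩ : E ⊆ Ω)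
    (hw : ∫⁻ x in E, ENNReal.ofReal (wgt Ω x) ≤ ENNReal.ofReal 4) {x : Euc N} (hx : x ∈ Ω) :
    2 * volume (E ∩ ball x (rdist Ω x / 20)) ≤ volume (ball x (rdist Ω x / 20)) := by
  have hρ := rdist_pos hΩ hx
  have hvb := vb_pos N
  set R := rdist Ω x / 20 with hR
  have hR0 : 0 < R := by positivity
  set W := 8 / vb N * (R ^ N)⁻¹ with hW
  have hW0 : 0 < W := by positivity
  have h1 : ∀ y ∈ E ∩ ball x R, ENNReal.ofReal W ≤ ENNReal.ofReal (wgt Ω y) := by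
    intro y hy
    refine ENNReal.ofReal_le_ofReal ?_
    have hy0 := rdist_pos hΩ (hEΩ hy.1)
    have h2 : rdist Ω y ≤ 40 * R := by
      have h3 := rdist_le_add Ω y x
      have h4 := mem_ball.1 hy.2
      have : rdist Ω x = 20 * R := by rw [hR]; ring
      linarith
    have h5 : ((40 * R) ^ N)⁻¹ ≤ (rdist Ω y ^ N)⁻¹ :=
      inv_anti₀ (by positivity) (pow_le_pow_left₀ hy0.le h2 N)
    have h6 : W = 8 * 40 ^ N / vb N * ((40 * R) ^ N)⁻¹ := by
      rw [hW, mul_pow]; field_simp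
    have h7 : W ≤ 8 * 40 ^ N / vb N * (rdist Ω y ^ N)⁻¹ := by
      rw [h6]; exact mul_le_mul_of_nonneg_left h5 (by positivity)
    unfold wgt
    linarith
  have h2 : ENNReal.ofReal W * volume (E ∩ ball x R) ≤ ENNReal.ofReal 4 := by
    rw [← setLIntegral_const]
    exact (setLIntegral_mono' (hE.inter measurableSet_ball) h1).trans
      ((lintegral_mono_set inter_subset_left).trans hw)
  have h3 : ENNReal.ofReal W * (2 * volume (E ∩ ball x R)) ≤ ENNReal.ofReal W * volume (ball x R) := by
    rw [vol_ball' x hR0, ← ENNReal.ofReal_mul hW0.le]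
    have h4 : W * (R ^ N * vb N) = 8 := by
      rw [hW]; field_simp
    rw [h4, mul_left_comm]
    calc 2 * (ENNReal.ofReal W * volume (E ∩ ball x R)) ≤ 2 * ENNReal.ofReal 4 := by gcongr
      _ = ENNReal.ofReal 8 := by
        rw [show (2 : ℝ≥0∞) = ENNReal.ofReal 2 by norm_num, ← ENNReal.ofReal_mul (by norm_num)]
        norm_num
  exact (ENNReal.mul_le_mul_iff_right (ENNReal.ofReal_pos.2 hW0).ne' ENNReal.ofReal_ne_top).1 h3

lemma stopping {E : Set (Euc N)} {x : Euc N} (hd : HasDensity E x 1) {R : ℝ} (hR : 0 < R)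
    (h0 : 2 * volume (E ∩ ball x R) ≤ volume (ball x R)) :
    ∃ r, 0 < r ∧ r ≤ R ∧ volume (ball x r) ≤ 2 ^ (N + 1) * volume (E ∩ ball x r) ∧
      2 * volume (E ∩ ball x r) ≤ volume (ball x r) := by
  have hRk : ∀ k : ℕ, 0 < R / 2 ^ k := fun k => by positivity
  have hlim : Tendsto (fun k : ℕ => R / 2 ^ k) atTop (𝓝[>] 0) := by
    refine tendsto_nhdsWithin_iff.2 ⟨?_, Eventually.of_forall hRk⟩
    have := (tendsto_pow_atTop_nhds_zero_of_lt_one (r := (1/2 : ℝ)) (by norm_num)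
      (by norm_num)).const_mul R
    rw [mul_zero] at this
    refine this.congr fun k => ?_
    rw [one_div, inv_pow]; rfl
  have hex : ∃ k : ℕ, volume (ball x (R / 2 ^ k)) < 2 * volume (E ∩ ball x (R / 2 ^ k)) := by
    have h1 := (hd.comp hlim).eventually (lt_mem_nhds (a := (2 : ℝ≥0∞)⁻¹) (by
      rw [ENNReal.ofReal_one]; exact ENNReal.one_half_lt_one))
    obtain ⟨k, hk⟩ := h1.exists
    refine ⟨k, ?_⟩
    simp only [Function.comp] at hk
    have hb0 : volume (ball x (R / 2 ^ k)) ≠ 0 := (measure_ball_pos _ _ (hRk k)).ne'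
    have hbt : volume (ball x (R / 2 ^ k)) ≠ ⊤ := measure_ball_lt_top.ne
    rw [ENNReal.lt_div_iff_mul_lt (Or.inl hb0) (Or.inl hbt)] at hk
    have h2 := (ENNReal.mul_lt_mul_iff_right (a := 2) two_ne_zero ENNReal.ofNat_ne_top).2 hk
    rwa [← mul_assoc, ENNReal.mul_inv_cancel two_ne_zero ENNReal.ofNat_ne_top, one_mul] at h2
  classical
  have hspec := Nat.find_spec hex
  have hmin := fun m => Nat.find_min hex (m := m)
  rcases hk : Nat.find hex with _ | j
  · rw [hk] at hspec
    simp only [pow_zero, div_one] at hspec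
    exact absurd h0 (not_le.2 hspec)
  · rw [hk] at hspec
    refine ⟨R / 2 ^ j, hRk j, div_le_self hR.le (one_le_pow₀ (by norm_num)), ?_,
      not_lt.1 (hmin j (by omega))⟩
    have e1 : R / 2 ^ j = 2 * (R / 2 ^ (j + 1)) := by rw [pow_succ]; field_simp
    have e2 : volume (ball x (R / 2 ^ j)) = 2 ^ N * volume (ball x (R / 2 ^ (j + 1))) := by
      rw [vol_ball' x (hRk j), vol_ball' x (hRk (j + 1)), e1, mul_pow, mul_assoc,
        ENNReal.ofReal_mul (by positivity), ENNReal.ofReal_pow (by norm_num)]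
      norm_num
    rw [e2, pow_succ (2 : ℝ≥0∞), mul_assoc]
    have hle : R / 2 ^ (j + 1) ≤ R / 2 ^ j := by linarith [hRk (j + 1)]
    have hsub : volume (E ∩ ball x (R / 2 ^ (j + 1))) ≤ volume (E ∩ ball x (R / 2 ^ j)) :=
      measure_mono (inter_subset_inter_right _ (ball_subset_ball hle))
    exact mul_le_mul_right (hspec.le.trans (mul_le_mul_right hsub _)) _

lemma boxing {Ω E S : Set (Euc N)} (hΩ : IsOpen Ω) (hE : MeasurableSet E) {ε₁ : ℝ} (hε₁ : 0 ≤ ε₁)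
    (hS : ∀ x ∈ S, ∃ r, 0 < r ∧ r ≤ rdist Ω x / 20 ∧
      volume (ball x r) ≤ 2 ^ (N + 1) * volume (E ∩ ball x r) ∧
      2 * volume (E ∩ ball x r) ≤ volume (ball x r))
    (he : ∀ η : ℝ, 0 < η → ∃ e : Euc N → ℝ, ContDiffOn ℝ 1 e Ω ∧
      ∫⁻ x in Ω, ‖fderiv ℝ e x‖ₑ ≤ ENNReal.ofReal (ε₁ + η) ∧
      ∫⁻ x in Ω, ENNReal.ofReal |e x - E.indicator 1 x| ≤ ENNReal.ofReal η) :
    ∃ (u : Set (Euc N)) (r : Euc N → ℝ), u.Countable ∧ (∀ x ∈ u, 0 < r x ∧ r x ≤ rdist Ω x / 20) ∧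
      S ⊆ ⋃ x ∈ u, ball x (6 * r x) ∧
      ∀ F : Finset (Euc N), (∀ x ∈ F, x ∈ u) →
        ∑ x ∈ F, (r x) ^ N / r x ≤ 2 ^ (N + 2) * (2 ^ (N + 1) * ε₁) / vb N := by
  classical
  choose! r hr0 hrR hr1 hr2 using hS
  obtain ⟨u, huS, hdis, hcov⟩ := Vitali.exists_disjoint_subfamily_covering_enlargement_closedBall
    S (fun x => x) r 1 (fun x hx => by linarith [hrR x hx, rdist_le_one Ω x]) 5 (by norm_num)
  have hdis' : u.PairwiseDisjoint fun x => ball x (r x) :=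
    hdis.mono_on fun x _ => ball_subset_closedBall
  refine ⟨u, r, ?_, fun x hx => ⟨hr0 x (huS hx), hrR x (huS hx)⟩, ?_, ?_⟩
  · exact hdis'.countable_of_isOpen (fun x _ => isOpen_ball)
      (fun x hx => nonempty_ball.2 (hr0 x (huS hx)))
  · intro x hx
    obtain ⟨y, hy, hxy⟩ := hcov x hx
    refine mem_biUnion hy ?_
    have h1 := hxy (mem_closedBall_self (hr0 x hx).le)
    have h2 := hr0 y (huS hy)
    exact closedBall_subset_ball (by linarith) h1
  · intro F hF
    have hBΩ : ∀ x ∈ F, ball x (r x) ⊆ Ω := fun x hx =>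
      (ball_subset_ball (by
        have := hrR x (huS (hF x hx)); have := hr0 x (huS (hF x hx)); linarith)).trans
        (ball_rdist_subset Ω x)
    have hFd : (F : Set (Euc N)).PairwiseDisjoint fun x => ball x (r x) := hdis'.subset hF
    set m : ℝ := ∑ x ∈ F, 1 / r x with hm
    have hpos : ∀ x ∈ F, 0 < r x := fun x hx => hr0 x (huS (hF x hx))
    have hm1 : ∀ x ∈ F, 1 / r x ≤ m := fun x hx =>
      Finset.single_le_sum (f := fun x => 1 / r x)
        (fun y hy => (one_div_pos.2 (hpos y hy)).le) hx
    have hm0 : 0 ≤ m := Finset.sum_nonneg fun y hy => (one_div_pos.2 (hpos y hy)).le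
    have hsumΩ : ∀ f : Euc N → ℝ≥0∞, ∑ x ∈ F, ∫⁻ y in ball x (r x), f y ≤ ∫⁻ y in Ω, f y := by
      intro f
      rw [← lintegral_biUnion_finset hFd (fun x _ => measurableSet_ball)]
      exact lintegral_mono_set (iUnion₂_subset hBΩ)
    have key : ∀ η : ℝ, 0 < η → (∑ x ∈ F, (r x) ^ N / r x) * vb N ≤
        2 ^ (N + 2) * (2 ^ (N + 1) * (ε₁ + η) + m * η) := by
      intro η hη
      obtain ⟨e, he1, he2, he3⟩ := he η hη
      rw [← ENNReal.ofReal_le_ofReal_iff (by positivity), Finset.sum_mul,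
        ENNReal.ofReal_sum_of_nonneg (fun x hx => by
          have := hpos x hx; have := vb_pos N; positivity)]
      have hone : ∀ x ∈ F, ENNReal.ofReal ((r x) ^ N / r x * vb N) ≤ 2 ^ (N + 2) *
          (2 ^ (N + 1) * (∫⁻ y in ball x (r x), ‖fderiv ℝ e y‖ₑ) +
            ENNReal.ofReal m * ∫⁻ y in ball x (r x), ENNReal.ofReal |e y - E.indicator 1 y|) := by
        intro x hx
        have hrx := hpos x hx
        have h1 := poinc_dens hΩ he1 hE hrx (hBΩ x hx) (hr1 x (huS (hF x hx)))
          (hr2 x (huS (hF x hx)))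
        set I := ∫⁻ y in ball x (r x), ‖fderiv ℝ e y‖ₑ
        set J := ∫⁻ y in ball x (r x), ENNReal.ofReal |e y - E.indicator 1 y|
        have e1 : ENNReal.ofReal ((r x) ^ N / r x * vb N) =
            ENNReal.ofReal (1 / r x) * volume (ball x (r x)) := by
          rw [vol_ball' x hrx, ← ENNReal.ofReal_mul (by positivity)]
          congr 1; field_simp
        have e2 : ENNReal.ofReal (1 / r x) * ENNReal.ofReal (2 * r x) = 2 := by
          rw [← ENNReal.ofReal_mul (by positivity)]
          rw [show 1 / r x * (2 * r x) = 2 by field_simp]; norm_num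
        rw [e1]
        calc ENNReal.ofReal (1 / r x) * volume (ball x (r x)) ≤ ENNReal.ofReal (1 / r x) *
              (2 ^ (N + 2) * (ENNReal.ofReal (2 * r x) * 2 ^ N * I + J)) := by gcongr
          _ = 2 ^ (N + 2) * ((ENNReal.ofReal (1 / r x) * ENNReal.ofReal (2 * r x)) * 2 ^ N * I +
                ENNReal.ofReal (1 / r x) * J) := by ring
          _ ≤ _ := by
            rw [e2]
            gcongr
            · exact le_of_eq (by ring)
            · exact hm1 x hx
      refine (Finset.sum_le_sum hone).trans ?_
      rw [← Finset.mul_sum, Finset.sum_add_distrib, ← Finset.mul_sum, ← Finset.mul_sum]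
      have e3 : ∀ k : ℕ, (2 : ℝ≥0∞) ^ k = ENNReal.ofReal (2 ^ k) := fun k => by
        rw [ENNReal.ofReal_pow (by norm_num)]; norm_num
      rw [ENNReal.ofReal_mul (by positivity), ENNReal.ofReal_add (by positivity) (by positivity),
        ENNReal.ofReal_mul (by positivity), ENNReal.ofReal_mul hm0, ← e3, ← e3]
      gcongr
      · exact (hsumΩ _).trans he2
      · exact (hsumΩ _).trans he3
    have hl : Tendsto (fun η : ℝ => 2 ^ (N + 2) * (2 ^ (N + 1) * (ε₁ + η) + m * η)) (𝓝[>] 0)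
        (𝓝 (2 ^ (N + 2) * (2 ^ (N + 1) * (ε₁ + 0) + m * 0))) :=
      ((by fun_prop : Continuous (fun η : ℝ =>
        (2:ℝ) ^ (N + 2) * (2 ^ (N + 1) * (ε₁ + η) + m * η))).tendsto 0).mono_left nhdsWithin_le_nhds
    have h9 := ge_of_tendsto hl (by
      filter_upwards [self_mem_nhdsWithin] with η hη using key η hη)
    rw [le_div_iff₀ (vb_pos N)]
    simpa using h9

/-- Boxing constant. -/
def Cbox (N : ℕ) : ℝ := 2 ^ (N + 2) * (2 ^ (N + 1) * (5 + 20 * Lr)) / vb N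

/-- Total constant. -/
def Qc (N : ℕ) : ℝ :=
  8 + 10 * Lr + 2 * Lr * N * vb N * 6 ^ N * Cbox N + 6 ^ N * vb N * Cbox N

lemma Cbox_pos (N : ℕ) : 0 < Cbox N := by
  have := vb_pos N
  have := Lr_pos
  unfold Cbox
  positivity

lemma Qc_pos (N : ℕ) : 0 < Qc N := by
  have := vb_pos N
  have := Lr_pos
  have := Cbox_pos N
  unfold Qc
  positivity

lemma core_boxes {Ω U₀ : Set (Euc N)} (hΩ : IsOpen Ω) (hU₀ : IsOpen U₀) {c₀ s₀ : ℝ} (hc₀ : 0 ≤ c₀)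
    (hrel : RelPer Ω U₀ c₀) {u : Set (Euc N)} (hu : u.Countable) {r : Euc N → ℝ}
    (hr : ∀ x ∈ u, 0 < r x ∧ r x ≤ 1)
    (hsum : ∀ F : Finset (Euc N), (∀ x ∈ F, x ∈ u) → ∑ x ∈ F, (r x) ^ N / r x ≤ s₀) :
    volume (⋃ x ∈ u, ball x (6 * r x)) ≤ ENNReal.ofReal (6 ^ N * vb N * s₀) ∧
    ∀ φ ∈ TestVF Ω, ∫ x in U₀ ∪ ⋃ x ∈ u, ball x (6 * r x), diverg φ x ≤
      c₀ + 2 * Lr * N * vb N * 6 ^ N * s₀ := by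
  classical
  have hvb := vb_pos N
  have hL := Lr_pos
  have hcu := hu.to_subtype
  have hsum' : ∀ F : Finset u, ∑ x ∈ F, (r x) ^ N / r x ≤ s₀ := by
    intro F
    have := hsum (F.map (Function.Embedding.subtype _)) (fun x hx => by
      obtain ⟨y, -, rfl⟩ := Finset.mem_map.1 hx
      exact y.2)
    rw [Finset.sum_map] at this
    exact this
  have hq : ∀ x : u, 0 < (r x) ^ N / r x := fun x => by
    have := (hr x x.2).1
    positivity
  constructor
  · refine (measure_biUnion_le _ hu _).trans ?_
    rw [ENNReal.tsum_eq_iSup_sum]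
    refine iSup_le fun F => ?_
    calc ∑ x ∈ F, volume (ball (x : Euc N) (6 * r x))
        ≤ ∑ x ∈ F, ENNReal.ofReal (6 ^ N * vb N * ((r x) ^ N / r x)) := by
          refine Finset.sum_le_sum fun x _ => ?_
          have h1 := (hr x x.2).1
          have h2 := (hr x x.2).2
          rw [vol_ball' _ (by positivity), mul_pow]
          refine ENNReal.ofReal_le_ofReal ?_
          have h3 : (r x) ^ N ≤ (r x) ^ N / r x := by
            rw [le_div_iff₀ h1]
            exact mul_le_of_le_one_right (by positivity) h2
          calc 6 ^ N * (r x) ^ N * vb N = 6 ^ N * vb N * (r x) ^ N := by ring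
            _ ≤ _ := mul_le_mul_of_nonneg_left h3 (by positivity)
      _ = ENNReal.ofReal (∑ x ∈ F, 6 ^ N * vb N * ((r x) ^ N / r x)) :=
          (ENNReal.ofReal_sum_of_nonneg fun x _ => mul_nonneg (by positivity) (hq x).le).symm
      _ ≤ _ := by
          refine ENNReal.ofReal_le_ofReal ?_
          rw [← Finset.mul_sum]
          exact mul_le_mul_of_nonneg_left (hsum' F) (by positivity)
  · intro φ hφ
    set V : Finset u → Set (Euc N) := fun F => U₀ ∪ ⋃ x ∈ F, ball (x : Euc N) (6 * r x) with hV
    have hVo : ∀ F, IsOpen (V F) := fun F =>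
      hU₀.union (isOpen_iUnion fun x => isOpen_iUnion fun _ => isOpen_ball)
    have hVm : Monotone V := fun F G hFG =>
      union_subset_union_right _ (biUnion_subset_biUnion_left hFG)
    have hVU : ⋃ F, V F = U₀ ∪ ⋃ x ∈ u, ball x (6 * r x) := by
      ext y
      simp only [hV, mem_iUnion, mem_union]
      constructor
      · rintro ⟨F, h | ⟨x, -, hx⟩⟩
        · exact Or.inl h
        · exact Or.inr ⟨x, x.2, hx⟩
      · rintro (h | ⟨x, hx, hy⟩)
        · exact ⟨∅, Or.inl h⟩
        · exact ⟨{⟨x, hx⟩}, Or.inr ⟨⟨x, hx⟩, by simp, hy⟩⟩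
    have hlim := tendsto_setIntegral_of_monotone (μ := volume) (f := diverg φ)
      (fun F => (hVo F).measurableSet) hVm (diverg_integrable hφ.1 hφ.2.1).integrableOn
    rw [hVU] at hlim
    refine le_of_tendsto' hlim fun F => ?_
    have hd : ∀ x : u, 0 ≤ 2 * Lr * N * vb N * ((6 * r x) ^ N / (6 * r x)) := fun x => by
      have := (hr x x.2).1
      positivity
    have h1 := relper_finset hΩ hc₀ hrel (fun x : u => ball (x : Euc N) (6 * r x)) _ hd
      (fun x => relper_ball Ω x (by linarith [(hr x x.2).1])) F
    refine (relper_integral hΩ (hVo F).measurableSet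
      (add_nonneg hc₀ (Finset.sum_nonneg fun x _ => hd x)) h1 hφ).trans ?_
    gcongr
    calc ∑ x ∈ F, 2 * Lr * N * vb N * ((6 * r x) ^ N / (6 * r x))
        ≤ ∑ x ∈ F, 2 * Lr * N * vb N * 6 ^ N * ((r x) ^ N / r x) := by
          refine Finset.sum_le_sum fun x _ => ?_
          have h1 := (hr x x.2).1
          have h3 : (6 * r x) ^ N / (6 * r x) ≤ 6 ^ N * ((r x) ^ N / r x) := by
            rw [mul_pow, mul_div_assoc]
            refine mul_le_mul_of_nonneg_left ?_ (by positivity)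
            exact div_le_div_of_nonneg_left (by positivity) h1 (by linarith)
          calc _ ≤ 2 * Lr * N * vb N * (6 ^ N * ((r x) ^ N / r x)) :=
                mul_le_mul_of_nonneg_left h3 (by positivity)
            _ = _ := by ring
      _ ≤ _ := by
          rw [← Finset.mul_sum]
          exact mul_le_mul_of_nonneg_left (hsum' F) (by positivity)

lemma hasDensity_congr {A E : Set (Euc N)} {x : Euc N} {s : ℝ} (hs : 0 < s)
    (h : ∀ y ∈ ball x s, y ∈ A → y ∈ E) (hEA : E ⊆ A) (hd : HasDensity A x 1) :
    HasDensity E x 1 := by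
  refine Tendsto.congr' ?_ hd
  filter_upwards [Ioo_mem_nhdsGT hs] with ρ hρ
  congr 2
  ext y
  exact ⟨fun hy => ⟨h y (ball_subset_ball hρ.2.le hy.2) hy.1, hy.2⟩, fun hy => ⟨hEA hy.1, hy.2⟩⟩

lemma core {Ω A : Set (Euc N)} (hΩ : IsOpen Ω) (hA : MeasurableSet A) (hAΩ : A ⊆ Ω)
    (hper : perimeter A Ω < ⊤) {δ : ℝ} (hδ : 0 < δ) :
    ∃ U : Set (Euc N), IsOpen U ∧ U ⊆ Ω ∧ densityOne A Ω ⊆ U ∧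
      volume (U \ A) ≤ ENNReal.ofReal (Qc N * δ) ∧
      ∀ φ ∈ TestVF Ω, ∫ x in U, diverg φ x ≤ (perimeter A Ω).toReal + Qc N * δ := by
  have hvb := vb_pos N
  have hL := Lr_pos
  have hCb := Cbox_pos N
  obtain ⟨φ, hφ, hφδ⟩ := exists_testVF hper hδ
  obtain ⟨D, hD0, hD⟩ := diverg_bound hφ.1 hφ.2.1
  set κ : ℝ := min 1 (δ / (1 + D)) with hκdef
  have hκ : 0 < κ := lt_min one_pos (by positivity)
  have hκ1 : κ ≤ 1 := min_le_left _ _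
  have hκD : κ * (1 + D) ≤ δ := by
    have := min_le_right 1 (δ / (1 + D))
    rwa [le_div_iff₀ (by positivity)] at this
  have hDκ0 : 0 ≤ D * κ := by positivity
  have hκδ : κ ≤ δ := by linarith
  have hDκ : D * κ ≤ δ := by linarith
  obtain ⟨v, hv, hvint, hM1, hM2, hw⟩ :=
    key_prop hΩ hA hAΩ hper hφ hφδ (wgt_cont hΩ) (wgt_ge_one hΩ) hκ
  have hL1 : ∫⁻ x in Ω, ENNReal.ofReal |v x - A.indicator 1 x| ≤ ENNReal.ofReal κ := by
    refine le_trans (setLIntegral_mono' hΩ.measurableSet fun x hx => ENNReal.ofReal_le_ofReal ?_) hw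
    exact le_mul_of_one_le_left (abs_nonneg _) (wgt_ge_one hΩ x hx)
  have hK : δ + κ < 5 * (δ + κ) * (1 / 4) := by linarith
  obtain ⟨t, ht, hU₀⟩ := U0_relper hΩ hA hper hφ hD0 hD hv hvint hκ.le (by positivity) hM1 hK hL1
  obtain ⟨c, hc, he⟩ := E_approx hΩ hA hAΩ hper hφ hφδ hD0 hD hv hvint hκ.le (by positivity)
    hM2 hK hL1
  set E := A ∩ {x | v x ≤ c} with hEdef
  set U₀ : Set (Euc N) := {x | x ∈ Ω ∧ t < v x} with hU₀def
  have hEA : E ⊆ A := inter_subset_left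
  have hop : ∀ s : ℝ, IsOpen (Ω ∩ v ⁻¹' Ioi s) := fun s =>
    hv.continuousOn.isOpen_inter_preimage hΩ isOpen_Ioi
  have hE : MeasurableSet E := by
    have : E = A \ (Ω ∩ v ⁻¹' Ioi c) := by
      ext x
      simp only [hEdef, mem_inter_iff, mem_ofPred_eq, Set.mem_sdiff, mem_preimage, mem_Ioi, not_and, not_lt]
      exact ⟨fun h => ⟨h.1, fun _ => h.2⟩, fun h => ⟨h.1, h.2 (hAΩ h.1)⟩⟩
    rw [this]
    exact hA.diff (hop c).measurableSet
  have hU₀o : IsOpen U₀ := hop t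
  have hwE : ∫⁻ x in E, ENNReal.ofReal (wgt Ω x) ≤ ENNReal.ofReal 4 := by
    calc ∫⁻ x in E, ENNReal.ofReal (wgt Ω x)
        ≤ ∫⁻ x in E, ENNReal.ofReal 4 * ENNReal.ofReal (wgt Ω x * |v x - A.indicator 1 x|) := by
          refine setLIntegral_mono' hE fun x hx => ?_
          rw [← ENNReal.ofReal_mul (by norm_num)]
          refine ENNReal.ofReal_le_ofReal ?_
          have h1 := wgt_ge_one hΩ x (hAΩ hx.1)
          have h2 : v x ≤ c := hx.2
          rw [indicator_of_mem hx.1, Pi.one_apply, abs_of_nonpos (by linarith [hc.2])]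
          nlinarith [hc.2]
      _ = ENNReal.ofReal 4 * ∫⁻ x in E, ENNReal.ofReal (wgt Ω x * |v x - A.indicator 1 x|) :=
          lintegral_const_mul' _ _ ENNReal.ofReal_ne_top
      _ ≤ ENNReal.ofReal 4 * ENNReal.ofReal κ := by
          gcongr
          exact (lintegral_mono_set (hEA.trans hAΩ)).trans hw
      _ ≤ ENNReal.ofReal 4 := by
          rw [← ENNReal.ofReal_mul (by norm_num)]
          exact ENNReal.ofReal_le_ofReal (by linarith)
  have hε₁ : δ + 2 * (Lr * (5 * (δ + κ))) + D * (4 * κ) ≤ (5 + 20 * Lr) * δ := by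
    nlinarith
  obtain ⟨u, r, hu, hur, hcov, hsum⟩ := boxing (S := {x | x ∈ Ω ∧ HasDensity E x 1})
    (ε₁ := (5 + 20 * Lr) * δ) hΩ hE (by positivity)
    (fun x hx => stopping hx.2 (by linarith [rdist_pos hΩ hx.1])
      (small_dens hΩ hE (hEA.trans hAΩ) hwE hx.1))
    (fun η hη => by
      obtain ⟨e, e1, e2, e3⟩ := he η hη
      exact ⟨e, e1, e2.trans (ENNReal.ofReal_le_ofReal (by linarith)), e3⟩)
  have hsum' : ∀ F : Finset (Euc N), (∀ x ∈ F, x ∈ u) →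
      ∑ x ∈ F, (r x) ^ N / r x ≤ Cbox N * δ := fun F hF =>
    (hsum F hF).trans (le_of_eq (by unfold Cbox; ring))
  have hc₀ : 0 ≤ Lr * (5 * (δ + κ)) + (perimeter A Ω).toReal + D * (4 * κ) := by
    have : 0 ≤ (perimeter A Ω).toReal := ENNReal.toReal_nonneg
    positivity
  obtain ⟨hvol, hIntg⟩ := core_boxes hΩ hU₀o hc₀ hU₀ hu
    (fun x hx => ⟨(hur x hx).1, by linarith [(hur x hx).2, rdist_le_one Ω x]⟩) hsum'
  refine ⟨U₀ ∪ ⋃ x ∈ u, ball x (6 * r x), ?_, ?_, ?_, ?_, ?_⟩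
  · exact hU₀o.union (isOpen_iUnion fun x => isOpen_iUnion fun _ => isOpen_ball)
  · refine union_subset (fun x hx => hx.1) (iUnion₂_subset fun x hx => ?_)
    refine (ball_subset_ball ?_).trans (ball_rdist_subset Ω x)
    linarith [(hur x hx).1, (hur x hx).2]
  · rintro x ⟨hxΩ, hxd⟩
    by_cases hxt : t < v x
    · exact Or.inl ⟨hxΩ, hxt⟩
    · right
      have hxc : v x < c := by linarith [ht.2, hc.1, not_lt.1 hxt]
      have hnb : Ω ∩ v ⁻¹' Iio c ∈ 𝓝 x :=
        (hv.continuousOn.isOpen_inter_preimage hΩ isOpen_Iio).mem_nhds ⟨hxΩ, hxc⟩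
      obtain ⟨s, hs, hsb⟩ := Metric.mem_nhds_iff.1 hnb
      exact hcov ⟨hxΩ, hasDensity_congr hs (fun y hy hyA => ⟨hyA, show v y ≤ c from le_of_lt (hsb hy).2⟩) hEA hxd⟩
  · have h1 : volume (U₀ \ A) ≤ ENNReal.ofReal (4 * κ) :=
      lint_four_vol hL1 hΩ.measurableSet (hU₀o.measurableSet.diff hA)
        (fun x hx => hx.1.1) (fun x hx => by
          have := hx.1.2
          rw [indicator_of_notMem hx.2, sub_zero, abs_of_nonneg (by linarith [ht.1])]
          linarith [ht.1])
    calc volume ((U₀ ∪ ⋃ x ∈ u, ball x (6 * r x)) \ A)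
        ≤ volume ((U₀ \ A) ∪ ⋃ x ∈ u, ball x (6 * r x)) := by
          refine measure_mono ?_
          rw [union_sdiff_distrib]
          exact union_subset_union_right _ sdiff_subset
      _ ≤ ENNReal.ofReal (4 * κ) + ENNReal.ofReal (6 ^ N * vb N * (Cbox N * δ)) :=
          (measure_union_le _ _).trans (add_le_add h1 hvol)
      _ = ENNReal.ofReal (4 * κ + 6 ^ N * vb N * (Cbox N * δ)) :=
          (ENNReal.ofReal_add (by positivity) (by positivity)).symm
      _ ≤ _ := by
          refine ENNReal.ofReal_le_ofReal ?_
          have h2 : 0 ≤ (4 + 10 * Lr + 2 * Lr * N * vb N * 6 ^ N * Cbox N) * δ := by positivity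
          unfold Qc
          linarith
  · intro ψ hψ
    refine (hIntg ψ hψ).trans ?_
    have h2 : 0 ≤ 6 ^ N * vb N * Cbox N * δ := by positivity
    have h3 : Lr * (5 * (δ + κ)) ≤ Lr * (10 * δ) := by
      refine mul_le_mul_of_nonneg_left ?_ hL.le
      linarith
    unfold Qc
    linarith

lemma ae_density (A : Set (Euc N)) : ∀ᵐ x ∂(volume.restrict A), HasDensity A x 1 := by
  filter_upwards [Besicovitch.ae_tendsto_measure_inter_div (volume : Measure (Euc N)) A] with x hx
  unfold HasDensity
  rw [ENNReal.ofReal_one]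
  refine hx.congr' ?_
  filter_upwards [self_mem_nhdsWithin] with ρ hρ
  have hb : (ball x ρ : Set (Euc N)) =ᵐ[volume] closedBall x ρ := by
    refine ae_eq_of_subset_of_measure_ge ball_subset_closedBall ?_
      measurableSet_ball.nullMeasurableSet measure_closedBall_lt_top.ne
    rw [Measure.addHaar_closedBall _ _ (le_of_lt hρ), Measure.addHaar_ball_of_pos _ _ hρ]
  rw [measure_congr hb, measure_congr ((ae_eq_refl A).inter hb)]

lemma main_meas {Ω A : Set (Euc N)} (hΩ : IsOpen Ω) (hA : MeasurableSet A) (hAΩ : A ⊆ Ω)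
    (hper : perimeter A Ω < ⊤) {ε : ℝ} (hε : 0 < ε) :
    ∃ U : Set (Euc N), IsOpen U ∧ U ⊆ Ω ∧ densityOne A Ω ⊆ U ∧
      volume (U \ A) < ENNReal.ofReal ε ∧
      perimeter U Ω < perimeter A Ω + ENNReal.ofReal ε ∧
      perimeter A Ω < perimeter U Ω + ENNReal.ofReal ε := by
  obtain ⟨φ, hφ, hφδ⟩ := exists_testVF hper (half_pos hε)
  obtain ⟨D, hD0, hD⟩ := diverg_bound hφ.1 hφ.2.1
  have hQ := Qc_pos N
  set δ := ε / (2 * (Qc N * (1 + D))) with hδdef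
  have hδ : 0 < δ := by positivity
  have hδ1 : Qc N * δ * (1 + D) = ε / 2 := by rw [hδdef]; field_simp
  have hQδ : 0 < Qc N * δ := by positivity
  have h0 : 0 ≤ D * (Qc N * δ) := by positivity
  have hQε : Qc N * δ < ε := by linarith
  obtain ⟨U, hU, hUΩ, hdU, hvol, hIntg⟩ := core hΩ hA hAΩ hper hδ
  have hP : ENNReal.ofReal (perimeter A Ω).toReal = perimeter A Ω := ENNReal.ofReal_toReal hper.ne
  have hpU : perimeter U Ω < perimeter A Ω + ENNReal.ofReal ε := by
    refine (perimeter_le_of hIntg).trans_lt ?_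
    rw [ENNReal.ofReal_add ENNReal.toReal_nonneg hQδ.le, hP]
    exact ENNReal.add_lt_add_left hper.ne ((ENNReal.ofReal_lt_ofReal_iff hε).2 hQε)
  refine ⟨U, hU, hUΩ, hdU, hvol.trans_lt ((ENNReal.ofReal_lt_ofReal_iff hε).2 hQε), hpU, ?_⟩
  have hpUt : perimeter U Ω < ⊤ := hpU.trans_le le_top
  have hAU : volume (A \ U) = 0 := by
    have h1 := ae_density A
    rw [ae_restrict_iff' hA] at h1
    refine measure_mono_null ?_ (ae_iff.1 h1)
    intro x hx hcon
    exact hx.2 (hdU ⟨hAΩ hx.1, hcon hx.1⟩)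
  have hi : Integrable (diverg φ) := diverg_integrable hφ.1 hφ.2.1
  have e1 : ∫ x in A, diverg φ x = ∫ x in A ∩ U, diverg φ x := by
    rw [← integral_inter_add_sdiff hU.measurableSet hi.integrableOn,
      setIntegral_measure_zero _ hAU, add_zero]
  have e2 : ∫ x in U, diverg φ x = (∫ x in U ∩ A, diverg φ x) + ∫ x in U \ A, diverg φ x :=
    (integral_inter_add_sdiff hA hi.integrableOn).symm
  have e3 : -(D * (Qc N * δ)) ≤ ∫ x in U \ A, diverg φ x := by
    have hfin : volume (U \ A) < ⊤ := hvol.trans_lt ENNReal.ofReal_lt_top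
    have h2 := norm_setIntegral_le_of_norm_le_const (f := diverg φ) hfin (fun x _ => hD x)
    rw [Real.norm_eq_abs] at h2
    have h3 : volume.real (U \ A) ≤ Qc N * δ := ENNReal.toReal_le_of_le_ofReal hQδ.le hvol
    have h4 := neg_abs_le (∫ x in U \ A, diverg φ x)
    have h5 := mul_le_mul_of_nonneg_left h3 hD0
    linarith
  have e4 := testVF_integral_le hpUt hφ
  have e5 : (perimeter A Ω).toReal < (perimeter U Ω).toReal + ε := by
    rw [inter_comm] at e1
    linarith
  rw [← hP, ← ENNReal.ofReal_toReal hpUt.ne, ← ENNReal.ofReal_add ENNReal.toReal_nonneg hε.le]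
  exact (ENNReal.ofReal_lt_ofReal_iff (by
    have : 0 ≤ (perimeter U Ω).toReal := ENNReal.toReal_nonneg
    linarith)).2 e5

lemma main_null (Ω : Set (Euc N)) (hΩ : IsOpen Ω)
    (A : Set (Euc N)) (hA : A ⊆ Ω) (hmA : NullMeasurableSet A volume)
    (hper : perimeter A Ω < ⊤) (ε : ℝ) (hε : 0 < ε) :
    ∃ U : Set (Euc N), IsOpen U ∧ U ⊆ Ω ∧ densityOne A Ω ⊆ U ∧
      volume (U \ A) < ENNReal.ofReal ε ∧
      perimeter U Ω < perimeter A Ω + ENNReal.ofReal ε ∧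
      perimeter A Ω < perimeter U Ω + ENNReal.ofReal ε := by
  obtain ⟨B, hBA, hB, hBe⟩ := hmA.exists_measurable_subset_ae_eq
  have hp : perimeter B Ω = perimeter A Ω := by
    unfold perimeter
    have h : ∀ φ : Euc N → Euc N, ∫ x in B, diverg φ x = ∫ x in A, diverg φ x := fun φ =>
      setIntegral_congr_set hBe
    simp_rw [h]
  have hd : densityOne B Ω = densityOne A Ω := by
    unfold densityOne HasDensity
    have : ∀ x ρ, volume (B ∩ ball x ρ) = volume (A ∩ ball x ρ) := fun x ρ =>
      measure_congr (hBe.inter (ae_eq_refl _))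
    simp_rw [this]
  obtain ⟨U, h1, h2, h3, h4, h5, h6⟩ := main_meas hΩ hB (hBA.trans hA) (hp ▸ hper) hε
  rw [hp] at h5 h6
  rw [hd] at h3
  exact ⟨U, h1, h2, h3, (measure_mono (sdiff_subset_sdiff_right hBA)).trans_lt h4, h5, h6⟩

/-- if `A ⊆ Ω` is a measurable set of finite perimeter in the open set `Ω`,
then for every `ε > 0` there is an open `U ⊆ Ω` with `A^{(1)} ⊆ U`, `λ^N(U \ A) < ε` and
`|P(U, Ω) − P(A, Ω)| < ε`. -/
theorem statement16 {N : ℕ} (Ω : Set (Euc N)) (hΩ : IsOpen Ω)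
    (A : Set (Euc N)) (hA : A ⊆ Ω) (hmA : NullMeasurableSet A volume)
    (hper : perimeter A Ω < ⊤) (ε : ℝ) (hε : 0 < ε) :
    ∃ U : Set (Euc N), IsOpen U ∧ U ⊆ Ω ∧ densityOne A Ω ⊆ U ∧
      volume (U \ A) < ENNReal.ofReal ε ∧
      perimeter U Ω < perimeter A Ω + ENNReal.ofReal ε ∧
      perimeter A Ω < perimeter U Ω + ENNReal.ofReal ε := by
  exact main_null Ω hΩ A hA hmA hper ε hε
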